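/- arXiv:2411.04601 — 2 statements merged into one kernel-verified Lean document; each statement's English description precedes it below -/
import Mathlib

section
/- If G is an outerplanar graph, then the matching complex M(G) is either contractible or homotopy equivalent to a wedge of spheres. -/
noncomputable section

/-- The geometric realization of a set of faces `K` (an abstract simplicial complex):
the space of convex-combination weight functions supported on a face. -/
def realization {α : Type*} (K : Set (Finset α)) : Type _ :=
  {f : α → ℝ // (∀ a, 0 ≤ f a) ∧ ∃ s ∈ K, Function.support f ⊆ ↑s ∧ ∑ a ∈ s, f a = 1}

instance realization.topologicalSpace {α : Type*} (K : Set (Finset α)) :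
    TopologicalSpace (realization K) :=
  instTopologicalSpaceSubtype

/-- The unreduced suspension of a space: the cylinder `X × [0,1]` together with two cone
points, gluing `X × {0}` to one and `X × {1}` to the other.  (With this definition, the
suspension of the empty space is the two-point space `S⁰`.) -/
def Susp (X : Type*) [TopologicalSpace X] : Type _ :=
  Quot (fun (p q : (X × Set.Icc (0:ℝ) 1) ⊕ Bool) =>
    match p, q with
    | Sum.inl p, Sum.inr b => ((p.2 : ℝ) = 0 ∧ b = false) ∨ ((p.2 : ℝ) = 1 ∧ b = true)
    | _, _ => False)

instance Susp.topologicalSpace (X : Type*) [TopologicalSpace X] :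
    TopologicalSpace (Susp X) := by
  unfold Susp; infer_instance

/-- The wedge sum of two pointed spaces. -/
def Wedge (X : Type*) (Y : Type*) [TopologicalSpace X] [TopologicalSpace Y]
    (x : X) (y : Y) : Type _ :=
  Quot (fun (a b : X ⊕ Y) => a = Sum.inl x ∧ b = Sum.inr y)

instance Wedge.topologicalSpace (X : Type*) (Y : Type*) [TopologicalSpace X]
    [TopologicalSpace Y] (x : X) (y : Y) : TopologicalSpace (Wedge X Y x y) := by
  unfold Wedge; infer_instance

/-- The `n`-sphere, as the unit sphere in `ℝ^(n+1)`. -/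
def nSphere (n : ℕ) : Type :=
  Metric.sphere (0 : EuclideanSpace ℝ (Fin (n + 1))) 1

instance nSphere.topologicalSpace (n : ℕ) : TopologicalSpace (nSphere n) := by
  unfold nSphere; infer_instance

/-- A basepoint on the `n`-sphere. -/
def spherePt (n : ℕ) : nSphere n :=
  ⟨EuclideanSpace.single 0 1, by simp [EuclideanSpace.norm_single]⟩

/-- The wedge of a family of spheres, of dimensions `n i`. -/
def WedgeOfSpheres {ι : Type} (n : ι → ℕ) : Type :=
  Quot (fun (a b : Σ i, nSphere (n i)) =>
    ∃ i j, a = ⟨i, spherePt (n i)⟩ ∧ b = ⟨j, spherePt (n j)⟩)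

instance WedgeOfSpheres.topologicalSpace {ι : Type} (n : ι → ℕ) :
    TopologicalSpace (WedgeOfSpheres n) := by
  unfold WedgeOfSpheres; infer_instance

/-- A space is (homotopy equivalent to) a wedge of spheres if it is homotopy equivalent to a
wedge of finitely many spheres of possibly varying dimensions. -/
def IsWedgeOfSpheres (X : Type*) [TopologicalSpace X] : Prop :=
  ∃ (k : ℕ) (n : Fin k → ℕ), Nonempty (ContinuousMap.HomotopyEquiv X (WedgeOfSpheres n))
/-- The matching complex of a simple graph: faces are finite sets of pairwise disjoint edges. -/
def matchingComplex {V : Type*} (G : SimpleGraph V) : Set (Finset (Sym2 V)) :=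
  {s | (∀ e ∈ s, e ∈ G.edgeSet) ∧ ∀ e ∈ s, ∀ f ∈ s, e ≠ f → ∀ v, v ∈ e → v ∉ f}

/-- The open edge neighborhood `EN(e)`: the set of edges of `G` adjacent to (sharing a vertex
with) `e`, other than `e` itself. -/
def edgeNbhdOpen {V : Type*} (G : SimpleGraph V) (e : Sym2 V) : Set (Sym2 V) :=
  {f | f ∈ G.edgeSet ∧ f ≠ e ∧ ∃ v, v ∈ e ∧ v ∈ f}

/-- The closed edge neighborhood `EN[e]`: the set of edges of `G` sharing a vertex with `e`,
together with `e` itself. -/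
def edgeNbhdClosed {V : Type*} (G : SimpleGraph V) (e : Sym2 V) : Set (Sym2 V) :=
  {f | f ∈ G.edgeSet ∧ ∃ v, v ∈ e ∧ v ∈ f}

/-- Two chords of a circle, with endpoints at circle positions `a, b` and `c, d`
(positions measured injectively along the circle), cross iff their endpoints interleave. -/
def chordsCross (a b c d : ℝ) : Prop :=
  (min a b < min c d ∧ min c d < max a b ∧ max a b < max c d) ∨
  (min c d < min a b ∧ min a b < max c d ∧ max c d < max a b)

/-- A graph is outerplanar iff it has a drawing with all vertices (injectively) on a circle
and edges drawn as pairwise noncrossing chords; equivalently, a planar drawing with every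
vertex on the unbounded face. -/
def Outerplanar {V : Type*} (G : SimpleGraph V) : Prop :=
  ∃ f : V ↪ ℝ, ∀ a b c d, G.Adj a b → G.Adj c d →
    a ≠ c → a ≠ d → b ≠ c → b ≠ d → ¬ chordsCross (f a) (f b) (f c) (f d)

/-- An outerplanar graph is maximal outerplanar if adding any edge destroys outerplanarity. -/
def MaximalOuterplanar {V : Type*} (G : SimpleGraph V) : Prop :=
  Outerplanar G ∧ ∀ a b : V, a ≠ b → ¬ G.Adj a b →
    ¬ Outerplanar (G ⊔ SimpleGraph.fromEdgeSet {s(a, b)})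
/-- A cutpoint (cut-vertex) of a graph: a vertex whose removal disconnects two vertices that
were connected, i.e. whose removal increases the number of connected components. -/
def IsCutvertex {V : Type*} (G : SimpleGraph V) (v : V) : Prop :=
  ∃ a b : {u : V // u ≠ v}, G.Reachable a.1 b.1 ∧
    ¬ (G.induce {u : V | u ≠ v}).Reachable ⟨a.1, a.2⟩ ⟨b.1, b.2⟩

/-- A block of `G`: a maximal connected subgraph having no cutpoint of itself. -/
def IsBlock {V : Type*} (G : SimpleGraph V) (H : G.Subgraph) : Prop :=
  H.Connected ∧ (∀ v, ¬ IsCutvertex H.coe v) ∧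
    ∀ H' : G.Subgraph, H ≤ H' → H'.Connected → (∀ v, ¬ IsCutvertex H'.coe v) → H' = H

/-- The block-cutpoint graph of `G`: the bipartite graph on blocks and cutpoints of `G`,
with a block `B` adjacent to a cutpoint `c` iff `c` belongs to `B`. -/
def blockCutpointGraph {V : Type*} (G : SimpleGraph V) :
    SimpleGraph ({H : G.Subgraph // IsBlock G H} ⊕ {v : V // IsCutvertex G v}) :=
  SimpleGraph.fromRel (fun x y =>
    ∃ B c, x = Sum.inl B ∧ y = Sum.inr c ∧ c.1 ∈ B.1.verts)

/-- A cycle (given as a closed walk) is chordless if every edge of `G` joining two of its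
vertices is an edge of the cycle.  In an outerplanar graph drawn with all vertices on the
unbounded face, the basic cycles (boundaries of the bounded faces) are exactly the
chordless cycles. -/
def Chordless {V : Type*} (G : SimpleGraph V) {v : V} (p : G.Walk v v) : Prop :=
  ∀ a ∈ p.support, ∀ b ∈ p.support, G.Adj a b → s(a, b) ∈ p.edges

/-- The basic cycles of (an outerplanar graph) `G`, recorded by their edge sets. -/
def basicCycles {V : Type*} [DecidableEq V] (G : SimpleGraph V) : Set (Finset (Sym2 V)) :=
  {s | ∃ (v : V) (p : G.Walk v v), p.IsCycle ∧ Chordless G p ∧ s = p.edges.toFinset}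

/-- The weak dual of (an outerplanar graph) `G`: vertices are the basic cycles (bounded
faces), two being adjacent iff they share at least one edge. -/
def weakDual {V : Type*} [DecidableEq V] (G : SimpleGraph V) :
    SimpleGraph (basicCycles G) :=
  SimpleGraph.fromRel (fun s t => ((s.1 ∩ t.1) : Finset (Sym2 V)).Nonempty)

/-- A multigraph on vertex set `V`: an edge index type together with an assignment of
(unordered pairs of) endpoints. -/
structure Multigraph (V : Type u) : Type (max u (v + 1)) where
  E : Type v
  ends : E → Sym2 V

/-- The matching complex of a multigraph: faces are finite sets of pairwise
vertex-disjoint edges. -/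
def Multigraph.matchingComplex {V : Type*} (M : Multigraph V) : Set (Finset M.E) :=
  {s | ∀ i ∈ s, ∀ j ∈ s, i ≠ j → ∀ v, v ∈ M.ends i → v ∉ M.ends j}

namespace MCO

open unitInterval ContinuousMap Topology

/-! ### Mapping cones -/

/-- Clamp a real number to the unit interval. -/
def cl (x : ℝ) : I := Set.projIcc 0 1 zero_le_one x

lemma continuous_cl : Continuous cl := continuous_projIcc (h := zero_le_one)

lemma cl_nonpos {x : ℝ} (h : x ≤ 0) : cl x = 0 := Set.projIcc_of_le_left _ h

lemma cl_ge {x : ℝ} (h : 1 ≤ x) : cl x = 1 := Set.projIcc_of_right_le _ h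

@[simp] lemma cl_coe (t : I) : cl (t : ℝ) = t := Set.projIcc_val _ t

section cone

variable {A : Type*} {B : Type*} {X : Type*} [TopologicalSpace A] [TopologicalSpace B]
  [TopologicalSpace X]

inductive ConeRel (f : C(A, B)) : (A × I) ⊕ (B ⊕ Unit) → (A × I) ⊕ (B ⊕ Unit) → Prop
  | bot (a : A) : ConeRel f (Sum.inl (a, 0)) (Sum.inr (Sum.inl (f a)))
  | top (a : A) : ConeRel f (Sum.inl (a, 1)) (Sum.inr (Sum.inr ()))

/-- The mapping cone of a continuous map. -/
def MCone (f : C(A, B)) : Type _ := Quot (ConeRel f)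

instance (f : C(A, B)) : TopologicalSpace (MCone f) :=
  inferInstanceAs (TopologicalSpace (Quot (ConeRel f)))

def cyl (f : C(A, B)) (a : A) (t : I) : MCone f := Quot.mk _ (Sum.inl (a, t))
def inB (f : C(A, B)) (b : B) : MCone f := Quot.mk _ (Sum.inr (Sum.inl b))
def apex (f : C(A, B)) : MCone f := Quot.mk _ (Sum.inr (Sum.inr ()))

lemma cyl_zero (f : C(A, B)) (a : A) : cyl f a 0 = inB f (f a) := Quot.sound (ConeRel.bot a)
lemma cyl_one (f : C(A, B)) (a : A) : cyl f a 1 = apex f := Quot.sound (ConeRel.top a)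

lemma continuous_cyl (f : C(A, B)) : Continuous fun p : A × I => cyl f p.1 p.2 :=
  continuous_quot_mk.comp continuous_inl

lemma continuous_inB (f : C(A, B)) : Continuous (inB f) :=
  continuous_quot_mk.comp (continuous_inr.comp continuous_inl)

lemma continuous_cyl' {Z : Type*} [TopologicalSpace Z] (f : C(A, B)) {u : Z → A} {v : Z → I}
    (hu : Continuous u) (hv : Continuous v) : Continuous fun z => cyl f (u z) (v z) :=
  (continuous_cyl f).comp (hu.prodMk hv)

/-- Maps out of the mapping cone. -/
def desc {f : C(A, B)} (h : A → I → X) (g : B → X) (p : X)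
    (hc : Continuous fun q : A × I => h q.1 q.2) (gc : Continuous g)
    (h0 : ∀ a, h a 0 = g (f a)) (h1 : ∀ a, h a 1 = p) : C(MCone f, X) where
  toFun := Quot.lift (Sum.elim (fun q => h q.1 q.2) (Sum.elim g (fun _ => p))) (by
    rintro _ _ (a | a)
    · exact h0 a
    · exact h1 a)
  continuous_toFun := continuous_quot_lift _
    (continuous_sumElim.2 ⟨hc, continuous_sumElim.2 ⟨gc, continuous_const⟩⟩)

@[simp] lemma desc_cyl {f : C(A, B)} (h : A → I → X) (g : B → X) (p : X) (hc gc h0 h1) (a t) :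
    desc (f := f) h g p hc gc h0 h1 (cyl f a t) = h a t := rfl
@[simp] lemma desc_inB {f : C(A, B)} (h : A → I → X) (g : B → X) (p : X) (hc gc h0 h1) (b) :
    desc (f := f) h g p hc gc h0 h1 (inB f b) = g b := rfl
@[simp] lemma desc_apex {f : C(A, B)} (h : A → I → X) (g : B → X) (p : X) (hc gc h0 h1) :
    desc (f := f) h g p hc gc h0 h1 (apex f) = p := rfl

lemma cone_ind {f : C(A, B)} {P : MCone f → Prop} (h : ∀ a t, P (cyl f a t))
    (g : ∀ b, P (inB f b)) (p : P (apex f)) : ∀ z, P z := by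
  rintro ⟨⟨a, t⟩ | b | ⟨⟩⟩
  · exact h a t
  · exact g b
  · exact p

/-- Homotopies of maps out of the mapping cone. -/
lemma cone_homotopic {f : C(A, B)} (u v : C(MCone f, X)) (h : I → A → I → X) (g : I → B → X)
    (p : I → X)
    (hc : Continuous fun q : I × A × I => h q.1 q.2.1 q.2.2)
    (gc : Continuous fun q : I × B => g q.1 q.2) (pc : Continuous p)
    (h0 : ∀ s a, h s a 0 = g s (f a)) (h1 : ∀ s a, h s a 1 = p s)
    (uh : ∀ a t, h 0 a t = u (cyl f a t)) (ug : ∀ b, g 0 b = u (inB f b)) (up : p 0 = u (apex f))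
    (vh : ∀ a t, h 1 a t = v (cyl f a t)) (vg : ∀ b, g 1 b = v (inB f b))
    (vp : p 1 = v (apex f)) : u.Homotopic v := by
  let H : C(A × I, C(I, X)) := ContinuousMap.curry
    ⟨fun q : (A × I) × I => h q.2 q.1.1 q.1.2, by
      exact hc.comp (by fun_prop : Continuous fun q : (A × I) × I => (q.2, q.1.1, q.1.2))⟩
  let g' : C(B, C(I, X)) := ContinuousMap.curry
    ⟨fun q : B × I => g q.2 q.1, gc.comp (continuous_snd.prodMk continuous_fst)⟩
  let D : C(MCone f, C(I, X)) := desc (fun a t => H (a, t)) g' ⟨p, pc⟩ H.continuous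
    g'.continuous (fun a => by ext s; exact h0 s a) (fun a => by ext s; exact h1 s a)
  refine ⟨⟨⟨fun q => D q.2 q.1, ?_⟩, ?_, ?_⟩⟩
  · have := (ContinuousMap.uncurry D).continuous
    exact this.comp (continuous_snd.prodMk continuous_fst)
  · refine cone_ind ?_ ?_ ?_
    · intro a t; exact uh a t
    · intro b; exact ug b
    · exact up
  · refine cone_ind ?_ ?_ ?_
    · intro a t; exact vh a t
    · intro b; exact vg b
    · exact vp

/-- A continuous map is a homotopy equivalence. -/
def IsHE (f : C(A, B)) : Prop :=
  ∃ g : C(B, A), (g.comp f).Homotopic (ContinuousMap.id A) ∧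
    (f.comp g).Homotopic (ContinuousMap.id B)

lemma IsHE.nonempty {f : C(A, B)} (h : IsHE f) : Nonempty (A ≃ₕ B) := by
  obtain ⟨g, h1, h2⟩ := h
  exact ⟨⟨f, g, h1, h2⟩⟩

lemma IsHE.congr {f g : C(A, B)} (h : IsHE f) (hfg : f.Homotopic g) : IsHE g := by
  obtain ⟨k, h1, h2⟩ := h
  exact ⟨k, ((Homotopic.refl k).comp hfg.symm).trans h1, (hfg.symm.comp (Homotopic.refl k)).trans h2⟩

lemma IsHE.of_two {f : C(A, B)} {g k : C(B, A)} (h1 : (g.comp f).Homotopic (ContinuousMap.id A))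
    (h2 : (f.comp k).Homotopic (ContinuousMap.id B)) : IsHE f := by
  refine ⟨g, h1, ?_⟩
  have e1 : g.Homotopic k := by
    have a := (Homotopic.refl g).comp h2
    have b := h1.comp (Homotopic.refl k)
    rw [ContinuousMap.id_comp] at b
    rw [ContinuousMap.comp_id, ← ContinuousMap.comp_assoc] at a
    exact a.symm.trans b
  exact ((Homotopic.refl f).comp e1).trans h2

/-- A weak form of the two-out-of-six property. -/
lemma IsHE.two_of_six {C D : Type*} [TopologicalSpace C] [TopologicalSpace D]
    {f : C(A, B)} {g : C(B, C)} {h : C(C, D)} (h1 : IsHE (g.comp f)) (h2 : IsHE (h.comp g)) :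
    IsHE f := by
  obtain ⟨u, hu1, hu2⟩ := h1
  obtain ⟨v, hv1, hv2⟩ := h2
  refine IsHE.of_two (g := u.comp g) (k := u.comp g) ?_ ?_
  · rwa [ContinuousMap.comp_assoc]
  · -- `g` has left inverse `v h`; `g (f u g) ≃ g`
    have a : (g.comp (f.comp (u.comp g))).Homotopic g := by
      have := hu2.comp (Homotopic.refl g)
      simpa [ContinuousMap.comp_assoc] using this
    have b := (Homotopic.refl (v.comp h)).comp a
    have c := hv1.comp (Homotopic.refl (f.comp (u.comp g)))
    rw [ContinuousMap.id_comp] at c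
    have d : ((v.comp h).comp (g.comp (f.comp (u.comp g)))).Homotopic (f.comp (u.comp g)) := by
      simpa [ContinuousMap.comp_assoc] using c
    have e : ((v.comp h).comp g).Homotopic (ContinuousMap.id B) := by
      simpa [ContinuousMap.comp_assoc] using hv1
    exact d.symm.trans (b.trans e)

end cone

section coneinv

variable {A : Type*} {B : Type*} {B' : Type*} [TopologicalSpace A] [TopologicalSpace B]
  [TopologicalSpace B']

/-- The map of cones induced by a homotopy of attaching maps. -/
def coneT {f g : C(A, B)} (F : Homotopy f g) : C(MCone f, MCone g) :=
  desc (fun a t => if 2 * (t : ℝ) ≤ 1 then inB g (F (cl (2 * t), a)) else cyl g a (cl (2 * t - 1)))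
    (inB g) (apex g)
    (by
      refine Continuous.if_le ?_ ?_ (by fun_prop) (by fun_prop) ?_
      · exact (continuous_inB g).comp (F.continuous.comp
          ((continuous_cl.comp (by fun_prop)).prodMk (by fun_prop)))
      · exact continuous_cyl' g (by fun_prop) (continuous_cl.comp (by fun_prop))
      · intro q hq
        rw [hq, cl_ge le_rfl, F.apply_one, cl_nonpos (by simp), cyl_zero])
    (continuous_inB g)
    (fun a => by simp [cl_nonpos])
    (fun a => by
      have : ¬ ((2 : ℝ) * ((1 : I) : ℝ) ≤ 1) := by norm_num
      rw [if_neg this, cl_ge (by norm_num), cyl_one])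

lemma coneT_coneT {f g : C(A, B)} (F : Homotopy f g) :
    ((coneT F.symm).comp (coneT F)).Homotopic (ContinuousMap.id _) := by
  refine Homotopic.symm ?_
  refine cone_homotopic _ _
    (fun s a t => if (1 + 3 * (s : ℝ)) * t ≤ 3 * s then
      inB f (F (cl (min ((1 + 3 * (s : ℝ)) * t / 2) (3 * s - (1 + 3 * (s : ℝ)) * t)), a))
      else cyl f a (cl ((1 + 3 * (s : ℝ)) * t - 3 * s)))
    (fun _ b => inB f b) (fun _ => apex f) ?_ ?_ continuous_const ?_ ?_ ?_ ?_ ?_ ?_ ?_ ?_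
  · refine Continuous.if_le ?_ ?_ (by fun_prop) (by fun_prop) ?_
    · exact (continuous_inB f).comp (F.continuous.comp
          ((continuous_cl.comp (by fun_prop)).prodMk (by fun_prop)))
    · exact continuous_cyl' f (by fun_prop) (continuous_cl.comp (by fun_prop))
    · intro q hq
      rw [hq, cl_nonpos (by simp), F.apply_zero, cl_nonpos (by simp), cyl_zero]
  · exact (continuous_inB f).comp continuous_snd
  · intro s a
    have := s.2.1
    rw [if_pos (by simpa using this), cl_nonpos (by simp), F.apply_zero]
  · intro s a
    have h : ¬ ((1 + 3 * (s : ℝ)) * ((1 : I) : ℝ) ≤ 3 * s) := by simp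
    rw [if_neg h, cl_ge (by simp), cyl_one]
  · intro a t
    by_cases h : (t : ℝ) ≤ 0
    · have h' : t = 0 := Subtype.ext (le_antisymm h t.2.1)
      subst h'
      simp [cyl_zero, cl_nonpos]
    · simp [h]
  · intro b; rfl
  · rfl
  · intro a t
    have e1 : (1 + 3 * ((1 : I) : ℝ)) = 4 := by norm_num
    simp only [e1, coneT, ContinuousMap.comp_apply, desc_cyl]
    by_cases h : 2 * (t : ℝ) ≤ 1
    · rw [if_pos h, desc_inB, if_pos (by norm_num; linarith)]
      congr 3
      rw [min_eq_left (by norm_num; linarith)]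
      congr 1; ring
    · rw [if_neg h, desc_cyl]
      push Not at h
      have hcl : ((cl (2 * (t : ℝ) - 1) : I) : ℝ) = 2 * t - 1 := by
        have := t.2.2
        simp only [cl, Set.coe_projIcc]
        rw [min_eq_right (by linarith), max_eq_right (by linarith)]
      rw [hcl]
      by_cases h2 : 2 * (2 * (t : ℝ) - 1) ≤ 1
      · rw [if_pos h2, if_pos (by norm_num; linarith), Homotopy.symm_apply]
        congr 3
        rw [min_eq_right (by norm_num; linarith)]
        apply Subtype.ext
        simp only [cl, Set.coe_projIcc, unitInterval.coe_symm_eq]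
        rw [min_eq_right, max_eq_right, min_eq_right, max_eq_right] <;> norm_num <;> linarith
      · rw [if_neg h2, if_neg (by norm_num; linarith)]
        congr 2; norm_num; ring
  · intro b; rfl
  · rfl

lemma coneT_isHE {f g : C(A, B)} (F : Homotopy f g) : IsHE (coneT F) := by
  refine ⟨coneT F.symm, coneT_coneT F, ?_⟩
  have := coneT_coneT F.symm
  rwa [Homotopy.symm_symm] at this

/-- Pushforward along a map of the target. -/
def coneMap {f : C(A, B)} (φ : C(B, B')) (g : C(A, B')) (h : g = φ.comp f) :
    C(MCone f, MCone g) :=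
  desc (fun a t => cyl g a t) (fun b => inB g (φ b)) (apex g) (continuous_cyl g)
    ((continuous_inB g).comp φ.continuous) (fun a => by rw [cyl_zero, h]; rfl)
    (fun a => cyl_one g a)

lemma coneMap_isHE_of_homotopic_id {f : C(A, B)} (φ : C(B, B)) (g : C(A, B)) (h : g = φ.comp f)
    (H : (ContinuousMap.id B).Homotopic φ) : IsHE (coneMap φ g h) := by
  obtain ⟨η⟩ := H
  let F : Homotopy f g := (η.compContinuousMap f).cast (by simp) h.symm
  have hF : ∀ q, F q = η (q.1, f q.2) := fun q => rfl
  refine (coneT_isHE F).congr ?_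
  have h0 : ∀ a, g a = η (1, f a) := fun a => by rw [h]; simp
  refine cone_homotopic _ _
    (fun s a t => if (2 - (s : ℝ)) * t ≤ 1 - s then
      inB g (η (cl (s + (2 - (s : ℝ)) * t), f a))
      else cyl g a (cl ((2 - (s : ℝ)) * t - (1 - s))))
    (fun s b => inB g (η (s, b))) (fun _ => apex g) ?_ ?_ continuous_const ?_ ?_ ?_ ?_ ?_ ?_ ?_ ?_
  · refine Continuous.if_le ?_ ?_ (by fun_prop) (by fun_prop) ?_
    · exact (continuous_inB g).comp (η.continuous.comp
          ((continuous_cl.comp (by fun_prop)).prodMk (by fun_prop)))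
    · exact continuous_cyl' g (by fun_prop) (continuous_cl.comp (by fun_prop))
    · intro q hq
      rw [hq, cl_ge (by linarith), cl_nonpos (by linarith), cyl_zero, h0]
  · exact (continuous_inB g).comp η.continuous
  · intro s a
    have := s.2.2
    rw [if_pos (by simpa using this)]
    simp
  · intro s a
    have h : ¬ ((2 - (s : ℝ)) * ((1 : I) : ℝ) ≤ 1 - s) := by
      simp
    rw [if_neg h, cl_ge (by simp; linarith), cyl_one]
  · intro a t
    simp [coneT, hF]
  · intro b; simp [coneT]
  · rfl
  · intro a t
    have e1 : (2 - ((1 : I) : ℝ)) = 1 := by norm_num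
    simp only [e1, coneMap, desc_cyl]
    by_cases h : (t : ℝ) ≤ 0
    · have h' : t = 0 := Subtype.ext (le_antisymm h t.2.1)
      subst h'
      rw [if_pos (by simp), cyl_zero, h0, cl_ge (by simp)]
    · rw [if_neg (by simpa using h)]; simp
  · intro b; simp [coneMap]
  · rfl

lemma coneMap_isHE {f : C(A, B)} (φ : C(B, B')) (hφ : IsHE φ) :
    IsHE (coneMap (f := f) φ (φ.comp f) rfl) := by
  obtain ⟨ψ, h1, h2⟩ := hφ
  refine IsHE.two_of_six (g := coneMap ψ (ψ.comp (φ.comp f)) rfl)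
    (h := coneMap φ (φ.comp (ψ.comp (φ.comp f))) rfl) ?_ ?_
  · have := coneMap_isHE_of_homotopic_id (f := f) (ψ.comp φ) (ψ.comp (φ.comp f)) rfl h1.symm
    have e : (coneMap ψ (ψ.comp (φ.comp f)) rfl).comp (coneMap (f := f) φ (φ.comp f) rfl) =
        coneMap (ψ.comp φ) (ψ.comp (φ.comp f)) rfl := by
      ext z
      revert z
      exact cone_ind (fun _ _ => rfl) (fun _ => rfl) rfl
    rwa [e]
  · have := coneMap_isHE_of_homotopic_id (f := φ.comp f) (φ.comp ψ) (φ.comp (ψ.comp (φ.comp f)))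
      rfl h2.symm
    have e : (coneMap φ (φ.comp (ψ.comp (φ.comp f))) rfl).comp
        (coneMap (f := φ.comp f) ψ (ψ.comp (φ.comp f)) rfl) =
        coneMap (φ.comp ψ) (φ.comp (ψ.comp (φ.comp f))) rfl := by
      ext z
      revert z
      exact cone_ind (fun _ _ => rfl) (fun _ => rfl) rfl
    rwa [e]

/-- Mapping cone is invariant under change of the target. -/
lemma cone_target (f : C(A, B)) (e : B ≃ₕ B') : Nonempty (MCone f ≃ₕ MCone (e.toFun.comp f)) :=
  (coneMap_isHE e.toFun ⟨e.invFun, e.left_inv, e.right_inv⟩).nonempty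

lemma cone_homotopy {f g : C(A, B)} (h : f.Homotopic g) : Nonempty (MCone f ≃ₕ MCone g) := by
  obtain ⟨F⟩ := h
  exact (coneT_isHE F).nonempty

/-- Mapping cones of constant maps: change of source. -/
def coneSrc {A' : Type*} [TopologicalSpace A'] (α : C(A, A')) (b : B) :
    C(MCone (ContinuousMap.const A b), MCone (ContinuousMap.const A' b)) :=
  desc (fun a t => cyl _ (α a) t) (fun b => inB _ b) (apex _)
    (continuous_cyl' _ (by fun_prop) (by fun_prop))
    (continuous_inB _) (fun a => by rw [cyl_zero]; rfl)
    (fun a => cyl_one _ _)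

lemma coneSrc_homotopic {A' : Type*} [TopologicalSpace A'] {α β : C(A, A')} (b : B)
    (h : α.Homotopic β) : (coneSrc α b).Homotopic (coneSrc β b) := by
  obtain ⟨F⟩ := h
  refine cone_homotopic _ _ (fun s a t => cyl _ (F (s, a)) t) (fun _ b => inB _ b)
    (fun _ => apex _) ?_ ?_ continuous_const ?_ ?_ ?_ ?_ ?_ ?_ ?_ ?_
  · exact continuous_cyl' _ (F.continuous.comp (by fun_prop)) (by fun_prop)
  · exact (continuous_inB _).comp continuous_snd
  · intro s a; rw [cyl_zero]; rfl
  · intro s a; rw [cyl_one]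
  all_goals simp [coneSrc]

lemma cone_source {A' : Type*} [TopologicalSpace A'] (e : A ≃ₕ A') (b : B) :
    Nonempty (MCone (ContinuousMap.const A b) ≃ₕ MCone (ContinuousMap.const A' b)) := by
  have idl : ∀ (Z : Type _) [TopologicalSpace Z], coneSrc (ContinuousMap.id Z) b =
      ContinuousMap.id (MCone (ContinuousMap.const Z b)) := by
    intro Z _
    ext z
    revert z
    exact cone_ind (fun _ _ => rfl) (fun _ => rfl) rfl
  have idl' : coneSrc (ContinuousMap.id A') b =
      ContinuousMap.id (MCone (ContinuousMap.const A' b)) := by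
    ext z
    revert z
    exact cone_ind (fun _ _ => rfl) (fun _ => rfl) rfl
  refine ⟨⟨coneSrc e.toFun b, coneSrc e.invFun b, ?_, ?_⟩⟩
  · have := coneSrc_homotopic b e.left_inv
    rw [idl] at this
    convert this using 1
    ext z
    revert z
    exact cone_ind (fun _ _ => rfl) (fun _ => rfl) rfl
  · have := coneSrc_homotopic b e.right_inv
    rw [idl'] at this
    convert this using 1
    ext z
    revert z
    exact cone_ind (fun _ _ => rfl) (fun _ => rfl) rfl

/-- Attaching a whisker does not change the homotopy type. -/
lemma cone_whisker (b : B) : Nonempty (MCone (ContinuousMap.const Unit b) ≃ₕ B) := by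
  let r : C(MCone (ContinuousMap.const Unit b), B) :=
    desc (fun _ _ => b) id b continuous_const continuous_id (fun _ => rfl) (fun _ => rfl)
  refine ⟨⟨r, ⟨inB _, continuous_inB _⟩, ?_, ?_⟩⟩
  · refine cone_homotopic _ _ (fun s a t => cyl _ a (s * t)) (fun _ b => inB _ b)
      (fun s => cyl _ () s) ?_ ?_ ?_ ?_ ?_ ?_ ?_ ?_ ?_ ?_ ?_
    · exact continuous_cyl' _ (by fun_prop) (by fun_prop)
    · exact (continuous_inB _).comp continuous_snd
    · exact continuous_cyl' _ (by fun_prop) (by fun_prop)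
    · intro s a; rw [mul_zero, cyl_zero]
    · intro s a; rw [mul_one]
    · intro a t; rw [zero_mul, cyl_zero]; rfl
    · intro b; rfl
    · rw [cyl_zero]; rfl
    · intro a t; rw [one_mul]; rfl
    · intro b; rfl
    · rw [cyl_one]; rfl
  · have : r.comp ⟨inB _, continuous_inB _⟩ = ContinuousMap.id B := by ext x; rfl
    rw [this]

lemma cone_contractible_source [ContractibleSpace A] (f : C(A, B)) :
    Nonempty (MCone f ≃ₕ B) := by
  obtain ⟨b, hb⟩ : f.Nullhomotopic := by
    have := (id_nullhomotopic A).comp_right f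
    rwa [ContinuousMap.comp_id] at this
  obtain ⟨e1⟩ := cone_homotopy hb
  obtain ⟨e2⟩ := cone_source (ContractibleSpace.hequiv_unit A).some b
  obtain ⟨e3⟩ := cone_whisker b
  exact ⟨(e1.trans e2).trans e3⟩

end coneinv

/-! ### Spheres -/

section sphere

/-- Coordinates of a point of a sphere. -/
def co {n : ℕ} (x : nSphere n) (i : Fin (n + 1)) : ℝ := (x.1 : EuclideanSpace ℝ (Fin (n + 1))) i

lemma co_sum {n : ℕ} (x : nSphere n) : ∑ i, co x i ^ 2 = 1 := by
  have h := x.2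
  rw [mem_sphere_zero_iff_norm] at h
  have := EuclideanSpace.norm_sq_eq (x.1 : EuclideanSpace ℝ (Fin (n + 1)))
  rw [h] at this
  simpa [co] using this.symm

/-- Construct a point of a sphere from coordinates. -/
def mkS {n : ℕ} (v : Fin (n + 1) → ℝ) (h : ∑ i, v i ^ 2 = 1) : nSphere n :=
  ⟨WithLp.toLp 2 v, by
    rw [mem_sphere_zero_iff_norm, EuclideanSpace.norm_eq]
    simp [h]⟩

@[simp] lemma co_mkS {n : ℕ} (v : Fin (n + 1) → ℝ) (h) (i) : co (mkS v h) i = v i := rfl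

lemma sph_ext {n : ℕ} {x y : nSphere n} (h : ∀ i, co x i = co y i) : x = y := by
  apply Subtype.ext
  ext i
  exact h i

lemma co_spherePt_zero (n : ℕ) : co (spherePt n) 0 = 1 := by
  simp [co, spherePt]

lemma co_spherePt_succ (n : ℕ) (i : Fin n) : co (spherePt n) i.succ = 0 := by
  simp [co, spherePt]

lemma continuous_co {n : ℕ} (i : Fin (n + 1)) : Continuous fun x : nSphere n => co x i := by
  have h : Continuous fun x : nSphere n => (x.1 : EuclideanSpace ℝ (Fin (n + 1))) :=
    continuous_subtype_val
  unfold co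
  fun_prop

lemma continuous_sph {n : ℕ} {Z : Type*} [TopologicalSpace Z] {u : Z → nSphere n}
    (h : ∀ i, Continuous fun z => co (u z) i) : Continuous u := by
  refine Continuous.subtype_mk (f := fun z => (u z).1) ?_ _
  have : (fun z => ((u z).1 : EuclideanSpace ℝ (Fin (n + 1)))) =
      fun z => WithLp.toLp 2 (fun i => co (u z) i) := by
    ext z i; rfl
  rw [this]
  fun_prop

instance (n : ℕ) : CompactSpace (nSphere n) :=
  inferInstanceAs (CompactSpace (Metric.sphere (0 : EuclideanSpace ℝ (Fin (n + 1))) 1))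

instance (n : ℕ) : T2Space (nSphere n) :=
  inferInstanceAs (T2Space (Metric.sphere (0 : EuclideanSpace ℝ (Fin (n + 1))) 1))

/-- The suspension coordinates on the sphere. -/
def sp {n : ℕ} (x : nSphere n) (t : I) : nSphere (n + 1) :=
  mkS (Fin.cons (Real.cos (Real.pi * t)) fun i => Real.sin (Real.pi * t) * co x i) (by
    rw [Fin.sum_univ_succ]
    simp only [Fin.cons_zero, Fin.cons_succ, mul_pow]
    rw [← Finset.mul_sum, co_sum, mul_one, Real.cos_sq_add_sin_sq])

@[simp] lemma co_sp_zero {n : ℕ} (x : nSphere n) (t : I) :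
    co (sp x t) 0 = Real.cos (Real.pi * t) := rfl
@[simp] lemma co_sp_succ {n : ℕ} (x : nSphere n) (t : I) (i : Fin (n + 1)) :
    co (sp x t) i.succ = Real.sin (Real.pi * t) * co x i := rfl

lemma sp_zero {n : ℕ} (x : nSphere n) : sp x 0 = spherePt (n + 1) := by
  apply sph_ext
  refine Fin.cases ?_ ?_
  · simp [co_spherePt_zero]
  · intro i; simp [co_spherePt_succ]

lemma sp_one {n : ℕ} (x y : nSphere n) : sp x 1 = sp y 1 := by
  apply sph_ext
  refine Fin.cases ?_ ?_
  · simp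
  · intro i; simp

lemma continuous_sp {n : ℕ} : Continuous fun q : nSphere n × I => sp q.1 q.2 := by
  apply continuous_sph
  refine Fin.cases ?_ ?_
  · simp only [co_sp_zero]; fun_prop
  · intro i
    simp only [co_sp_succ]
    exact (by fun_prop : Continuous fun q : nSphere n × I => Real.sin (Real.pi * q.2)).mul
      ((continuous_co i).comp continuous_fst)

lemma sp_surj {n : ℕ} : Function.Surjective fun q : nSphere n × I => sp q.1 q.2 := by
  intro y
  have hy := co_sum y
  rw [Fin.sum_univ_succ] at hy
  have hnn : 0 ≤ ∑ i : Fin (n + 1), co y i.succ ^ 2 := Finset.sum_nonneg fun i _ => sq_nonneg _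
  have h1 : co y 0 ≤ 1 := by nlinarith
  have h2 : -1 ≤ co y 0 := by nlinarith
  let t : I := ⟨Real.arccos (co y 0) / Real.pi, div_nonneg (Real.arccos_nonneg _) Real.pi_pos.le,
    (div_le_one Real.pi_pos).2 (Real.arccos_le_pi _)⟩
  have ht : Real.pi * (t : ℝ) = Real.arccos (co y 0) := by
    simp only [t]; field_simp
  have hs : Real.sin (Real.pi * t) ^ 2 = ∑ i : Fin (n + 1), co y i.succ ^ 2 := by
    rw [ht, Real.sin_sq, Real.cos_arccos h2 h1]; linarith
  by_cases h0 : Real.sin (Real.pi * t) = 0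
  · refine ⟨(spherePt n, t), ?_⟩
    apply sph_ext
    refine Fin.cases ?_ ?_
    · simp only [co_sp_zero]
      rw [ht, Real.cos_arccos h2 h1]
    · intro i
      simp only [co_sp_succ, h0, zero_mul]
      rw [h0] at hs
      have := (Finset.sum_eq_zero_iff_of_nonneg (fun i _ => sq_nonneg (co y (Fin.succ i)))).1
        (hs.symm.trans (by norm_num)) i (Finset.mem_univ i)
      exact (pow_eq_zero_iff two_ne_zero).1 this |>.symm
  · refine ⟨(mkS (fun i => co y i.succ / Real.sin (Real.pi * t)) ?_, t), ?_⟩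
    · simp only [div_pow]
      rw [← Finset.sum_div, ← hs, div_self (pow_ne_zero 2 h0)]
    apply sph_ext
    refine Fin.cases ?_ ?_
    · simp only [co_sp_zero]
      rw [ht, Real.cos_arccos h2 h1]
    · intro i
      simp only [co_sp_succ, co_mkS]
      field_simp

/-- The suspension coordinates as a bundled map. -/
def spC (n : ℕ) : C(nSphere n × I, nSphere (n + 1)) := ⟨fun q => sp q.1 q.2, continuous_sp⟩

lemma sp_quot (n : ℕ) : IsQuotientMap (spC n) :=
  IsQuotientMap.of_surjective_continuous sp_surj continuous_sp

lemma sp_factors {n : ℕ} {X : Type*} (k : nSphere n → I → X) (h0 : ∀ x y, k x 0 = k y 0)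
    (h1 : ∀ x y, k x 1 = k y 1) :
    Function.FactorsThrough (fun q : nSphere n × I => k q.1 q.2) (spC n) := by
  rintro ⟨x, t⟩ ⟨y, u⟩ h
  replace h : sp x t = sp y u := h
  have e0 : Real.cos (Real.pi * t) = Real.cos (Real.pi * u) := by
    rw [← co_sp_zero x t, ← co_sp_zero y u]; exact congrArg (fun z => co z 0) h
  have hpi := Real.pi_pos
  have mem : ∀ t : I, Real.pi * (t : ℝ) ∈ Set.Icc 0 Real.pi := fun t =>
    ⟨mul_nonneg hpi.le t.2.1, by nlinarith [t.2.2]⟩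
  have e1 : t = u := by
    have := Real.injOn_cos (mem t) (mem u) e0
    exact Subtype.ext (mul_left_cancel₀ hpi.ne' this)
  subst e1
  simp only
  by_cases ht0 : t = 0
  · subst ht0; exact h0 x y
  by_cases ht1 : t = 1
  · subst ht1; exact h1 x y
  have p0 : (0 : ℝ) < t := lt_of_le_of_ne t.2.1 (fun h => ht0 (Subtype.ext h.symm))
  have p1 : (t : ℝ) < 1 := lt_of_le_of_ne t.2.2 (fun h => ht1 (Subtype.ext h))
  have hs : Real.sin (Real.pi * t) ≠ 0 :=
    (Real.sin_pos_of_pos_of_lt_pi (by positivity) (by nlinarith)).ne'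
  have : x = y := by
    apply sph_ext
    intro i
    have := congrArg (fun z => co z i.succ) h
    simp only [co_sp_succ] at this
    exact mul_left_cancel₀ hs this
  rw [this]

/-- Maps out of the sphere, defined in suspension coordinates. -/
def sl {n : ℕ} {X : Type*} [TopologicalSpace X] (k : nSphere n → I → X)
    (hk : Continuous fun q : nSphere n × I => k q.1 q.2) (h0 : ∀ x y, k x 0 = k y 0)
    (h1 : ∀ x y, k x 1 = k y 1) : C(nSphere (n + 1), X) :=
  (sp_quot n).lift ⟨_, hk⟩ (sp_factors k h0 h1)

lemma sl_sp {n : ℕ} {X : Type*} [TopologicalSpace X] (k : nSphere n → I → X) (hk h0 h1) (x t) :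
    sl k hk h0 h1 (sp x t) = k x t := by
  have := (sp_quot n).lift_comp (⟨_, hk⟩ : C(nSphere n × I, X)) (sp_factors k h0 h1)
  exact DFunLike.congr_fun this (x, t)

/-- The homotopy of the sphere shrinking the half great circle from the pole to its opposite. -/
def rot {n : ℕ} (s : I) (y : nSphere (n + 1)) : nSphere (n + 1) :=
  mkS (Fin.cons (Real.cos (s * Real.arccos (co y 0)) * co y 0
        + Real.sin (s * Real.arccos (co y 0)) * co y (Fin.succ 0))
      (Fin.cons (Real.cos (s * Real.arccos (co y 0)) * co y (Fin.succ 0)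
        - Real.sin (s * Real.arccos (co y 0)) * co y 0)
      fun i => co y i.succ.succ)) (by
    have h := co_sum y
    rw [Fin.sum_univ_succ, Fin.sum_univ_succ] at h
    rw [Fin.sum_univ_succ, Fin.sum_univ_succ]
    simp only [Fin.cons_zero, Fin.cons_succ]
    have h2 := Real.cos_sq_add_sin_sq (s * Real.arccos (co y 0))
    rw [← h]
    linear_combination (co y 0 ^ 2 + co y (Fin.succ 0) ^ 2) * h2)

lemma continuous_rot {n : ℕ} : Continuous fun q : I × nSphere (n + 1) => rot q.1 q.2 := by
  have hc : ∀ i, Continuous fun q : I × nSphere (n + 1) => co q.2 i := fun i =>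
    (continuous_co i).comp continuous_snd
  have ha : Continuous fun q : I × nSphere (n + 1) => (q.1 : ℝ) * Real.arccos (co q.2 0) :=
    (by fun_prop : Continuous fun q : I × nSphere (n + 1) => (q.1 : ℝ)).mul
      (Real.continuous_arccos.comp (hc 0))
  apply continuous_sph
  refine Fin.cases ?_ (Fin.cases ?_ ?_)
  · exact ((Real.continuous_cos.comp ha).mul (hc 0)).add ((Real.continuous_sin.comp ha).mul (hc _))
  · exact ((Real.continuous_cos.comp ha).mul (hc _)).sub ((Real.continuous_sin.comp ha).mul (hc 0))
  · intro i; exact hc _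

lemma rot_zero {n : ℕ} (y : nSphere (n + 1)) : rot 0 y = y := by
  apply sph_ext
  refine Fin.cases ?_ (Fin.cases ?_ ?_)
  · simp [rot]
  · simp [rot]
  · intro i; simp [rot]

lemma rot_sp {n : ℕ} (s t : I) : rot s (sp (spherePt n) t) = sp (spherePt n) (σ s * t) := by
  have hpi := Real.pi_pos
  have h : Real.arccos (Real.cos (Real.pi * t)) = Real.pi * t :=
    Real.arccos_cos (mul_nonneg hpi.le t.2.1) (by nlinarith [t.2.2])
  have e : Real.pi * ((σ s * t : I) : ℝ) = Real.pi * t - s * (Real.pi * t) := by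
    simp; ring
  apply sph_ext
  refine Fin.cases ?_ (Fin.cases ?_ ?_)
  · rw [co_sp_zero, e, Real.cos_sub]
    simp only [rot, co_mkS, Fin.cons_zero, co_sp_zero, h, co_sp_succ, co_spherePt_zero]
    ring
  · rw [co_sp_succ, e, Real.sin_sub]
    simp only [rot, co_mkS, Fin.cons_zero, Fin.cons_succ, co_sp_zero, h, co_sp_succ,
      co_spherePt_zero]
    ring
  · intro i
    rw [co_sp_succ]
    simp only [rot, co_mkS, Fin.cons_succ, co_sp_succ, co_spherePt_succ]
    simp

lemma rot_pt {n : ℕ} (s : I) : rot s (spherePt (n + 1)) = spherePt (n + 1) := by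
  rw [← sp_zero (spherePt n), rot_sp, mul_zero]

lemma rot_sp_one {n : ℕ} (s : I) (x : nSphere n) : rot s (sp x 1) = sp (spherePt n) (σ s) := by
  rw [sp_one x (spherePt n), rot_sp, mul_one]

attribute [irreducible] sp rot mkS

end sphere

/-! ### Wedges of spheres -/

section wedge


inductive WdRel {ι : Type} (n : ι → ℕ) :
    Unit ⊕ (Σ i, nSphere (n i)) → Unit ⊕ (Σ i, nSphere (n i)) → Prop
  | pt (i : ι) : WdRel n (Sum.inr ⟨i, spherePt (n i)⟩) (Sum.inl ())

/-- The wedge of spheres with an explicit base point. -/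
def Wd {ι : Type} (n : ι → ℕ) : Type := Quot (WdRel n)

instance {ι : Type} (n : ι → ℕ) : TopologicalSpace (Wd n) :=
  inferInstanceAs (TopologicalSpace (Quot (WdRel n)))

variable {ι κ : Type} {n : ι → ℕ} {m : κ → ℕ} {X : Type*} [TopologicalSpace X]

def wbase (n : ι → ℕ) : Wd n := Quot.mk _ (Sum.inl ())
def sph (n : ι → ℕ) (i : ι) (x : nSphere (n i)) : Wd n := Quot.mk _ (Sum.inr ⟨i, x⟩)

lemma sph_pt (n : ι → ℕ) (i : ι) : sph n i (spherePt (n i)) = wbase n := Quot.sound (WdRel.pt i)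

lemma continuous_sphW (n : ι → ℕ) (i : ι) : Continuous (sph n i) :=
  continuous_quot_mk.comp (continuous_inr.comp continuous_sigmaMk)

/-- Maps out of a wedge. -/
def wdesc (h : ∀ i, nSphere (n i) → X) (p : X) (hc : ∀ i, Continuous (h i))
    (h0 : ∀ i, h i (spherePt (n i)) = p) : C(Wd n, X) where
  toFun := Quot.lift (Sum.elim (fun _ => p) (fun q => h q.1 q.2)) (by
    rintro _ _ ⟨i⟩
    exact h0 i)
  continuous_toFun := continuous_quot_lift _
    (continuous_sumElim.2 ⟨continuous_const, continuous_sigma hc⟩)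

@[simp] lemma wdesc_sph (h : ∀ i, nSphere (n i) → X) (p : X) (hc h0) (i) (x) :
    wdesc h p hc h0 (sph n i x) = h i x := rfl
@[simp] lemma wdesc_base (h : ∀ i, nSphere (n i) → X) (p : X) (hc h0) :
    wdesc h p hc h0 (wbase n) = p := rfl

lemma wd_ind {P : Wd n → Prop} (h : ∀ i x, P (sph n i x)) (p : P (wbase n)) : ∀ z, P z := by
  rintro ⟨⟨⟩ | ⟨i, x⟩⟩
  · exact p
  · exact h i x

/-- Parametrized maps out of a wedge. -/
def wdT {T : Type*} [TopologicalSpace T] (h : ∀ i, nSphere (n i) → T → X) (p : T → X)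
    (hc : ∀ i, Continuous fun q : nSphere (n i) × T => h i q.1 q.2) (pc : Continuous p)
    (h0 : ∀ i t, h i (spherePt (n i)) t = p t) : C(Wd n, C(T, X)) :=
  wdesc (fun i => ContinuousMap.curry ⟨fun q : nSphere (n i) × T => h i q.1 q.2, hc i⟩) ⟨p, pc⟩
    (fun i => ContinuousMap.continuous _) (fun i => by ext t; exact h0 i t)

@[simp] lemma wdT_sph {T : Type*} [TopologicalSpace T] (h : ∀ i, nSphere (n i) → T → X) (p : T → X)
    (hc pc h0) (i x t) : wdT h p hc pc h0 (sph n i x) t = h i x t := rfl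
@[simp] lemma wdT_base {T : Type*} [TopologicalSpace T] (h : ∀ i, nSphere (n i) → T → X) (p : T → X)
    (hc pc h0) (t) : wdT h p hc pc h0 (wbase n) t = p t := rfl

lemma continuous_wdT {T : Type*} [TopologicalSpace T] [LocallyCompactSpace T]
    (F : C(Wd n, C(T, X))) : Continuous fun q : Wd n × T => F q.1 q.2 :=
  (ContinuousMap.uncurry F).continuous

lemma wd_homotopic (u v : C(Wd n, X)) (h : ∀ i, nSphere (n i) → I → X) (p : I → X)
    (hc : ∀ i, Continuous fun q : nSphere (n i) × I => h i q.1 q.2) (pc : Continuous p)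
    (h0 : ∀ i t, h i (spherePt (n i)) t = p t)
    (uh : ∀ i x, h i x 0 = u (sph n i x)) (up : p 0 = u (wbase n))
    (vh : ∀ i x, h i x 1 = v (sph n i x)) (vp : p 1 = v (wbase n)) : u.Homotopic v := by
  refine ⟨⟨⟨fun q => wdT h p hc pc h0 q.2 q.1, ?_⟩, ?_, ?_⟩⟩
  · exact (continuous_wdT (wdT h p hc pc h0)).comp (continuous_snd.prodMk continuous_fst)
  · exact wd_ind (fun i x => uh i x) up
  · exact wd_ind (fun i x => vh i x) vp

/-- Dimensions of the spheres after attaching cones. -/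
def dims (m : κ → ℕ) (n : ι → ℕ) : κ ⊕ ι → ℕ := Sum.elim m (fun i => n i + 1)

/-- The inclusion of a new sphere. -/
def sphR (n : ι → ℕ) (m : κ → ℕ) (i : ι) (x : nSphere (n i + 1)) : Wd (dims m n) :=
  sph (dims m n) (Sum.inr i) x

lemma continuous_sphR (n : ι → ℕ) (m : κ → ℕ) (i : ι) : Continuous (sphR n m i) :=
  continuous_sphW (dims m n) (Sum.inr i)

lemma sphR_pt (n : ι → ℕ) (m : κ → ℕ) (i : ι) : sphR n m i (spherePt _) = wbase _ :=
  sph_pt (dims m n) (Sum.inr i)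

lemma continuous_sp2 {k : ℕ} {Z : Type*} [TopologicalSpace Z] {u : Z → nSphere k} {v : Z → I}
    (hu : Continuous u) (hv : Continuous v) : Continuous fun z => sp (u z) (v z) :=
  continuous_sp.comp (hu.prodMk hv)

lemma continuous_rot2 {k : ℕ} {Z : Type*} [TopologicalSpace Z] {u : Z → I}
    {v : Z → nSphere (k + 1)}
    (hu : Continuous u) (hv : Continuous v) : Continuous fun z => rot (u z) (v z) :=
  continuous_rot.comp (hu.prodMk hv)

/-- The cylinder part of the map `phi`. -/
def phiC (n : ι → ℕ) (m : κ → ℕ) : C(Wd n, C(I, Wd (dims m n))) :=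
  wdT (T := I) (fun i x t => sphR n m i (rot 1 (sp x t)))
      (fun _ => wbase (dims m n))
      (fun i => (continuous_sphR n m i).comp
        (continuous_rot2 continuous_const (continuous_sp2 continuous_fst continuous_snd)))
      continuous_const
      (fun i t => by
        rw [rot_sp, symm_one, zero_mul, sp_zero, sphR_pt])

lemma phiC_sph (n : ι → ℕ) (m : κ → ℕ) (i x t) :
    phiC n m (sph n i x) t = sphR n m i (rot 1 (sp x t)) := rfl

lemma phiC_base (n : ι → ℕ) (m : κ → ℕ) (t) :
    phiC n m (wbase n) t = wbase (dims m n) := rfl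

def phi (n : ι → ℕ) (m : κ → ℕ) : C(MCone (ContinuousMap.const (Wd n) (wbase m)), Wd (dims m n)) :=
  desc (fun a t => phiC n m a t)
    (wdesc (fun k x => sph (dims m n) (Sum.inl k) x) (wbase (dims m n))
      (fun k => continuous_sphW (dims m n) (Sum.inl k))
      (fun k => sph_pt (dims m n) (Sum.inl k)))
    (wbase (dims m n))
    (continuous_wdT _) (ContinuousMap.continuous _)
    (wd_ind (fun i x => by
        rw [phiC_sph, sp_zero, rot_pt, sphR_pt]; rfl) rfl)
    (wd_ind (fun i x => by
        rw [phiC_sph, rot_sp_one, symm_one, sp_zero, sphR_pt]) rfl)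

def psiS (n : ι → ℕ) (m : κ → ℕ) (i : ι) :
    C(nSphere (n i + 1), MCone (ContinuousMap.const (Wd n) (wbase m))) :=
  sl (fun x t => cyl _ (sph n i x) t)
    (continuous_cyl' _ ((continuous_sphW n i).comp continuous_fst) continuous_snd)
    (fun x y => by simp only [cyl_zero, ContinuousMap.const_apply])
    (fun x y => by simp only [cyl_one])

lemma psiS_sp (n : ι → ℕ) (m : κ → ℕ) (i : ι) (x t) :
    psiS n m i (sp x t) = cyl _ (sph n i x) t := sl_sp _ _ _ _ x t

lemma psiS_pt (n : ι → ℕ) (m : κ → ℕ) (i : ι) :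
    psiS n m i (spherePt _) = inB _ (wbase m) := by
  rw [← sp_zero (spherePt (n i)), psiS_sp, cyl_zero]; rfl

def psi (n : ι → ℕ) (m : κ → ℕ) : C(Wd (dims m n), MCone (ContinuousMap.const (Wd n) (wbase m))) :=
  wdesc (fun j => match j with
      | Sum.inl k => fun x => inB _ (sph m k x)
      | Sum.inr i => fun x => psiS n m i x)
    (inB _ (wbase m))
    (fun j => match j with
      | Sum.inl k => (continuous_inB _).comp (continuous_sphW m k)
      | Sum.inr i => (psiS n m i).continuous)
    (fun j => match j with
      | Sum.inl k => congrArg (inB _) (sph_pt m k)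
      | Sum.inr i => psiS_pt n m i)

/-- The cylinder part of the homotopy. -/
def FF (n : ι → ℕ) (m : κ → ℕ) :
    C(Wd n, C(I × I, MCone (ContinuousMap.const (Wd n) (wbase m)))) :=
  wdT (T := I × I) (fun i x q => psiS n m i (rot q.1 (sp x q.2)))
    (fun q => cyl _ (wbase n) (σ q.1 * q.2))
    (fun i => (psiS n m i).continuous.comp (continuous_rot2
      (continuous_fst.comp continuous_snd)
      (continuous_sp2 continuous_fst (continuous_snd.comp continuous_snd))))
    (continuous_cyl' _ continuous_const (by fun_prop))
    (fun i q => by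
      rw [rot_sp, psiS_sp, sph_pt])

lemma FF_sph (n : ι → ℕ) (m : κ → ℕ) (i x q) :
    FF n m (sph n i x) q = psiS n m i (rot q.1 (sp x q.2)) := rfl

lemma FF_base (n : ι → ℕ) (m : κ → ℕ) (q) :
    FF n m (wbase n) q = cyl _ (wbase n) (σ q.1 * q.2) := rfl

lemma T3 (n : ι → ℕ) (m : κ → ℕ) :
    Nonempty (MCone (ContinuousMap.const (Wd n) (wbase m)) ≃ₕ Wd (dims m n)) := by
  refine ⟨⟨phi n m, psi n m, ?_, ?_⟩⟩
  · symm
    let F := FF n m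
    refine cone_homotopic _ _ (fun s a t => F a (s, t)) (fun s b => inB _ b)
      (fun s => cyl _ (wbase n) (σ s)) ?_ ?_ ?_ ?_ ?_ ?_ ?_ ?_ ?_ ?_ ?_
    · exact (continuous_wdT F).comp (by fun_prop :
        Continuous fun q : I × Wd n × I => (q.2.1, (q.1, q.2.2)))
    · exact (continuous_inB _).comp continuous_snd
    · exact continuous_cyl' _ continuous_const (by fun_prop)
    · intro s
      refine wd_ind (fun i x => ?_) ?_
      · simp only [F, FF_sph]
        rw [sp_zero, rot_pt, psiS_pt]; rfl
      · simp only [F, FF_base]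
        rw [mul_zero, cyl_zero]
    · intro s
      refine wd_ind (fun i x => ?_) ?_
      · simp only [F, FF_sph]
        rw [rot_sp_one, psiS_sp, sph_pt]
      · simp only [F, FF_base]
        rw [mul_one]
    · intro a t
      revert a
      refine wd_ind (fun i x => ?_) ?_
      · simp only [F, FF_sph]
        rw [rot_zero, psiS_sp]; rfl
      · simp only [F, FF_base]
        rw [symm_zero, one_mul]; rfl
    · intro b; rfl
    · rw [symm_zero, cyl_one]; rfl
    · intro a t
      revert a
      refine wd_ind (fun i x => ?_) ?_
      · simp only [F, FF_sph]; rfl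
      · simp only [F, FF_base]
        rw [symm_one, zero_mul, cyl_zero]; rfl
    · refine wd_ind (fun i x => rfl) rfl
    · rw [symm_one, cyl_zero]; rfl
  · symm
    refine wd_homotopic _ _ (fun j => match j with
      | Sum.inl k => fun x s => sph (dims m n) (Sum.inl k) x
      | Sum.inr i => fun x s => sph (dims m n) (Sum.inr i) (rot s x))
      (fun _ => wbase _) ?_ continuous_const ?_ ?_ rfl ?_ rfl
    · rintro (k | i)
      · exact (continuous_sphW (dims m n) (Sum.inl k)).comp continuous_fst
      · exact (continuous_sphW (dims m n) (Sum.inr i)).comp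
          (continuous_rot.comp (continuous_snd.prodMk continuous_fst))
    · rintro (k | i) t
      · exact sph_pt (dims m n) (Sum.inl k)
      · have : rot t (spherePt (n i + 1)) = spherePt (n i + 1) := rot_pt t
        exact (congrArg (sph (dims m n) (Sum.inr i)) this).trans (sph_pt (dims m n) (Sum.inr i))
    · rintro (k | i) x
      · rfl
      · exact congrArg (sph (dims m n) (Sum.inr i)) (rot_zero x)
    · rintro (k | i) x
      · rfl
      · obtain ⟨⟨y, t⟩, rfl⟩ := sp_surj x
        have e : psi n m (sph (dims m n) (Sum.inr i) (sp y t)) = cyl _ (sph n i y) t :=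
          psiS_sp n m i y t
        exact (congrArg (phi n m) e).symm

end wedge

/-! ### Spaces equivalent to finite wedges of spheres -/

section good

variable {ι κ : Type} {X : Type*} [TopologicalSpace X] {Y : Type*} [TopologicalSpace Y]

/-- Homotopy equivalent to a wedge of spheres with a base point (possibly a point). -/
def GoodSp (X : Type*) [TopologicalSpace X] : Prop :=
  ∃ (ι : Type) (_ : Fintype ι) (n : ι → ℕ), Nonempty (X ≃ₕ Wd n)

lemma GoodSp.of_equiv (h : GoodSp Y) (e : X ≃ₕ Y) : GoodSp X := by
  obtain ⟨ι, _, n, ⟨k⟩⟩ := h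
  exact ⟨ι, ‹_›, n, ⟨e.trans k⟩⟩

def castS {a b : ℕ} (h : a = b) (x : nSphere a) : nSphere b := h ▸ x

lemma continuous_castS {a b : ℕ} (h : a = b) : Continuous (castS h) := by
  subst h; exact continuous_id

lemma castS_pt {a b : ℕ} (h : a = b) : castS h (spherePt a) = spherePt b := by
  subst h; rfl

lemma sph_castS (n : ι → ℕ) {i j : ι} (hij : i = j) (h : n i = n j) (x : nSphere (n i)) :
    sph n j (castS h x) = sph n i x := by
  subst hij; rfl

/-- Reindexing a wedge. -/
def wdReindex (n : ι → ℕ) (e : κ ≃ ι) : Wd n ≃ₕ Wd (fun k => n (e k)) where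
  toFun := wdesc (fun i x => sph (fun k => n (e k)) (e.symm i) (castS (by simp) x)) (wbase _)
    (fun i => (continuous_sphW _ _).comp (continuous_castS _))
    (fun i => by rw [castS_pt]; exact sph_pt (fun k => n (e k)) (e.symm i))
  invFun := wdesc (fun k x => sph n (e k) x) (wbase _) (fun k => continuous_sphW n (e k))
    (fun k => sph_pt n (e k))
  left_inv := by
    convert Homotopic.refl _
    ext z
    revert z
    refine wd_ind (fun i x => ?_) rfl
    exact (sph_castS n (e.apply_symm_apply i).symm _ x).symm
  right_inv := by
    convert Homotopic.refl _
    ext z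
    revert z
    refine wd_ind (fun i x => ?_) rfl
    exact (sph_castS (fun k => n (e k)) (e.symm_apply_apply i).symm _ x).symm

lemma wd_wedge (n : ι → ℕ) (i0 : ι) : Nonempty (Wd n ≃ₕ WedgeOfSpheres n) := by
  let f : C(Wd n, WedgeOfSpheres n) := wdesc (fun i x => Quot.mk _ ⟨i, x⟩)
    (Quot.mk _ ⟨i0, spherePt _⟩) (fun i => continuous_quot_mk.comp continuous_sigmaMk)
    (fun i => Quot.sound ⟨i, i0, rfl, rfl⟩)
  let g : C(WedgeOfSpheres n, Wd n) := ⟨Quot.lift (fun q => sph n q.1 q.2) (by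
      rintro _ _ ⟨i, j, rfl, rfl⟩
      exact (sph_pt n i).trans (sph_pt n j).symm),
    continuous_quot_lift _ (continuous_sigma fun i => continuous_sphW n i)⟩
  refine ⟨⟨f, g, ?_, ?_⟩⟩
  · have : g.comp f = ContinuousMap.id _ := by
      ext z
      revert z
      exact wd_ind (fun i x => rfl) (sph_pt n i0)
    rw [this]
  · have : f.comp g = ContinuousMap.id _ := by
      ext ⟨i, x⟩
      rfl
    rw [this]

lemma GoodSp.final (h : GoodSp X) : ContractibleSpace X ∨ IsWedgeOfSpheres X := by
  obtain ⟨ι, _, n, ⟨k⟩⟩ := h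
  rcases isEmpty_or_nonempty ι with he | he
  · left
    have : Unique (Wd n) := ⟨⟨wbase n⟩, wd_ind (fun i => he.elim i) rfl⟩
    have : ContractibleSpace (Wd n) := inferInstance
    exact k.contractibleSpace
  · right
    refine ⟨Fintype.card ι, fun k => n ((Fintype.equivFin ι).symm k), ?_⟩
    obtain ⟨i0⟩ := he
    obtain ⟨w⟩ := wd_wedge (fun k => n ((Fintype.equivFin ι).symm k)) (Fintype.equivFin ι i0)
    exact ⟨(k.trans (wdReindex n (Fintype.equivFin ι).symm)).trans w⟩

lemma GoodSp.of_contractible [ContractibleSpace X] : GoodSp X := by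
  refine ⟨Empty, inferInstance, Empty.elim, ?_⟩
  have : Unique (Wd (Empty.elim : Empty → ℕ)) := ⟨⟨wbase _⟩, wd_ind (fun i => i.elim) rfl⟩
  have : ContractibleSpace (Wd (Empty.elim : Empty → ℕ)) := inferInstance
  obtain ⟨a⟩ := ContractibleSpace.hequiv X (Wd (Empty.elim : Empty → ℕ))
  exact ⟨a⟩

lemma empty_wedge [IsEmpty X] : IsWedgeOfSpheres X := by
  refine ⟨0, Fin.elim0, ?_⟩
  have : IsEmpty (WedgeOfSpheres (Fin.elim0 : Fin 0 → ℕ)) := ⟨by rintro ⟨i, x⟩; exact i.elim0⟩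
  refine ⟨⟨⟨isEmptyElim, ?_⟩, ⟨isEmptyElim, ?_⟩, ?_, ?_⟩⟩
  · rw [continuous_iff_continuousAt]; exact isEmptyElim
  · rw [continuous_iff_continuousAt]; exact isEmptyElim
  · convert Homotopic.refl _; ext z; exact isEmptyElim z
  · convert Homotopic.refl _; ext z; exact isEmptyElim z

lemma GoodSp.attach (f : C(X, Y)) (hX : GoodSp X) (hY : GoodSp Y) [PathConnectedSpace Y] (b : Y)
    (hf : f.Homotopic (ContinuousMap.const X b)) : GoodSp (MCone f) := by
  obtain ⟨ι, _, n, ⟨α⟩⟩ := hX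
  obtain ⟨κ, _, m, ⟨β⟩⟩ := hY
  obtain ⟨e1⟩ := cone_homotopy hf
  obtain ⟨e2⟩ := cone_target (ContinuousMap.const X b) β
  have hpath : Joined (β b) (wbase m) := by
    have p1 : Joined b (β.symm (wbase m)) := PathConnectedSpace.joined _ _
    have p2 : Joined (β b) (β (β.symm (wbase m))) := p1.map β.toFun.continuous
    obtain ⟨H⟩ := β.right_inv
    refine p2.trans ⟨⟨⟨fun t => H (t, wbase m), by fun_prop⟩, ?_, ?_⟩⟩
    · exact H.map_zero_left _
    · exact H.map_one_left _
  have hc : (β.toFun.comp (ContinuousMap.const X b)).Homotopic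
      (ContinuousMap.const X (wbase m)) := by
    obtain ⟨p⟩ := hpath
    refine ⟨⟨⟨fun q => p q.1, by fun_prop⟩, fun x => ?_, fun x => ?_⟩⟩
    · simp
    · simp
  obtain ⟨e3⟩ := cone_homotopy hc
  obtain ⟨e4⟩ := cone_source α (wbase m)
  obtain ⟨e5⟩ := T3 n m
  exact ⟨κ ⊕ ι, inferInstance, dims m n, ⟨(((e1.trans e2).trans e3).trans e4).trans e5⟩⟩

/-- The antipode of the base point of the zero sphere. -/
def negPt : nSphere 0 := mkS (fun _ => -1) (by simp)

lemma co_negPt (i) : co negPt i = -1 := by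
  unfold negPt; rw [co_mkS]

lemma s0_cases (x : nSphere 0) : x = spherePt 0 ∨ x = negPt := by
  have h := co_sum x
  have h2 : co x 0 ^ 2 = 1 := by
    rw [← h]; exact (Fin.sum_univ_one (fun i : Fin 1 => co x i ^ 2)).symm
  rcases sq_eq_one_iff.1 h2 with h | h
  · left
    apply sph_ext
    intro i
    have : i = 0 := Subsingleton.elim (α := Fin 1) _ _
    rw [this, h, co_spherePt_zero]
  · right
    apply sph_ext
    intro i
    have : i = 0 := Subsingleton.elim (α := Fin 1) _ _
    rw [this, h, co_negPt]

lemma s0_ne : spherePt 0 ≠ negPt := by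
  intro h
  have := congrArg (fun z => co z 0) h
  simp only [co_spherePt_zero, co_negPt] at this
  norm_num at this

lemma GoodSp.disjoint (f : C(X, Y)) [IsEmpty X] (hY : GoodSp Y) : GoodSp (MCone f) := by
  obtain ⟨κ, _, m, ⟨β⟩⟩ := hY
  obtain ⟨e2⟩ := cone_target f β
  classical
  let d : κ ⊕ Unit → ℕ := Sum.elim m (fun _ => 0)
  let N : Wd d := sph d (Sum.inr ()) negPt
  let u : C(MCone (β.toFun.comp f), Wd d) := desc (fun a _ => isEmptyElim a)
    (wdesc (fun k x => sph d (Sum.inl k) x) (wbase d) (fun k => continuous_sphW d (Sum.inl k))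
      (fun k => sph_pt d (Sum.inl k))) N
    (by rw [continuous_iff_continuousAt]; exact fun q => isEmptyElim q.1)
    (ContinuousMap.continuous _) (fun a => isEmptyElim a) (fun a => isEmptyElim a)
  have : Finite (nSphere 0) := by
    refine Set.finite_univ_iff.1 (Set.Finite.subset (Set.toFinite {spherePt 0, negPt}) ?_)
    intro x _
    exact s0_cases x
  have : DiscreteTopology (nSphere 0) := inferInstance
  let v : C(Wd d, MCone (β.toFun.comp f)) := wdesc (fun j => match j with
      | Sum.inl k => fun x => inB _ (sph m k x)
      | Sum.inr _ => fun x : nSphere 0 => if x = spherePt 0 then inB _ (wbase m) else apex _)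
    (inB _ (wbase m))
    (fun j => match j with
      | Sum.inl k => (continuous_inB _).comp (continuous_sphW m k)
      | Sum.inr _ => continuous_of_discreteTopology (α := nSphere 0))
    (fun j => match j with
      | Sum.inl k => congrArg (inB _) (sph_pt m k)
      | Sum.inr _ => if_pos rfl)
  refine ⟨κ ⊕ Unit, inferInstance, d, ⟨e2.trans ⟨u, v, ?_, ?_⟩⟩⟩
  · have : v.comp u = ContinuousMap.id _ := by
      ext z
      revert z
      refine cone_ind (fun a => isEmptyElim a) ?_ ?_
      · exact wd_ind (fun i x => rfl) rfl
      · exact if_neg s0_ne.symm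
    rw [this]
  · have : u.comp v = ContinuousMap.id _ := by
      ext z
      revert z
      refine wd_ind ?_ rfl
      rintro (k | ⟨⟩) x
      · rfl
      · rcases s0_cases x with rfl | rfl
        · have : v (sph d (Sum.inr ()) (spherePt 0)) = inB _ (wbase m) := if_pos rfl
          exact (congrArg u this).trans (sph_pt d (Sum.inr ())).symm
        · have : v (sph d (Sum.inr ()) negPt) = apex _ := if_neg s0_ne.symm
          exact (congrArg u this)
    rw [this]

end good

/-! ### Flag complexes -/

section flag

set_option linter.unusedSectionVars false

variable {α : Type*} [Fintype α] [DecidableEq α] (R : α → α → Prop) [DecidableRel R]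

/-- The realization of the flag complex of `R` on the finite set `E`. -/
def FRset (E : Finset α) : Set (α → ℝ) :=
  {f | (∀ a, 0 ≤ f a) ∧ ∑ a, f a = 1 ∧ (∀ a, a ∉ E → f a = 0) ∧
    ∀ a b, a ≠ b → ¬ R a b → f a * f b = 0}

abbrev FR (E : Finset α) : Type _ := FRset R E

variable {R}

lemma FR_le_one {E : Finset α} (x : FR R E) (a : α) : x.1 a ≤ 1 := by
  rw [← x.2.2.1]
  exact Finset.single_le_sum (fun b _ => x.2.1 b) (Finset.mem_univ a)

instance (E : Finset α) : CompactSpace (FR R E) := by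
  rw [← isCompact_iff_compactSpace]
  have hc : IsCompact (Set.univ.pi fun _ : α => Set.Icc (0 : ℝ) 1) :=
    isCompact_univ_pi fun _ => isCompact_Icc
  refine hc.of_isClosed_subset ?_ ?_
  · have : FRset R E = (⋂ a, {f : α → ℝ | 0 ≤ f a}) ∩ ({f : α → ℝ | ∑ a, f a = 1} ∩
        ((⋂ a, ⋂ (_ : a ∉ E), {f : α → ℝ | f a = 0}) ∩
        (⋂ a, ⋂ b, ⋂ (_ : a ≠ b), ⋂ (_ : ¬ R a b), {f : α → ℝ | f a * f b = 0}))) := by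
      ext f
      simp [FRset]
    rw [this]
    refine IsClosed.inter (isClosed_iInter fun a => ?_) (IsClosed.inter ?_ (IsClosed.inter ?_ ?_))
    · exact isClosed_le continuous_const (continuous_apply a)
    · exact isClosed_eq (by fun_prop) continuous_const
    · exact isClosed_iInter fun a => isClosed_iInter fun _ =>
        isClosed_eq (by fun_prop) continuous_const
    · exact isClosed_iInter fun a => isClosed_iInter fun b => isClosed_iInter fun _ =>
        isClosed_iInter fun _ => isClosed_eq (by fun_prop) continuous_const
  · intro f hf a _
    exact ⟨hf.1 a, FR_le_one ⟨f, hf⟩ a⟩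

lemma FRset_mono {S T : Finset α} (h : S ⊆ T) : FRset R S ⊆ FRset R T :=
  fun _ hf => ⟨hf.1, hf.2.1, fun a ha => hf.2.2.1 a fun h' => ha (h h'), hf.2.2.2⟩

/-- Inclusion of a full subcomplex. -/
def incl {S T : Finset α} (h : S ⊆ T) : C(FR R S, FR R T) :=
  ⟨Set.inclusion (FRset_mono h), continuous_inclusion _⟩

@[simp] lemma incl_val {S T : Finset α} (h : S ⊆ T) (x : FR R S) : (incl h x).1 = x.1 := rfl

/-- The vertex `e`. -/
def dl (e : α) : α → ℝ := fun a => if a = e then 1 else 0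

lemma dl_mem {E : Finset α} {e : α} (he : e ∈ E) : dl e ∈ FRset R E := by
  refine ⟨fun a => ?_, ?_, fun a ha => ?_, fun a b hab _ => ?_⟩
  · unfold dl; split_ifs <;> norm_num
  · simp [dl]
  · have : a ≠ e := by rintro rfl; exact ha he
    simp [dl, this]
  · by_cases h1 : a = e
    · have : b ≠ e := by rintro rfl; exact hab h1
      simp [dl, this]
    · simp [dl, h1]

/-- Points on the segment from `x` to the vertex `e`. -/
def mix (e : α) (x : α → ℝ) (t : ℝ) : α → ℝ := fun a => (1 - t) * x a + t * dl e a

lemma mix_self {e : α} {x : α → ℝ} (t : ℝ) : mix e x t e = (1 - t) * x e + t := by simp [mix, dl]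

lemma mix_ne {e a : α} {x : α → ℝ} (t : ℝ) (h : a ≠ e) : mix e x t a = (1 - t) * x a := by
  simp [mix, dl, h]

lemma mix_mem (hs : ∀ a b, R a b → R b a) {E : Finset α} {e : α} (he : e ∈ E) {x : α → ℝ}
    (hx : x ∈ FRset R E) (h : ∀ a, a ≠ e → x a ≠ 0 → R e a) (t : I) :
    mix e x t ∈ FRset R E := by
  have hd : dl e ∈ FRset R E := dl_mem he
  have t0 := t.2.1
  have t1 : 0 ≤ 1 - (t : ℝ) := by linarith [t.2.2]
  refine ⟨fun a => ?_, ?_, fun a ha => ?_, fun a b hab hR => ?_⟩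
  · exact add_nonneg (mul_nonneg t1 (hx.1 a)) (mul_nonneg t0 (hd.1 a))
  · simp only [mix]
    rw [Finset.sum_add_distrib, ← Finset.mul_sum, ← Finset.mul_sum, hx.2.1, hd.2.1]; ring
  · simp [mix, hx.2.2.1 a ha, hd.2.2.1 a ha]
  · by_cases h1 : a = e
    · subst h1
      have : x b = 0 := by
        by_contra hb
        exact hR (h b hab.symm hb)
      rw [mix_ne _ hab.symm, this]; ring
    · by_cases h2 : b = e
      · subst h2
        have : x a = 0 := by
          by_contra hb
          exact hR (hs _ _ (h a hab hb))
        rw [mix_ne _ hab, this]; ring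
      · rw [mix_ne _ h1, mix_ne _ h2]
        have := hx.2.2.2 a b hab hR
        linear_combination (1 - (t : ℝ)) ^ 2 * this

lemma continuous_mix (e : α) : Continuous fun q : (α → ℝ) × ℝ => mix e q.1 q.2 := by
  unfold mix; fun_prop

lemma filter_sub_erase (hi : ∀ a, ¬ R a a) (E : Finset α) (e : α) :
    E.filter (R e) ⊆ E.erase e := by
  intro a ha
  rw [Finset.mem_filter] at ha
  refine Finset.mem_erase.2 ⟨?_, ha.1⟩
  rintro rfl
  exact hi a ha.2

lemma mix_lk_mem (hs : ∀ a b, R a b → R b a) {E : Finset α} {e : α} (he : e ∈ E)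
    (x : FR R (E.filter (R e))) (t : I) : mix e x.1 t ∈ FRset R E := by
  refine mix_mem hs he (FRset_mono (Finset.filter_subset _ _) x.2) (fun a _ hxa => ?_) t
  by_contra hR
  exact hxa (x.2.2.2.1 a (by simp [hR]))

/-- The comparison map from the mapping cone. -/
def toFR (hs : ∀ a b, R a b → R b a) (hi : ∀ a, ¬ R a a) {E : Finset α} {e : α} (he : e ∈ E) :
    C(MCone (incl (R := R) (filter_sub_erase hi E e)), FR R E) :=
  desc (fun x t => ⟨mix e x.1 t, mix_lk_mem hs he x t⟩) (incl (Finset.erase_subset e E))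
    ⟨dl e, dl_mem he⟩
    (Continuous.subtype_mk ((continuous_mix e).comp (by fun_prop :
      Continuous fun q : FR R (E.filter (R e)) × I => (q.1.1, (q.2 : ℝ)))) _)
    (ContinuousMap.continuous _)
    (fun x => by apply Subtype.ext; ext a; simp [mix])
    (fun x => by apply Subtype.ext; ext a; simp [mix])

lemma cone_normal {A B : Type*} [TopologicalSpace A] [TopologicalSpace B] (f : C(A, B))
    (z : MCone f) : (∃ b, z = inB f b) ∨ z = apex f ∨
      ∃ a, ∃ t : I, 0 < (t : ℝ) ∧ (t : ℝ) < 1 ∧ z = cyl f a t := by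
  revert z
  refine cone_ind (fun a t => ?_) (fun b => Or.inl ⟨b, rfl⟩) (Or.inr (Or.inl rfl))
  by_cases h0 : (t : ℝ) = 0
  · have : t = 0 := Subtype.ext h0
    subst this
    exact Or.inl ⟨f a, cyl_zero f a⟩
  by_cases h1 : (t : ℝ) = 1
  · have : t = 1 := Subtype.ext h1
    subst this
    exact Or.inr (Or.inl (cyl_one f a))
  exact Or.inr (Or.inr ⟨a, t, lt_of_le_of_ne t.2.1 (Ne.symm h0), lt_of_le_of_ne t.2.2 h1, rfl⟩)

lemma FR_at {S : Finset α} (x : FR R S) {e : α} (h : e ∉ S) : x.1 e = 0 := x.2.2.2.1 e h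

lemma toFR_inj (hs : ∀ a b, R a b → R b a) (hi : ∀ a, ¬ R a a) {E : Finset α} {e : α}
    (he : e ∈ E) : Function.Injective (toFR hs hi he) := by
  have h1 : e ∉ E.filter (R e) := by simp [hi]
  have h2 : e ∉ E.erase e := by simp
  have vb : ∀ b, (toFR hs hi he (inB _ b)).1 = b.1 := fun b => rfl
  have va : (toFR hs hi he (apex _)).1 = dl e := rfl
  have vc : ∀ x t, (toFR hs hi he (cyl _ x t)).1 = mix e x.1 t := fun x t => rfl
  have eb : ∀ b, (toFR hs hi he (inB _ b)).1 e = 0 := fun b => FR_at b h2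
  have ea : (toFR hs hi he (apex _)).1 e = 1 := by rw [va]; simp [dl]
  have ec : ∀ x t, (toFR hs hi he (cyl _ x t)).1 e = t := fun x t => by
    rw [vc, mix_self, FR_at x h1]; ring
  intro z w hzw
  have hv : (toFR hs hi he z).1 e = (toFR hs hi he w).1 e := by rw [hzw]
  rcases cone_normal _ z with ⟨b, rfl⟩ | rfl | ⟨x, t, t0, t1, rfl⟩ <;>
  rcases cone_normal _ w with ⟨b', rfl⟩ | rfl | ⟨x', t', t0', t1', rfl⟩ <;>
  simp only [eb, ea, ec] at hv
  · congr 1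
    apply Subtype.ext
    rw [← vb b, ← vb b', hzw]
  · norm_num at hv
  · exact absurd hv t0'.ne
  · norm_num at hv
  · rfl
  · exact absurd hv t1'.ne'
  · exact absurd hv t0.ne'
  · exact absurd hv t1.ne
  · have : t = t' := Subtype.ext hv
    subst this
    congr 1
    apply Subtype.ext
    ext a
    have h3 : mix e x.1 t a = mix e x'.1 t a := by rw [← vc, ← vc, hzw]
    by_cases hae : a = e
    · subst hae; rw [FR_at x h1, FR_at x' h1]
    · rw [mix_ne _ hae, mix_ne _ hae] at h3
      exact mul_left_cancel₀ (by linarith : (1 - (t : ℝ)) ≠ 0) h3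

lemma toFR_surj (hs : ∀ a b, R a b → R b a) (hi : ∀ a, ¬ R a a) {E : Finset α} {e : α}
    (he : e ∈ E) : Function.Surjective (toFR hs hi he) := by
  intro g
  have g0 : 0 ≤ g.1 e := g.2.1 e
  have g1 : g.1 e ≤ 1 := FR_le_one g e
  rcases g0.eq_or_lt with h0 | h0
  · refine ⟨inB _ ⟨g.1, g.2.1, g.2.2.1, fun a ha => ?_, g.2.2.2.2⟩, Subtype.ext rfl⟩
    by_cases hae : a = e
    · rw [hae]; exact h0.symm
    · exact g.2.2.2.1 a fun h => ha (Finset.mem_erase.2 ⟨hae, h⟩)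
  rcases g1.eq_or_lt with h1 | h1
  · refine ⟨apex _, Subtype.ext ?_⟩
    ext a
    change dl e a = g.1 a
    by_cases hae : a = e
    · rw [hae, h1]; simp [dl]
    · have := g.2.2.1
      rw [← Finset.add_sum_erase _ _ (Finset.mem_univ e), h1] at this
      have h2 : ∑ b ∈ Finset.univ.erase e, g.1 b = 0 := by linarith
      have := (Finset.sum_eq_zero_iff_of_nonneg (fun b _ => g.2.1 b)).1 h2 a (by simp [hae])
      rw [this]; simp [dl, hae]
  · have hp : 0 < 1 - g.1 e := by linarith
    have hx : (fun a => if a = e then 0 else g.1 a / (1 - g.1 e)) ∈ FRset R (E.filter (R e)) := by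
      refine ⟨fun a => ?_, ?_, fun a ha => ?_, fun a b hab hR => ?_⟩
      · dsimp only
        split_ifs
        · exact le_rfl
        · exact div_nonneg (g.2.1 a) hp.le
      · rw [← Finset.add_sum_erase _ _ (Finset.mem_univ e), if_pos rfl, zero_add]
        have h2 := g.2.2.1
        rw [← Finset.add_sum_erase _ _ (Finset.mem_univ e)] at h2
        rw [Finset.sum_congr rfl (g := fun b => g.1 b / (1 - g.1 e)), ← Finset.sum_div,
          div_eq_one_iff_eq hp.ne']
        · linarith
        · intro b hb
          rw [if_neg (Finset.ne_of_mem_erase hb)]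
      · by_cases hae : a = e
        · exact if_pos hae
        · simp only [if_neg hae]
          have : g.1 a = 0 := by
            by_cases haE : a ∈ E
            · have hR : ¬ R e a := fun h => ha (by simp [h, haE])
              have := g.2.2.2.2 e a (Ne.symm hae) hR
              rcases mul_eq_zero.1 this with h | h
              · exact absurd h h0.ne'
              · exact h
            · exact g.2.2.2.1 a haE
          rw [this, zero_div]
      · by_cases h1 : a = e
        · simp [h1]
        by_cases h2 : b = e
        · simp [h2]
        simp only [if_neg h1, if_neg h2]
        rw [div_mul_div_comm, g.2.2.2.2 a b hab hR, zero_div]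
    refine ⟨cyl _ ⟨_, hx⟩ ⟨g.1 e, g0, g1⟩, Subtype.ext ?_⟩
    ext a
    change mix e _ (g.1 e) a = g.1 a
    by_cases hae : a = e
    · subst hae; rw [mix_self]; simp
    · rw [mix_ne _ hae]
      simp only [if_neg hae]
      field_simp

instance {A B : Type*} [TopologicalSpace A] [TopologicalSpace B] [CompactSpace A] [CompactSpace B]
    (f : C(A, B)) : CompactSpace (MCone f) :=
  inferInstanceAs (CompactSpace (Quot (ConeRel f)))

lemma FR_cone (hs : ∀ a b, R a b → R b a) (hi : ∀ a, ¬ R a a) {E : Finset α} {e : α}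
    (he : e ∈ E) : Nonempty (FR R E ≃ₕ MCone (incl (R := R) (filter_sub_erase hi E e))) := by
  have h := isHomeomorph_iff_continuous_bijective.2
    ⟨(toFR hs hi he).continuous, toFR_inj hs hi he, toFR_surj hs hi he⟩
  exact ⟨h.homeomorph.symm.toHomotopyEquiv⟩

lemma FR_contractible_of_cone (hs : ∀ a b, R a b → R b a) {E : Finset α} {e : α} (he : e ∈ E)
    (h : ∀ a ∈ E, a ≠ e → R e a) : ContractibleSpace (FR R E) := by
  rw [contractible_iff_id_nullhomotopic]
  refine ⟨⟨dl e, dl_mem he⟩, ⟨⟨⟨fun q => ⟨mix e q.2.1 q.1, mix_mem hs he q.2.2 (fun a ha hx => ?_) q.1⟩,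
    ?_⟩, ?_, ?_⟩⟩⟩
  · refine h a ?_ ha
    by_contra haE
    exact hx (q.2.2.2.2.1 a haE)
  · exact Continuous.subtype_mk ((continuous_mix e).comp (by fun_prop :
      Continuous fun q : I × FR R E => (q.2.1, (q.1 : ℝ)))) _
  · intro x; apply Subtype.ext; ext a; simp [mix]
  · intro x; apply Subtype.ext; ext a; simp [mix]

variable (R)

/-- Nonevasive flag complexes. -/
inductive NE : Finset α → Prop
  | cone {E : Finset α} (e : α) (he : e ∈ E) (h : ∀ a ∈ E, a ≠ e → R e a) : NE E
  | step {E : Finset α} (e : α) (he : e ∈ E) (h1 : NE (E.filter (R e))) (h2 : NE (E.erase e)) : NE E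

/-- Connectedness of the graph of `R` on `S`. -/
def Conn (S : Finset α) : Prop :=
  ∀ a ∈ S, ∀ b ∈ S, Relation.ReflTransGen (fun a b => a ∈ S ∧ b ∈ S ∧ R a b) a b

/-- A combinatorial condition ensuring that the flag complex is a wedge of spheres. -/
inductive Gd : Finset α → Prop
  | ne {E : Finset α} (h : NE R E) : Gd E
  | iso {E : Finset α} (e : α) (he : e ∈ E) (h1 : E.filter (R e) = ∅) (h2 : Gd (E.erase e)) : Gd E
  | leaf {E : Finset α} (e : α) (he : e ∈ E) (h1 : NE R (E.filter (R e))) (h2 : Gd (E.erase e)) :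
      Gd E
  | attach {E : Finset α} (e : α) (he : e ∈ E) (X : Finset α) (hX : NE R X)
      (h1 : E.filter (R e) ⊆ X) (h2 : X ⊆ E.erase e) (h3 : Gd (E.filter (R e)))
      (h4 : Gd (E.erase e)) (h5 : Conn R (E.erase e)) : Gd E

variable {R}

lemma FR_leaf (hs : ∀ a b, R a b → R b a) (hi : ∀ a, ¬ R a a) {E : Finset α} {e : α}
    (he : e ∈ E) [ContractibleSpace (FR R (E.filter (R e)))] :
    Nonempty (FR R E ≃ₕ FR R (E.erase e)) := by
  obtain ⟨a⟩ := FR_cone hs hi he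
  obtain ⟨b⟩ := cone_contractible_source (incl (R := R) (filter_sub_erase hi E e))
  exact ⟨a.trans b⟩

lemma NE.contractible (hs : ∀ a b, R a b → R b a) (hi : ∀ a, ¬ R a a) {E : Finset α}
    (h : NE R E) : ContractibleSpace (FR R E) := by
  induction h with
  | cone e he h => exact FR_contractible_of_cone hs he h
  | step e he _ _ ih1 ih2 =>
    obtain ⟨a⟩ := FR_leaf hs hi he
    exact a.contractibleSpace

lemma joined_mix (hs : ∀ a b, R a b → R b a) {E : Finset α} {e : α} (he : e ∈ E) (x : FR R E)
    (h : ∀ a, a ≠ e → x.1 a ≠ 0 → R e a) : Joined x ⟨dl e, dl_mem he⟩ := by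
  refine ⟨⟨⟨fun t => ⟨mix e x.1 t, mix_mem hs he x.2 h t⟩, ?_⟩, ?_, ?_⟩⟩
  · exact Continuous.subtype_mk ((continuous_mix e).comp (by fun_prop :
      Continuous fun t : I => (x.1, (t : ℝ)))) _
  · apply Subtype.ext; ext a; simp [mix]
  · apply Subtype.ext; ext a; simp [mix]

lemma FR_pathConnected (hs : ∀ a b, R a b → R b a) {S : Finset α} (hne : S.Nonempty)
    (hc : Conn R S) : PathConnectedSpace (FR R S) := by
  obtain ⟨a0, ha0⟩ := hne
  have key : ∀ x : FR R S, Joined x ⟨dl a0, dl_mem ha0⟩ := by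
    intro x
    obtain ⟨a, ha⟩ : ∃ a, x.1 a ≠ 0 := by
      by_contra! h
      have := x.2.2.1
      simp [h] at this
    have haS : a ∈ S := by
      by_contra h
      exact ha (x.2.2.2.1 a h)
    have h1 : Joined x ⟨dl a, dl_mem haS⟩ := by
      refine joined_mix hs haS x (fun b hb hxb => ?_)
      by_contra hR
      rcases mul_eq_zero.1 (x.2.2.2.2 a b hb.symm hR) with h | h
      · exact ha h
      · exact hxb h
    refine h1.trans ?_
    have hr := hc a haS a0 ha0
    clear h1 ha
    induction hr using Relation.ReflTransGen.head_induction_on with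
    | refl => exact Joined.refl _
    | @head p q h _ ih =>
      refine Joined.trans ?_ (ih h.2.1)
      refine joined_mix hs h.2.1 _ (fun d hd hdx => ?_)
      have : d = p := by
        by_contra hne
        exact hdx (if_neg hne)
      subst this
      exact hs _ _ h.2.2
  exact ⟨⟨_, dl_mem ha0⟩, fun x y => (key x).trans (key y).symm⟩

lemma Gd.nonempty {E : Finset α} (h : Gd R E) : E.Nonempty := by
  cases h with
  | ne h => cases h with
    | cone e he => exact ⟨e, he⟩
    | step e he => exact ⟨e, he⟩
  | iso e he => exact ⟨e, he⟩
  | leaf e he => exact ⟨e, he⟩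
  | attach e he => exact ⟨e, he⟩

theorem Gd.good (hs : ∀ a b, R a b → R b a) (hi : ∀ a, ¬ R a a) {E : Finset α}
    (h : Gd R E) : GoodSp (FR R E) := by
  induction h with
  | ne h =>
    have := h.contractible hs hi
    exact GoodSp.of_contractible
  | @iso E e he h1 h2 ih =>
    obtain ⟨k⟩ := FR_cone hs hi he
    have : IsEmpty (FR R (E.filter (R e))) := by
      refine ⟨fun x => ?_⟩
      have := x.2.2.1
      have h0 : ∀ a, x.1 a = 0 := fun a => x.2.2.2.1 a (by simp [h1])
      simp [h0] at this
    exact (GoodSp.disjoint _ ih).of_equiv k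
  | @leaf E e he h1 h2 ih =>
    have := h1.contractible hs hi
    obtain ⟨k⟩ := FR_leaf hs hi he
    exact ih.of_equiv k
  | @attach E e he X hX h1 h2 h3 h4 h5 ih1 ih2 =>
    have := hX.contractible hs hi
    have := FR_pathConnected hs h4.nonempty h5
    obtain ⟨k⟩ := FR_cone hs hi he
    obtain ⟨x0, hx0⟩ := id_nullhomotopic (FR R X)
    refine (GoodSp.attach _ ih1 ih2 (incl h2 x0) ?_).of_equiv k
    exact ((Homotopic.refl (incl (R := R) h2)).comp hx0).comp (Homotopic.refl (incl (R := R) h1))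

end flag

/-! ### Combinatorics of noncrossing edge sets -/

section comb

set_option linter.unusedSectionVars false

variable {α : Type*} [Fintype α] [DecidableEq α] {R : α → α → Prop} [DecidableRel R]

/-- A finite set of pairwise noncrossing arcs, `R` being the disjointness relation. -/
structure OP {P : Type*} [LinearOrder P] (R : α → α → Prop) (l r : α → P) (E : Finset α) :
    Prop where
  lt : ∀ e ∈ E, l e < r e
  inj : ∀ e ∈ E, ∀ g ∈ E, l e = l g → r e = r g → e = g
  nc : ∀ e ∈ E, ∀ g ∈ E, l e < l g → l g < r e → r e < r g → False
  hR : ∀ e ∈ E, ∀ g ∈ E, R e g ↔ (l e ≠ l g ∧ l e ≠ r g ∧ r e ≠ l g ∧ r e ≠ r g)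

lemma OP.mono {P : Type*} [LinearOrder P] {l r : α → P} {S E : Finset α} (h : OP R l r E)
    (hS : S ⊆ E) : OP R l r S :=
  ⟨fun e he => h.lt e (hS he), fun e he g hg => h.inj e (hS he) g (hS hg),
    fun e he g hg => h.nc e (hS he) g (hS hg), fun e he g hg => h.hR e (hS he) g (hS hg)⟩

/-- Paths of length one modulo three give nonevasive complexes. -/
lemma path_NE (hi : ∀ a, ¬ R a a) (c : ℕ → α) (Y : Finset α) (q : ℕ) : ∀ p : ℕ,
    (∀ i j, p ≤ i → i < p + (3 * q + 1) → p ≤ j → j < p + (3 * q + 1) →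
      (R (c i) (c j) ↔ (i + 2 ≤ j ∨ j + 2 ≤ i))) →
    (∀ i j, p ≤ i → i < p + (3 * q + 1) → p ≤ j → j < p + (3 * q + 1) → c i = c j → i = j) →
    (∀ i, p ≤ i → i < p + (3 * q + 1) → ∀ y ∈ Y, R (c i) y) →
    NE R ((Finset.Ico p (p + (3 * q + 1))).image c ∪ Y) := by
  induction q with
  | zero =>
    intro p hR _ hY
    refine NE.cone (c p) (by simp) ?_
    intro a ha hne
    rcases Finset.mem_union.1 ha with h | h
    · obtain ⟨i, hi', rfl⟩ := Finset.mem_image.1 h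
      rw [Finset.mem_Ico] at hi'
      have : i = p := by omega
      subst this
      exact absurd rfl hne
    · exact hY p le_rfl (by omega) a h
  | succ q ih =>
    intro p hR hinj hY
    set m := 3 * (q + 1) + 1 with hm
    have memS : ∀ i, p ≤ i → i < p + m → c i ∈ (Finset.Ico p (p + m)).image c ∪ Y := fun i h1 h2 =>
      Finset.mem_union_left _ (Finset.mem_image_of_mem _ (Finset.mem_Ico.2 ⟨h1, h2⟩))
    refine NE.step (c (p + 2)) (memS _ (by omega) (by omega)) ?_ ?_
    · refine NE.cone (c p) ?_ ?_
      · refine Finset.mem_filter.2 ⟨memS _ (by omega) (by omega), ?_⟩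
        rw [hR _ _ (by omega) (by omega) (by omega) (by omega)]
        omega
      · intro a ha hne
        obtain ⟨ha, haR⟩ := Finset.mem_filter.1 ha
        rcases Finset.mem_union.1 ha with h | h
        · obtain ⟨i, hi', rfl⟩ := Finset.mem_image.1 h
          rw [Finset.mem_Ico] at hi'
          rw [hR _ _ (by omega) (by omega) (by omega) (by omega)] at haR
          rw [hR _ _ (by omega) (by omega) (by omega) (by omega)]
          have : i ≠ p := by rintro rfl; exact hne rfl
          omega
        · exact hY p le_rfl (by omega) a h
    · refine NE.step (c (p + 1)) ?_ ?_ ?_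
      · refine Finset.mem_erase.2 ⟨fun h => ?_, memS _ (by omega) (by omega)⟩
        have := hinj _ _ (by omega) (by omega) (by omega) (by omega) h
        omega
      · have e : (((Finset.Ico p (p + m)).image c ∪ Y).erase (c (p + 2))).filter (R (c (p + 1))) =
            (Finset.Ico (p + 3) (p + 3 + (3 * q + 1))).image c ∪ Y := by
          ext a
          simp only [Finset.mem_filter, Finset.mem_erase, Finset.mem_union]
          constructor
          · rintro ⟨⟨hne, h | h⟩, haR⟩
            · left
              obtain ⟨i, hi', rfl⟩ := Finset.mem_image.1 h
              rw [Finset.mem_Ico] at hi'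
              rw [hR _ _ (by omega) (by omega) (by omega) (by omega)] at haR
              exact Finset.mem_image_of_mem _ (Finset.mem_Ico.2 (by omega))
            · exact Or.inr h
          · rintro (h | h)
            · obtain ⟨i, hi', rfl⟩ := Finset.mem_image.1 h
              rw [Finset.mem_Ico] at hi'
              refine ⟨⟨fun h => ?_, Or.inl (Finset.mem_image_of_mem _ (Finset.mem_Ico.2 (by omega)))⟩,
                ?_⟩
              · have := hinj _ _ (by omega) (by omega) (by omega) (by omega) h
                omega
              · rw [hR _ _ (by omega) (by omega) (by omega) (by omega)]
                omega
            · refine ⟨⟨?_, Or.inr h⟩, hY _ (by omega) (by omega) a h⟩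
              rintro rfl
              exact hi _ (hY _ (by omega) (by omega) _ h)
        rw [e]
        refine ih (p + 3) ?_ ?_ ?_
        · intro i j h1 h2 h3 h4
          exact hR i j (by omega) (by omega) (by omega) (by omega)
        · intro i j h1 h2 h3 h4
          exact hinj i j (by omega) (by omega) (by omega) (by omega)
        · intro i h1 h2
          exact hY i (by omega) (by omega)
      · refine NE.cone (c p) ?_ ?_
        · refine Finset.mem_erase.2 ⟨fun h => ?_, Finset.mem_erase.2 ⟨fun h => ?_,
            memS _ (by omega) (by omega)⟩⟩
          · have := hinj _ _ (by omega) (by omega) (by omega) (by omega) h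
            omega
          · have := hinj _ _ (by omega) (by omega) (by omega) (by omega) h
            omega
        · intro a ha hne
          obtain ⟨h1, ha⟩ := Finset.mem_erase.1 ha
          obtain ⟨h2, ha⟩ := Finset.mem_erase.1 ha
          rcases Finset.mem_union.1 ha with h | h
          · obtain ⟨i, hi', rfl⟩ := Finset.mem_image.1 h
            rw [Finset.mem_Ico] at hi'
            rw [hR _ _ (by omega) (by omega) (by omega) (by omega)]
            have : i ≠ p := by rintro rfl; exact hne rfl
            have : i ≠ p + 1 := by rintro rfl; exact h1 rfl
            have : i ≠ p + 2 := by rintro rfl; exact h2 rfl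
            omega
          · exact hY p le_rfl (by omega) a h

/-- The structural lemma when there is no pendant vertex, in compressed coordinates. -/
lemma struct_nat (hi : ∀ a, ¬ R a a) {l r : α → ℕ} {E : Finset α} (h : OP R l r E)
    (hne : E.Nonempty)
    (hcont : ∀ e ∈ E, ∀ i ≤ r e, ∃ g ∈ E, l g = i ∨ r g = i)
    (hpen : ∀ e ∈ E, ∀ v, (v = l e ∨ v = r e) → ∃ g ∈ E, g ≠ e ∧ (l g = v ∨ r g = v)) :
    ∃ w ∈ E, ∃ X, NE R X ∧ E.filter (R w) ⊆ X ∧ X ⊆ E.erase w := by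
  have hex : (E.filter fun e => l e + 2 ≤ r e).Nonempty := by
    obtain ⟨e0, he0⟩ := hne
    obtain ⟨g, hg, hg0⟩ := hcont e0 he0 0 (Nat.zero_le _)
    have hglt := h.lt g hg
    have hg0 : l g = 0 := by omega
    obtain ⟨k, hk, hkg, hk0⟩ := hpen g hg (l g) (Or.inl rfl)
    have hklt := h.lt k hk
    have hk0 : l k = 0 := by omega
    have : r k ≠ r g := fun h' => hkg (h.inj k hk g hg (by omega) h')
    by_cases h2 : 2 ≤ r g
    · exact ⟨g, Finset.mem_filter.2 ⟨hg, by omega⟩⟩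
    · exact ⟨k, Finset.mem_filter.2 ⟨hk, by omega⟩⟩
  obtain ⟨w, hw, hmin⟩ := Finset.exists_min_image _ (fun e => r e - l e) hex
  obtain ⟨hw, hw2⟩ := Finset.mem_filter.1 hw
  have hmin' : ∀ e ∈ E, r e - l e < r w - l w → r e = l e + 1 := by
    intro e he hlt
    have := h.lt e he
    by_contra hc
    have := hmin e (Finset.mem_filter.2 ⟨he, by omega⟩)
    omega
  -- edges at interior vertices are short
  have short : ∀ e ∈ E, ∀ i, l w < i → i < r w → (l e = i ∨ r e = i) → r e = l e + 1 := by
    intro e he i h1 h2 hh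
    have elt := h.lt e he
    apply hmin' e he
    rcases hh with hh | hh
    · have := h.nc w hw e he
      have : r e ≤ r w := by
        by_contra hcon
        exact this (by omega) (by omega) (by omega)
      omega
    · have := h.nc e he w hw
      have : l w ≤ l e := by
        by_contra hcon
        exact this (by omega) (by omega) (by omega)
      omega
  have both : ∀ i, l w < i → i < r w →
      (∃ c ∈ E, l c = i ∧ r c = i + 1) ∧ (∃ c ∈ E, l c + 1 = i ∧ r c = i) := by
    intro i h1 h2
    obtain ⟨e, he, hei⟩ := hcont w hw i (by omega)
    obtain ⟨g, hg, hge, hgi⟩ := hpen e he i (by omega)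
    have s1 := short e he i h1 h2 hei
    have s2 := short g hg i h1 h2 hgi
    have hdiff : l g ≠ l e := fun h' => hge (h.inj g hg e he h' (by omega))
    by_cases hl : l e = i
    · exact ⟨⟨e, he, by omega, by omega⟩, ⟨g, hg, by omega, by omega⟩⟩
    · exact ⟨⟨g, hg, by omega, by omega⟩, ⟨e, he, by omega, by omega⟩⟩
  have hcex : ∀ j, ∃ c, l w ≤ j → j < r w → c ∈ E ∧ l c = j ∧ r c = j + 1 := by
    intro j
    by_cases hj : l w ≤ j ∧ j < r w
    · by_cases hj2 : l w = j
      · obtain ⟨-, c, hc, h1, h2⟩ := both (j + 1) (by omega) (by omega)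
        exact ⟨c, fun _ _ => ⟨hc, by omega, by omega⟩⟩
      · obtain ⟨⟨c, hc, h1, h2⟩, -⟩ := both j (by omega) (by omega)
        exact ⟨c, fun _ _ => ⟨hc, by omega, by omega⟩⟩
    · exact ⟨w, fun h1 h2 => absurd ⟨h1, h2⟩ hj⟩
  choose c hc using hcex
  let Y := E.filter fun e => (l e < l w ∨ r w < l e) ∧ (r e < l w ∨ r w < r e)
  obtain ⟨p, q, hp1, hp2, hp3, hp4⟩ : ∃ p q, l w ≤ p ∧ p ≤ l w + 1 ∧ r w ≤ p + (3 * q + 1) + 1 ∧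
      p + (3 * q + 1) ≤ r w := by
    have : (r w - l w) % 3 = 0 ∨ (r w - l w) % 3 = 1 ∨ (r w - l w) % 3 = 2 := by omega
    rcases this with h3 | h3 | h3
    · exact ⟨l w + 1, (r w - l w) / 3 - 1, by omega, by omega, by omega, by omega⟩
    · exact ⟨l w, (r w - l w) / 3, by omega, by omega, by omega, by omega⟩
    · exact ⟨l w, (r w - l w) / 3, by omega, by omega, by omega, by omega⟩
  refine ⟨w, hw, (Finset.Ico p (p + (3 * q + 1))).image c ∪ Y, ?_, ?_, ?_⟩
  · refine path_NE hi c Y q p ?_ ?_ ?_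
    · intro i j h1 h2 h3 h4
      obtain ⟨m1, l1, r1⟩ := hc i (by omega) (by omega)
      obtain ⟨m2, l2, r2⟩ := hc j (by omega) (by omega)
      rw [h.hR _ m1 _ m2]
      omega
    · intro i j h1 h2 h3 h4 hij
      obtain ⟨m1, l1, r1⟩ := hc i (by omega) (by omega)
      obtain ⟨m2, l2, r2⟩ := hc j (by omega) (by omega)
      rw [← l1, ← l2, hij]
    · intro i h1 h2 y hy
      obtain ⟨m1, l1, r1⟩ := hc i (by omega) (by omega)
      obtain ⟨m2, hy⟩ := Finset.mem_filter.1 hy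
      rw [h.hR _ m1 _ m2]
      omega
  · intro e he
    obtain ⟨he, heR⟩ := Finset.mem_filter.1 he
    rw [h.hR _ hw _ he] at heR
    have elt := h.lt e he
    by_cases hY : (l e < l w ∨ r w < l e) ∧ (r e < l w ∨ r w < r e)
    · exact Finset.mem_union_right _ (Finset.mem_filter.2 ⟨he, hY⟩)
    · apply Finset.mem_union_left
      have s : r e = l e + 1 := by
        by_cases h1 : l w < l e ∧ l e < r w
        · exact short e he (l e) h1.1 h1.2 (Or.inl rfl)
        · exact short e he (r e) (by omega) (by omega) (Or.inr rfl)
      obtain ⟨m1, l1, r1⟩ := hc (l e) (by omega) (by omega)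
      refine Finset.mem_image.2 ⟨l e, Finset.mem_Ico.2 (by omega), ?_⟩
      exact h.inj _ m1 _ he l1 (by omega)
  · intro e he
    rcases Finset.mem_union.1 he with h' | h'
    · obtain ⟨i, hi', rfl⟩ := Finset.mem_image.1 h'
      rw [Finset.mem_Ico] at hi'
      obtain ⟨m1, l1, r1⟩ := hc i (by omega) (by omega)
      refine Finset.mem_erase.2 ⟨fun h'' => ?_, m1⟩
      rw [h''] at l1 r1
      omega
    · obtain ⟨m2, hy⟩ := Finset.mem_filter.1 h'
      refine Finset.mem_erase.2 ⟨fun h'' => ?_, m2⟩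
      rw [h''] at hy
      omega

/-- Compression of coordinates. -/
lemma compress {P : Type*} [LinearOrder P] {l r : α → P} {E : Finset α} (h : OP R l r E) :
    ∃ rk : P → ℕ, OP R (fun e => rk (l e)) (fun e => rk (r e)) E ∧
      (∀ e ∈ E, ∀ i ≤ rk (r e), ∃ g ∈ E, rk (l g) = i ∨ rk (r g) = i) ∧
      (∀ e ∈ E, ∀ g ∈ E, (rk (l e) = rk (l g) → l e = l g) ∧ (rk (l e) = rk (r g) → l e = r g) ∧
        (rk (r e) = rk (l g) → r e = l g) ∧ (rk (r e) = rk (r g) → r e = r g)) := by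
  classical
  let U : Finset P := E.image l ∪ E.image r
  let o := U.orderIsoOfFin rfl
  let rk : P → ℕ := fun v => if hv : v ∈ U then (o.symm ⟨v, hv⟩ : ℕ) else 0
  have hl : ∀ e ∈ E, l e ∈ U := fun e he =>
    Finset.mem_union_left _ (Finset.mem_image_of_mem _ he)
  have hr : ∀ e ∈ E, r e ∈ U := fun e he =>
    Finset.mem_union_right _ (Finset.mem_image_of_mem _ he)
  have hlt : ∀ u ∈ U, ∀ v ∈ U, (rk u < rk v ↔ u < v) := by
    intro u hu v hv
    simp only [rk, dif_pos hu, dif_pos hv]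
    rw [Fin.val_fin_lt, o.symm.lt_iff_lt]
    exact Iff.rfl
  have heq : ∀ u ∈ U, ∀ v ∈ U, (rk u = rk v ↔ u = v) := by
    intro u hu v hv
    refine ⟨fun h' => ?_, fun h' => by rw [h']⟩
    rcases lt_trichotomy u v with h1 | h1 | h1
    · have := (hlt u hu v hv).2 h1; omega
    · exact h1
    · have := (hlt v hv u hu).2 h1; omega
  refine ⟨rk, ⟨?_, ?_, ?_, ?_⟩, ?_, ?_⟩
  · intro e he
    exact (hlt _ (hl e he) _ (hr e he)).2 (h.lt e he)
  · intro e he g hg h1 h2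
    exact h.inj e he g hg ((heq _ (hl e he) _ (hl g hg)).1 h1) ((heq _ (hr e he) _ (hr g hg)).1 h2)
  · intro e he g hg h1 h2 h3
    exact h.nc e he g hg ((hlt _ (hl e he) _ (hl g hg)).1 h1) ((hlt _ (hl g hg) _ (hr e he)).1 h2)
      ((hlt _ (hr e he) _ (hr g hg)).1 h3)
  · intro e he g hg
    rw [h.hR e he g hg, Ne, Ne, Ne, Ne, Ne, Ne, Ne, Ne, heq _ (hl e he) _ (hl g hg),
      heq _ (hl e he) _ (hr g hg), heq _ (hr e he) _ (hl g hg), heq _ (hr e he) _ (hr g hg)]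
  · intro e he i hi'
    have hcard : i < U.card := by
      refine lt_of_le_of_lt hi' ?_
      simp only [rk, dif_pos (hr e he)]
      exact Fin.is_lt _
    have hm : (o ⟨i, hcard⟩).1 ∈ U := (o ⟨i, hcard⟩).2
    have hrk : rk (o ⟨i, hcard⟩).1 = i := by
      simp only [rk, dif_pos hm]
      simp
    rcases Finset.mem_union.1 hm with h' | h'
    · obtain ⟨g, hg, hg'⟩ := Finset.mem_image.1 h'
      exact ⟨g, hg, Or.inl (by rw [hg', hrk])⟩
    · obtain ⟨g, hg, hg'⟩ := Finset.mem_image.1 h'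
      exact ⟨g, hg, Or.inr (by rw [hg', hrk])⟩
  · intro e he g hg
    exact ⟨(heq _ (hl e he) _ (hl g hg)).1, (heq _ (hl e he) _ (hr g hg)).1,
      (heq _ (hr e he) _ (hl g hg)).1, (heq _ (hr e he) _ (hr g hg)).1⟩

lemma struct {P : Type*} [LinearOrder P] (hi : ∀ a, ¬ R a a)
    {l r : α → P} {E : Finset α}
    (h : OP R l r E) (hne : E.Nonempty) (hnc : ∀ e ∈ E, ∃ a ∈ E, a ≠ e ∧ ¬ R e a) :
    ∃ w ∈ E, ∃ X, NE R X ∧ E.filter (R w) ⊆ X ∧ X ⊆ E.erase w := by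
  by_cases hp : ∃ e ∈ E, ∃ v, (v = l e ∨ v = r e) ∧ ∀ g ∈ E, (l g = v ∨ r g = v) → g = e
  · obtain ⟨e, he, v, hv, hg⟩ := hp
    obtain ⟨w, hw, hwe, hwR⟩ := hnc e he
    refine ⟨w, hw, insert e (E.filter (R w)), ?_, Finset.subset_insert _ _, ?_⟩
    · refine NE.cone e (Finset.mem_insert_self _ _) ?_
      intro a ha hae
      obtain ⟨ha, haR⟩ := Finset.mem_filter.1 ((Finset.mem_insert.1 ha).resolve_left hae)
      have h1 := hg a ha
      have h2 := hg w hw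
      rw [h.hR _ he _ hw] at hwR
      rw [h.hR _ hw _ ha] at haR
      rw [h.hR _ he _ ha]
      have elt := h.lt e he
      have n1 : l a ≠ v := fun h' => hae (h1 (Or.inl h'))
      have n2 : r a ≠ v := fun h' => hae (h1 (Or.inr h'))
      have n3 : l w ≠ v := fun h' => hwe (h2 (Or.inl h'))
      have n4 : r w ≠ v := fun h' => hwe (h2 (Or.inr h'))
      clear h1 h2 hg
      grind
    · intro a ha
      rcases Finset.mem_insert.1 ha with rfl | ha
      · exact Finset.mem_erase.2 ⟨hwe.symm, he⟩
      · exact filter_sub_erase hi E w ha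
  · push Not at hp
    obtain ⟨rk, h1, h2, h3⟩ := compress h
    refine struct_nat hi h1 hne h2 ?_
    rintro e he v hv
    rcases hv with rfl | rfl
    · obtain ⟨g, hg, hg1, hg2⟩ := hp e he (l e) (Or.inl rfl)
      exact ⟨g, hg, hg2, hg1.imp (congrArg rk) (congrArg rk)⟩
    · obtain ⟨g, hg, hg1, hg2⟩ := hp e he (r e) (Or.inr rfl)
      exact ⟨g, hg, hg2, hg1.imp (congrArg rk) (congrArg rk)⟩

lemma meet_two {P : Type*} {a b g1 g2 h1 h2 : P} (d : g1 ≠ h1 ∧ g1 ≠ h2 ∧ g2 ≠ h1 ∧ g2 ≠ h2)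
    (m1 : ¬ (a ≠ g1 ∧ a ≠ g2 ∧ b ≠ g1 ∧ b ≠ g2)) (m2 : ¬ (a ≠ h1 ∧ a ≠ h2 ∧ b ≠ h1 ∧ b ≠ h2)) :
    ((a = g1 ∨ a = g2) ∧ (b = h1 ∨ b = h2)) ∨ ((a = h1 ∨ a = h2) ∧ (b = g1 ∨ b = g2)) := by
  grind

lemma conn_aux {P : Type*} [LinearOrder P] {g1 g2 h1 h2 x1 x2 y1 y2 z1 z2 : P}
    (d : g1 ≠ h1 ∧ g1 ≠ h2 ∧ g2 ≠ h1 ∧ g2 ≠ h2)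
    (ly : y1 < y2) (lz : z1 < z2)
    (xy : x1 ≠ y1 ∧ x1 ≠ y2 ∧ x2 ≠ y1 ∧ x2 ≠ y2) (xz : x1 ≠ z1 ∧ x1 ≠ z2 ∧ x2 ≠ z1 ∧ x2 ≠ z2)
    (xg : ¬ (x1 ≠ g1 ∧ x1 ≠ g2 ∧ x2 ≠ g1 ∧ x2 ≠ g2))
    (xh : ¬ (x1 ≠ h1 ∧ x1 ≠ h2 ∧ x2 ≠ h1 ∧ x2 ≠ h2))
    (yg : ¬ (y1 ≠ g1 ∧ y1 ≠ g2 ∧ y2 ≠ g1 ∧ y2 ≠ g2))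
    (yh : ¬ (y1 ≠ h1 ∧ y1 ≠ h2 ∧ y2 ≠ h1 ∧ y2 ≠ h2))
    (zg : ¬ (z1 ≠ g1 ∧ z1 ≠ g2 ∧ z2 ≠ g1 ∧ z2 ≠ g2))
    (zh : ¬ (z1 ≠ h1 ∧ z1 ≠ h2 ∧ z2 ≠ h1 ∧ z2 ≠ h2)) : y1 = z1 ∧ y2 = z2 := by
  have mx := meet_two d xg xh
  have my := meet_two d yg yh
  have mz := meet_two d zg zh
  have ly' := ly.ne
  have lz' := lz.ne
  have ly2 := ly.not_gt
  have lz2 := lz.not_gt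
  clear xg xh yg yh zg zh
  rcases mx with ⟨rfl | rfl, rfl | rfl⟩ | ⟨rfl | rfl, rfl | rfl⟩ <;>
  rcases my with ⟨rfl | rfl, rfl | rfl⟩ | ⟨rfl | rfl, rfl | rfl⟩ <;>
  simp only [ne_eq, not_true_eq_false, false_and, and_false] at xy <;>
  rcases mz with ⟨rfl | rfl, rfl | rfl⟩ | ⟨rfl | rfl, rfl | rfl⟩ <;>
  simp only [ne_eq, not_true_eq_false, false_and, and_false] at xz <;>
  first
    | exact ⟨rfl, rfl⟩
    | exact absurd ly lz2

lemma conn_lemma {P : Type*} [LinearOrder P] (hs : ∀ a b, R a b → R b a) {l r : α → P}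
    {E : Finset α} (h : OP R l r E) (h1 : ∀ g ∈ E, ∃ g' ∈ E, R g g')
    (h2 : ∃ x ∈ E, ∃ y ∈ E, ∃ z ∈ E, y ≠ z ∧ R x y ∧ R x z) : Conn R E := by
  obtain ⟨x, hx, y, hy, z, hz, hyz, hxy, hxz⟩ := h2
  let Q : α → α → Prop := fun a b => a ∈ E ∧ b ∈ E ∧ R a b
  have hQ : Std.Symm Q := ⟨fun a b h => ⟨h.2.1, h.1, hs _ _ h.2.2⟩⟩
  have key : ∀ g ∈ E, Relation.ReflTransGen Q x g := by
    intro g hg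
    by_contra hcon
    obtain ⟨k, hk, hgk⟩ := h1 g hg
    have ng : ∀ a ∈ E, Relation.ReflTransGen Q x a → ¬ R a g := fun a ha hra hR =>
      hcon (hra.tail ⟨ha, hg, hR⟩)
    have nk : ∀ a ∈ E, Relation.ReflTransGen Q x a → ¬ R a k := fun a ha hra hR =>
      hcon ((hra.tail ⟨ha, hk, hR⟩).tail ⟨hk, hg, hs _ _ hgk⟩)
    have ry : Relation.ReflTransGen Q x y := Relation.ReflTransGen.single ⟨hx, hy, hxy⟩
    have rz : Relation.ReflTransGen Q x z := Relation.ReflTransGen.single ⟨hx, hz, hxz⟩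
    have a1 := ng x hx Relation.ReflTransGen.refl
    have a2 := nk x hx Relation.ReflTransGen.refl
    have a3 := ng y hy ry
    have a4 := nk y hy ry
    have a5 := ng z hz rz
    have a6 := nk z hz rz
    rw [h.hR _ hx _ hg] at a1
    rw [h.hR _ hx _ hk] at a2
    rw [h.hR _ hy _ hg] at a3
    rw [h.hR _ hy _ hk] at a4
    rw [h.hR _ hz _ hg] at a5
    rw [h.hR _ hz _ hk] at a6
    rw [h.hR _ hg _ hk] at hgk
    rw [h.hR _ hx _ hy] at hxy
    rw [h.hR _ hx _ hz] at hxz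
    obtain ⟨e1, e2⟩ := conn_aux hgk (h.lt y hy) (h.lt z hz) hxy hxz a1 a2 a3 a4 a5 a6
    exact hyz (h.inj y hy z hz e1 e2)
  intro a ha b hb
  exact ((Relation.ReflTransGen.stdSymm (r := Q)).symm _ _ (key a ha)).trans (key b hb)

theorem main_comb {P : Type*} [LinearOrder P] (hs : ∀ a b, R a b → R b a) (hi : ∀ a, ¬ R a a)
    {l r : α → P} (E : Finset α) : OP R l r E → E = ∅ ∨ Gd R E := by
  induction E using Finset.strongInduction with
  | H E ih =>
  intro h
  rcases Finset.eq_empty_or_nonempty E with hE | hE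
  · exact Or.inl hE
  right
  have ihe : ∀ e ∈ E, E.erase e = ∅ ∨ Gd R (E.erase e) := fun e he =>
    ih _ (Finset.erase_ssubset he) (h.mono (Finset.erase_subset _ _))
  have ihf : ∀ e ∈ E, E.filter (R e) = ∅ ∨ Gd R (E.filter (R e)) := fun e he =>
    ih _ (lt_of_le_of_lt (filter_sub_erase hi E e) (Finset.erase_ssubset he))
      (h.mono (Finset.filter_subset _ _))
  by_cases c1 : ∃ e ∈ E, E.filter (R e) = ∅
  · obtain ⟨e, he, hf⟩ := c1
    rcases ihe e he with h0 | h0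
    · refine Gd.ne (NE.cone e he fun a ha hae => ?_)
      have : a ∈ E.erase e := Finset.mem_erase.2 ⟨hae, ha⟩
      rw [h0] at this
      simp at this
    · exact Gd.iso e he hf h0
  push Not at c1
  have eg : ∀ e ∈ E, Gd R (E.erase e) := fun e he => (ihe e he).resolve_left fun h0 => by
    obtain ⟨a, ha⟩ := Finset.nonempty_iff_ne_empty.2 (Finset.nonempty_iff_ne_empty.1 (c1 e he))
    have := filter_sub_erase hi E e ha
    rw [h0] at this
    simp at this
  by_cases c2 : ∃ e ∈ E, ∃ x, E.filter (R e) = {x}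
  · obtain ⟨e, he, x, hx⟩ := c2
    refine Gd.leaf e he ?_ (eg e he)
    rw [hx]
    refine NE.cone x (by simp) ?_
    intro a ha hax
    exact absurd (Finset.mem_singleton.1 ha) hax
  by_cases c3 : ∃ e ∈ E, ∀ a ∈ E, a ≠ e → R e a
  · obtain ⟨e, he, ha⟩ := c3
    exact Gd.ne (NE.cone e he ha)
  push Not at c2 c3
  have two : ∀ e ∈ E, ∃ y ∈ E, ∃ z ∈ E, y ≠ z ∧ R e y ∧ R e z := by
    intro e he
    obtain ⟨y, hy⟩ := c1 e he
    by_contra hcon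
    push Not at hcon
    apply c2 e he y
    rw [Finset.mem_filter] at hy
    ext z
    simp only [Finset.mem_filter, Finset.mem_singleton]
    constructor
    · rintro ⟨hz, hRz⟩
      by_contra hzy
      exact hcon y hy.1 z hz (Ne.symm hzy) hy.2 hRz
    · rintro rfl; exact hy
  obtain ⟨w, hw, X, hX, hX1, hX2⟩ := struct hi h hE c3
  refine Gd.attach w hw X hX hX1 hX2 ((ihf w hw).resolve_left ?_) (eg w hw) ?_
  · exact Finset.nonempty_iff_ne_empty.1 (c1 w hw)
  · refine conn_lemma hs (h.mono (Finset.erase_subset w E)) ?_ ?_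
    · intro g hg
      obtain ⟨y, hy, z, hz, hyz, hgy, hgz⟩ := two g (Finset.mem_of_mem_erase hg)
      by_cases hyw : y = w
      · exact ⟨z, Finset.mem_erase.2 ⟨fun h' => hyz (hyw.trans h'.symm), hz⟩, hgz⟩
      · exact ⟨y, Finset.mem_erase.2 ⟨hyw, hy⟩, hgy⟩
    · obtain ⟨x, hx, hxw, hxR⟩ := c3 w hw
      obtain ⟨y, hy, z, hz, hyz, hgy, hgz⟩ := two x hx
      refine ⟨x, Finset.mem_erase.2 ⟨hxw, hx⟩, y, Finset.mem_erase.2 ⟨?_, hy⟩, z,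
        Finset.mem_erase.2 ⟨?_, hz⟩, hyz, hgy, hgz⟩
      · rintro rfl; exact hxR (hs _ _ hgy)
      · rintro rfl; exact hxR (hs _ _ hgz)

end comb

/-! ### The matching complex -/

section final

variable {V : Type*}

/-- Vertex-disjointness of edges. -/
def dj (e g : Sym2 V) : Prop := ∀ v, v ∈ e → v ∉ g

lemma dj_symm (e g : Sym2 V) (h : dj e g) : dj g e := fun v hv hv' => h v hv' hv

lemma dj_irrefl (e : Sym2 V) : ¬ dj e e := by
  induction e with
  | _ a b => exact fun h => h a (by simp) (by simp)

/-- Left and right end of an edge. -/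
def lft (f : V ↪ ℝ) (e : Sym2 V) : ℝ := (e.map f).inf
def rgt (f : V ↪ ℝ) (e : Sym2 V) : ℝ := (e.map f).sup

lemma lft_mk (f : V ↪ ℝ) (a b : V) : lft f s(a, b) = min (f a) (f b) := rfl
lemma rgt_mk (f : V ↪ ℝ) (a b : V) : rgt f s(a, b) = max (f a) (f b) := rfl

lemma dj_mk (a b c d : V) : dj s(a, b) s(c, d) ↔ (a ≠ c ∧ a ≠ d ∧ b ≠ c ∧ b ≠ d) := by
  simp only [dj, Sym2.mem_iff]
  constructor
  · intro h
    have h1 := h a (Or.inl rfl)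
    have h2 := h b (Or.inr rfl)
    tauto
  · rintro ⟨h1, h2, h3, h4⟩ v (rfl | rfl) <;> tauto

lemma OP_graph [DecidableEq (Sym2 V)] (G : SimpleGraph V) (f : V ↪ ℝ)
    (hf : ∀ a b c d, G.Adj a b → G.Adj c d →
      a ≠ c → a ≠ d → b ≠ c → b ≠ d → ¬ chordsCross (f a) (f b) (f c) (f d))
    (E : Finset (Sym2 V)) (hE : ∀ e ∈ E, e ∈ G.edgeSet) : OP dj (lft f) (rgt f) E := by
  have fi : ∀ a b, f a = f b ↔ a = b := fun a b => f.injective.eq_iff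
  refine ⟨?_, ?_, ?_, ?_⟩
  · intro e he
    have := hE e he
    induction e with
    | _ a b =>
      rw [SimpleGraph.mem_edgeSet] at this
      rw [lft_mk, rgt_mk, min_lt_max]
      exact fun h => this.ne (f.injective h)
  · intro e he g hg h1 h2
    clear he hg
    induction e with
    | _ a b =>
      induction g with
      | _ c d =>
        rw [lft_mk, lft_mk] at h1
        rw [rgt_mk, rgt_mk] at h2
        rw [Sym2.eq_iff, ← fi, ← fi, ← fi, ← fi]
        rcases le_total (f a) (f b) with h3 | h3 <;> rcases le_total (f c) (f d) with h4 | h4 <;>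
        simp only [min_eq_left, min_eq_right, max_eq_left, max_eq_right, h3, h4] at h1 h2 <;> tauto
  · intro e he g hg h1 h2 h3
    have h4 := hE e he
    have h5 := hE g hg
    clear he hg
    induction e with
    | _ a b =>
      induction g with
      | _ c d =>
        rw [SimpleGraph.mem_edgeSet] at h4 h5
        rw [lft_mk] at h1 h2
        rw [rgt_mk] at h2 h3
        rw [lft_mk] at h1
        rw [rgt_mk] at h3
        refine hf a b c d h4 h5 ?_ ?_ ?_ ?_ (Or.inl ⟨h1, h2, h3⟩) <;>
        · intro h6
          subst h6
          clear hf
          grind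
  · intro e he g hg
    have h4 := hE e he
    have h5 := hE g hg
    clear he hg
    induction e with
    | _ a b =>
      induction g with
      | _ c d =>
        rw [dj_mk, lft_mk, lft_mk, rgt_mk, rgt_mk, Ne, Ne, Ne, Ne, ← fi, ← fi, ← fi, ← fi]
        rcases le_total (f a) (f b) with h3 | h3 <;> rcases le_total (f c) (f d) with h4 | h4 <;>
        simp only [min_eq_left, min_eq_right, max_eq_left, max_eq_right, h3, h4] <;> tauto

lemma realization_eq [Fintype V] [Fintype (Sym2 V)] [DecidableEq (Sym2 V)] (G : SimpleGraph V)
    (E : Finset (Sym2 V)) (hE : ∀ e, e ∈ E ↔ e ∈ G.edgeSet) :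
    {f : Sym2 V → ℝ | (∀ a, 0 ≤ f a) ∧ ∃ s ∈ matchingComplex G,
      Function.support f ⊆ ↑s ∧ ∑ a ∈ s, f a = 1} = FRset dj E := by
  ext f
  constructor
  · rintro ⟨h0, s, hs, hsub, hsum⟩
    have hz : ∀ a, a ∉ s → f a = 0 := fun a ha => by
      by_contra h
      exact ha (Finset.mem_coe.1 (hsub h))
    refine ⟨h0, ?_, fun a ha => ?_, fun a b hab hR => ?_⟩
    · rw [← hsum]
      exact (Finset.sum_subset (Finset.subset_univ s) fun a _ ha => hz a ha).symm
    · exact hz a fun h => ha ((hE a).2 (hs.1 a h))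
    · by_cases ha : a ∈ s
      · by_cases hb : b ∈ s
        · exact absurd (hs.2 a ha b hb hab) hR
        · rw [hz b hb, mul_zero]
      · rw [hz a ha, zero_mul]
  · rintro ⟨h0, h1, h2, h3⟩
    refine ⟨h0, Finset.univ.filter (fun a => f a ≠ 0), ⟨fun e he => ?_, fun e he g hg hne => ?_⟩,
      ?_, ?_⟩
    · rw [← hE]
      by_contra h
      exact (Finset.mem_filter.1 he).2 (h2 e h)
    · by_contra hR
      rcases mul_eq_zero.1 (h3 e g hne hR) with h | h
      · exact (Finset.mem_filter.1 he).2 h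
      · exact (Finset.mem_filter.1 hg).2 h
    · intro a ha
      simpa using ha
    · rw [← h1]
      exact Finset.sum_filter_ne_zero _

end final

end MCO

/-- Main theorem: the matching complex of an outerplanar graph is contractible or homotopy
equivalent to a wedge of spheres. -/
theorem matchingComplex_outerplanar_contractible_or_wedge
    {V : Type*} [Fintype V] (G : SimpleGraph V) (hop : Outerplanar G) :
    ContractibleSpace (realization (matchingComplex G)) ∨
      IsWedgeOfSpheres (realization (matchingComplex G)) := by
  classical
  obtain ⟨f, hf⟩ := hop
  let E : Finset (Sym2 V) := Finset.univ.filter fun e => e ∈ G.edgeSet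
  have hE : ∀ e, e ∈ E ↔ e ∈ G.edgeSet := fun e => by simp [E]
  have h1 := MCO.OP_graph G f hf E fun e he => (hE e).1 he
  let H : realization (matchingComplex G) ≃ₜ MCO.FR (MCO.dj (V := V)) E :=
    Homeomorph.setCongr (MCO.realization_eq G E hE)
  rcases MCO.main_comb MCO.dj_symm MCO.dj_irrefl E h1 with h2 | h2
  · right
    have : IsEmpty (realization (matchingComplex G)) := by
      refine ⟨fun x => ?_⟩
      have hx := (H x).2
      have h0 : ∀ a, (H x).1 a = 0 := fun a => hx.2.2.1 a (by simp [h2])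
      have := hx.2.1
      simp [h0] at this
    exact MCO.empty_wedge
  · exact ((h2.good MCO.dj_symm MCO.dj_irrefl).of_equiv H.toHomotopyEquiv).final
end
end

section
/- If G is a forest, then the matching complex M(G) is contractible or homotopy equivalent to a wedge of spheres. -/
noncomputable section

section Development
open Topology unitInterval ContinuousMap

/-- Package a path-valued map as a relative homotopy. -/
lemma homRel_of {X Y : Type*} [TopologicalSpace X] [TopologicalSpace Y] (F G : C(X, Y)) (S : Set X)
    (H : C(X, C(I, Y))) (h0 : ∀ x, H x 0 = F x) (h1 : ∀ x, H x 1 = G x)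
    (hS : ∀ x ∈ S, ∀ t, H x t = F x) : F.HomotopicRel G S :=
  ⟨{ toFun := fun p => H p.2 p.1
     continuous_toFun := by
       have := (ContinuousMap.uncurry H).continuous
       exact this.comp continuous_swap
     map_zero_left := h0
     map_one_left := h1
     prop' := fun t x hx => hS x hx t }⟩

/-- Extract a path-valued map from a relative homotopy. -/
lemma homRel_out {X Y : Type*} [TopologicalSpace X] [TopologicalSpace Y] {F G : C(X, Y)} {S : Set X}
    (h : F.HomotopicRel G S) : ∃ H : C(X, C(I, Y)), (∀ x, H x 0 = F x) ∧ (∀ x, H x 1 = G x) ∧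
    (∀ x ∈ S, ∀ t, H x t = F x) := by
  obtain ⟨K⟩ := h
  refine ⟨(K.toContinuousMap.comp ContinuousMap.prodSwap).curry, fun x => K.apply_zero x,
    fun x => K.apply_one x, fun x hx t => K.eq_fst t hx⟩

/-- Pointed homotopy equivalence. -/
def PEq {X Y : Type*} [TopologicalSpace X] [TopologicalSpace Y] (x : X) (y : Y) : Prop :=
  ∃ (f : C(X, Y)) (g : C(Y, X)), f x = y ∧ g y = x ∧
    (g.comp f).HomotopicRel (ContinuousMap.id X) {x} ∧
    (f.comp g).HomotopicRel (ContinuousMap.id Y) {y}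

lemma PEq.symm {X Y : Type*} [TopologicalSpace X] [TopologicalSpace Y] {x : X} {y : Y}
    (h : PEq x y) : PEq y x := by
  obtain ⟨f, g, h1, h2, h3, h4⟩ := h
  exact ⟨g, f, h2, h1, h4, h3⟩

lemma PEq.trans {X Y Z : Type*} [TopologicalSpace X] [TopologicalSpace Y] [TopologicalSpace Z]
    {x : X} {y : Y} {z : Z} (h : PEq x y) (h' : PEq y z) : PEq x z := by
  obtain ⟨f, g, h1, h2, h3, h4⟩ := h
  obtain ⟨f', g', h1', h2', h3', h4'⟩ := h'
  refine ⟨f'.comp f, g.comp g', by simp [h1, h1'], by simp [h2, h2'], ?_, ?_⟩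
  · refine HomotopicRel.trans (g := g.comp f) ?_ h3
    obtain ⟨H, a, b, c⟩ := homRel_out h3'
    refine homRel_of _ _ _ ⟨fun u => g.comp (H (f u)), by fun_prop⟩ ?_ ?_ ?_
    · intro u; simp [a]
    · intro u; simp [b]
    · rintro u rfl t; simp [h1, c]
  · refine HomotopicRel.trans (g := f'.comp g') ?_ h4'
    obtain ⟨H, a, b, c⟩ := homRel_out h4
    refine homRel_of _ _ _ ⟨fun u => f'.comp (H (g' u)), by fun_prop⟩ ?_ ?_ ?_
    · intro u; simp [a]
    · intro u; simp [b]
    · rintro u rfl t; simp [h2', c]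

lemma PEq.of_inverse {X Y : Type*} [TopologicalSpace X] [TopologicalSpace Y] {x : X} {y : Y}
    (f : C(X, Y)) (g : C(Y, X)) (hx : f x = y) (h1 : ∀ u, g (f u) = u) (h2 : ∀ u, f (g u) = u) :
    PEq x y := by
  refine ⟨f, g, hx, by rw [← hx, h1], ?_, ?_⟩
  · have : g.comp f = ContinuousMap.id X := by ext u; exact h1 u
    rw [this]; exact HomotopicRel.refl _
  · have : f.comp g = ContinuousMap.id Y := by ext u; exact h2 u
    rw [this]; exact HomotopicRel.refl _

lemma PEq.of_homeo {X Y : Type*} [TopologicalSpace X] [TopologicalSpace Y] {x : X} {y : Y}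
    (f : X ≃ₜ Y) (hx : f x = y) : PEq x y :=
  PEq.of_inverse (f : C(X, Y)) (f.symm : C(Y, X)) hx (by simp) (by simp)

lemma PEq.refl {X : Type*} [TopologicalSpace X] (x : X) : PEq x x :=
  PEq.of_homeo (Homeomorph.refl X) rfl

lemma PEq.homotopyEquiv {X Y : Type*} [TopologicalSpace X] [TopologicalSpace Y] {x : X} {y : Y}
    (h : PEq x y) : Nonempty (ContinuousMap.HomotopyEquiv X Y) := by
  obtain ⟨f, g, _, _, h3, h4⟩ := h
  exact ⟨⟨f, g, h3.homotopic, h4.homotopic⟩⟩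

section WedgeAPI
variable {X Y T : Type*} [TopologicalSpace X] [TopologicalSpace Y] [TopologicalSpace T]
  {x : X} {y : Y}

/-- left inclusion -/
def winl (x : X) (y : Y) : C(X, Wedge X Y x y) :=
  ⟨fun u => Quot.mk _ (Sum.inl u), continuous_quot_mk.comp continuous_inl⟩

/-- right inclusion -/
def winr (x : X) (y : Y) : C(Y, Wedge X Y x y) :=
  ⟨fun u => Quot.mk _ (Sum.inr u), continuous_quot_mk.comp continuous_inr⟩

lemma wglue (x : X) (y : Y) : winl x y x = winr x y y := Quot.sound ⟨rfl, rfl⟩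

/-- maps out of a wedge -/
def wlift (u : C(X, T)) (v : C(Y, T)) (h : u x = v y) : C(Wedge X Y x y, T) :=
  ⟨Quot.lift (Sum.elim u v) (by rintro _ _ ⟨rfl, rfl⟩; exact h),
    continuous_quot_lift _ (u.continuous.sumElim v.continuous)⟩

@[simp] lemma wlift_inl (u : C(X, T)) (v : C(Y, T)) (h : u x = v y) (a : X) :
    wlift u v h (winl x y a) = u a := rfl
@[simp] lemma wlift_inr (u : C(X, T)) (v : C(Y, T)) (h : u x = v y) (a : Y) :
    wlift u v h (winr x y a) = v a := rfl

lemma wind {P : Wedge X Y x y → Prop} (h1 : ∀ a, P (winl x y a)) (h2 : ∀ a, P (winr x y a)) :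
    ∀ w, P w := by
  rintro ⟨a | a⟩
  · exact h1 a
  · exact h2 a

end WedgeAPI

lemma PEq.wedge {X Y X' Y' : Type*} [TopologicalSpace X] [TopologicalSpace Y]
    [TopologicalSpace X'] [TopologicalSpace Y'] {x : X} {y : Y} {x' : X'} {y' : Y'}
    (h : PEq x x') (h' : PEq y y') : PEq (winl x y x) (winl x' y' x') := by
  obtain ⟨f, g, h1, h2, h3, h4⟩ := h
  obtain ⟨f', g', h1', h2', h3', h4'⟩ := h'
  have e1 : (winl x' y').comp f x = (winr x' y').comp f' y := by simp [h1, h1', wglue]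
  have e2 : (winl x y).comp g x' = (winr x y).comp g' y' := by simp [h2, h2', wglue]
  refine ⟨wlift ((winl x' y').comp f) ((winr x' y').comp f') e1,
    wlift ((winl x y).comp g) ((winr x y).comp g') e2, by simp [h1], by simp [h2], ?_, ?_⟩
  · obtain ⟨H, a, b, c⟩ := homRel_out h3
    obtain ⟨H', a', b', c'⟩ := homRel_out h3'
    refine homRel_of _ _ _ (wlift ⟨fun u => (winl x y).comp (H u), by fun_prop⟩
      ⟨fun u => (winr x y).comp (H' u), by fun_prop⟩ ?_) ?_ ?_ ?_
    · ext t
      simp [c x rfl, c' y rfl, h1, h2, h1', h2', wglue]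
    · refine wind ?_ ?_ <;> intro u <;> simp [a, a']
    · refine wind ?_ ?_ <;> intro u <;> simp [b, b']
    · rintro _ rfl t
      simp [c x rfl]
  · obtain ⟨H, a, b, c⟩ := homRel_out h4
    obtain ⟨H', a', b', c'⟩ := homRel_out h4'
    refine homRel_of _ _ _ (wlift ⟨fun u => (winl x' y').comp (H u), by fun_prop⟩
      ⟨fun u => (winr x' y').comp (H' u), by fun_prop⟩ ?_) ?_ ?_ ?_
    · ext t
      simp [c x' rfl, c' y' rfl, h1, h2, h1', h2', wglue]
    · refine wind ?_ ?_ <;> intro u <;> simp [a, a']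
    · refine wind ?_ ?_ <;> intro u <;> simp [b, b']
    · rintro _ rfl t
      simp [c x' rfl]

lemma PEq.unit_wedge {Y : Type*} [TopologicalSpace Y] (y : Y) :
    PEq (winl () y ()) y := by
  refine PEq.of_inverse (wlift ⟨fun _ => y, by fun_prop⟩ (ContinuousMap.id Y) rfl) (winr () y) rfl ?_ ?_
  · refine wind ?_ ?_
    · rintro ⟨⟩; exact (wglue () y).symm
    · intro u; rfl
  · intro u; rfl

lemma homRel_mono {X Y : Type*} [TopologicalSpace X] [TopologicalSpace Y] {F G : C(X, Y)} {S S' : Set X}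
    (h : F.HomotopicRel G S) (hS : S' ⊆ S) : F.HomotopicRel G S' := by
  obtain ⟨H, a, b, c⟩ := homRel_out h
  exact homRel_of _ _ _ H a b fun x hx t => c x (hS hx) t

section MC
variable {L X T : Type*} [TopologicalSpace L] [TopologicalSpace X] [TopologicalSpace T]

/-- gluing relation of the mapping cone -/
inductive MConeRel (f : C(L, X)) : (X ⊕ ((L × I) ⊕ Unit)) → (X ⊕ ((L × I) ⊕ Unit)) → Prop
  | base (l : L) : MConeRel f (Sum.inl (f l)) (Sum.inr (Sum.inl (l, 0)))
  | tip (l : L) : MConeRel f (Sum.inr (Sum.inl (l, 1))) (Sum.inr (Sum.inr ()))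

/-- unreduced mapping cone -/
def MCone (f : C(L, X)) : Type _ := Quot (MConeRel f)

instance (f : C(L, X)) : TopologicalSpace (MCone f) := by unfold MCone; infer_instance

/-- base inclusion -/
def mi (f : C(L, X)) : C(X, MCone f) :=
  ⟨fun u => Quot.mk _ (Sum.inl u), continuous_quot_mk.comp continuous_inl⟩

/-- cone coordinates -/
def mc (f : C(L, X)) : C(L × I, MCone f) :=
  ⟨fun u => Quot.mk _ (Sum.inr (Sum.inl u)),
    continuous_quot_mk.comp (continuous_inr.comp continuous_inl)⟩

/-- cone tip -/
def mtip (f : C(L, X)) : MCone f := Quot.mk _ (Sum.inr (Sum.inr ()))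

@[simp] lemma mc_zero (f : C(L, X)) (l : L) : mc f (l, 0) = mi f (f l) :=
  (Quot.sound (MConeRel.base l)).symm
@[simp] lemma mc_one (f : C(L, X)) (l : L) : mc f (l, 1) = mtip f :=
  Quot.sound (MConeRel.tip l)

/-- maps out of a mapping cone -/
def mlift (f : C(L, X)) (u : C(X, T)) (w : C(L × I, T)) (p : T) (h0 : ∀ l, w (l, 0) = u (f l))
    (h1 : ∀ l, w (l, 1) = p) : C(MCone f, T) :=
  ⟨Quot.lift (Sum.elim u (Sum.elim w (fun _ => p)))
    (by rintro _ _ (l | l); exacts [(h0 l).symm, h1 l]),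
    continuous_quot_lift _ (u.continuous.sumElim (w.continuous.sumElim continuous_const))⟩

section
variable (f : C(L, X)) (u : C(X, T)) (w : C(L × I, T)) (p : T) (h0 : ∀ l, w (l, 0) = u (f l))
    (h1 : ∀ l, w (l, 1) = p)
@[simp] lemma mlift_mi (a : X) : mlift f u w p h0 h1 (mi f a) = u a := rfl
@[simp] lemma mlift_mc (a : L × I) : mlift f u w p h0 h1 (mc f a) = w a := rfl
@[simp] lemma mlift_mt : mlift f u w p h0 h1 (mtip f) = p := rfl
end

lemma mind {f : C(L, X)} {P : MCone f → Prop} (h1 : ∀ a, P (mi f a)) (h2 : ∀ a, P (mc f a))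
    (h3 : P (mtip f)) : ∀ w, P w := by
  rintro ⟨a | a | a⟩
  · exact h1 a
  · exact h2 a
  · exact h3

/-- The path of `l` through the nullhomotopy and then up the cone. -/
def mE {f g : C(L, X)} (N : Homotopy f g) : C(L × ℝ, MCone f) :=
  ⟨fun q => if q.2 ≤ 0 then mi f (N (Set.projIcc 0 1 zero_le_one (-q.2), q.1))
    else mc f (q.1, Set.projIcc 0 1 zero_le_one q.2), by
    refine Continuous.if_le ?_ ?_ continuous_snd continuous_const ?_
    · have := (continuous_projIcc (a := (0:ℝ)) (b := 1) (h := zero_le_one))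
      fun_prop
    · have := (continuous_projIcc (a := (0:ℝ)) (b := 1) (h := zero_le_one))
      fun_prop
    · rintro ⟨l, q⟩ (rfl : q = 0)
      have : Set.projIcc (0:ℝ) 1 zero_le_one 0 = 0 := Set.projIcc_left _
      simp [this]⟩

lemma mE_neg {f g : C(L, X)} (N : Homotopy f g) (l : L) (q : ℝ) (hq : q ≤ 0) :
    mE N (l, q) = mi f (N (Set.projIcc 0 1 zero_le_one (-q), l)) := by
  simp [mE, hq]

lemma mE_pos {f g : C(L, X)} (N : Homotopy f g) (l : L) (q : ℝ) (hq : 0 ≤ q) :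
    mE N (l, q) = mc f (l, Set.projIcc 0 1 zero_le_one q) := by
  rcases hq.eq_or_lt with rfl | h
  · have : Set.projIcc (0:ℝ) 1 zero_le_one 0 = 0 := Set.projIcc_left _
    simp [mE, this]
  · simp [mE, h]

lemma mE_neg_one {f g : C(L, X)} (N : Homotopy f g) (l : L) :
    mE N (l, -1) = mi f (g l) := by
  rw [mE_neg _ _ _ (by norm_num)]
  have : Set.projIcc (0:ℝ) 1 zero_le_one (- -1) = 1 := by rw [neg_neg]; exact Set.projIcc_right _
  simp [this]

lemma mE_one {f g : C(L, X)} (N : Homotopy f g) (l : L) :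
    mE N (l, 1) = mtip f := by
  rw [mE_pos _ _ _ (by norm_num)]
  have : Set.projIcc (0:ℝ) 1 zero_le_one 1 = 1 := Set.projIcc_right _
  simp [this]

lemma mE_zero {f g : C(L, X)} (N : Homotopy f g) (l : L) :
    mE N (l, 0) = mi f (f l) := by
  rw [mE_pos _ _ _ (by norm_num)]
  have : Set.projIcc (0:ℝ) 1 zero_le_one 0 = 0 := Set.projIcc_left _
  simp [this]

/-- comparison map of mapping cones of homotopic maps -/
def mphi {f g : C(L, X)} (N : Homotopy f g) : C(MCone f, MCone g) :=
  mlift f (mi g) ⟨fun q => mE N.symm (q.1, 2 * (q.2 : ℝ) - 1), by fun_prop⟩ (mtip g)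
    (by intro l; simpa using mE_neg_one N.symm l)
    (by intro l
        have : (2:ℝ) - 1 = 1 := by norm_num
        simpa [this] using mE_one N.symm l)

lemma mphi_mE {f g : C(L, X)} (N : Homotopy f g) (l : L) (q : I) :
    mphi N (mc f (l, q)) = mE N.symm (l, 2 * (q : ℝ) - 1) := rfl

lemma mphi_comp {f g : C(L, X)} (N : Homotopy f g) (l : L) (t : I) :
    mphi N.symm (mphi N (mc f (l, t))) =
      mE N (l, if (t : ℝ) ≤ 1/2 then -(2 * (t:ℝ)) else 4 * t - 3) := by
  rw [mphi_mE]
  obtain ⟨t, h0, h1⟩ := t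
  dsimp only
  by_cases ht : t ≤ 1/2
  · rw [mE_neg _ _ _ (by linarith), if_pos ht, mE_neg _ _ _ (by linarith)]
    change mi f _ = _
    rw [Homotopy.symm_apply]
    congr 3
    rw [Set.projIcc_of_mem (h := zero_le_one) (x := -(2 * t - 1)) ⟨by linarith, by linarith⟩,
      Set.projIcc_of_mem (h := zero_le_one) (x := - -(2 * t)) ⟨by linarith, by linarith⟩]
    ext
    simp
  · rw [mE_pos _ _ _ (by linarith), if_neg ht,
      Set.projIcc_of_mem (h := zero_le_one) (x := (2 * t - 1)) ⟨by linarith, by linarith⟩, mphi_mE,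
      Homotopy.symm_symm]
    congr 2
    ring

lemma mphi_hom {f g : C(L, X)} (N : Homotopy f g) :
    ((mphi N.symm).comp (mphi N)).HomotopicRel (ContinuousMap.id _) (Set.range (mi f)) := by
  have hc : Continuous (fun t : ℝ => if t ≤ 1/2 then -(2 * t) else 4 * t - 3) := by
    refine Continuous.if_le (by fun_prop) (by fun_prop) continuous_id continuous_const ?_
    rintro t rfl; norm_num
  set π : C(ℝ, ℝ) := ⟨_, hc⟩ with hπ
  have π0 : π 0 = 0 := by simp [hπ]
  have π1 : π 1 = 1 := by simp [hπ]; norm_num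
  let W : C((L × I) × I, MCone f) :=
    ⟨fun q => mE N (q.1.1, (1 - (q.2:ℝ)) * π q.1.2 + q.2 * q.1.2), by fun_prop⟩
  refine homRel_of _ _ _ (mlift f ⟨fun u => ContinuousMap.const I (mi f u), by fun_prop⟩ W.curry
    (ContinuousMap.const I (mtip f)) ?_ ?_) ?_ ?_ ?_
  · intro l; ext t; simp [W, π0, mE_zero]
  · intro l; ext t; simp [W, π1, mE_one]
  · refine mind ?_ ?_ ?_
    · intro u; rfl
    · rintro ⟨l, t⟩
      simp only [mlift_mc, curry_apply, ContinuousMap.comp_apply, mphi_comp]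
      simp [W, hπ]
    · rfl
  · refine mind ?_ ?_ ?_
    · intro u; rfl
    · rintro ⟨l, t⟩
      simp only [mlift_mc, curry_apply, ContinuousMap.id_apply]
      simp only [W, coe_mk, Set.Icc.coe_one, sub_self, zero_mul, one_mul, zero_add]
      rw [mE_pos _ _ _ t.2.1]
      simp
    · rfl
  · rintro _ ⟨u, rfl⟩ t; rfl

lemma PEq.mcone {f g : C(L, X)} (h : f.Homotopic g) (x : X) : PEq (mi f x) (mi g x) := by
  obtain ⟨N⟩ := h
  refine ⟨mphi N, mphi N.symm, rfl, rfl, ?_, ?_⟩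
  · exact homRel_mono (mphi_hom N) (by rintro _ rfl; exact ⟨x, rfl⟩)
  · have := mphi_hom N.symm
    rw [Homotopy.symm_symm] at this
    exact homRel_mono this (by rintro _ rfl; exact ⟨x, rfl⟩)

/-- suspension as mapping cone of a constant map -/
abbrev SL (L : Type*) [TopologicalSpace L] := MCone (ContinuousMap.const L ())

lemma PEq.mcone_const (e : X) : PEq (mi (ContinuousMap.const L e) e)
    (winl e (mi (ContinuousMap.const L ()) ()) e) := by
  refine PEq.of_inverse
    (mlift _ (winl e _) ((winr e _).comp (mc _)) (winr e _ (mtip _)) ?_ ?_)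
    (wlift (mi _) (mlift _ (ContinuousMap.const _ (mi _ e)) (mc _) (mtip _) ?_ ?_) ?_) ?_ ?_ ?_
  · intro l; simp [wglue]
  · intro l; simp
  · intro l; simp
  · intro l; simp
  · rfl
  · rfl
  · refine mind ?_ ?_ ?_
    · intro a; rfl
    · intro a; rfl
    · rfl
  · refine wind ?_ (mind ?_ ?_ ?_)
    · intro a; rfl
    · rintro ⟨⟩; exact wglue _ _
    · intro a; rfl
    · rfl
end MC


section CxSec
variable {A : Type*} [Fintype A]

/-- Geometric realization of the independence complex of `H` on the vertices in `S`. -/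
def Cx (H : SimpleGraph A) (S : Set A) : Set (A → ℝ) :=
  {z | (∀ a, 0 ≤ z a) ∧ ∑ a, z a = 1 ∧ (∀ a, a ∉ S → z a = 0) ∧
    ∀ a b, H.Adj a b → z a * z b = 0}

variable {H : SimpleGraph A} {S : Set A}

lemma Cx_le_one {z : A → ℝ} (hz : z ∈ Cx H S) (a : A) : z a ≤ 1 := by
  rw [← hz.2.1]
  exact Finset.single_le_sum (f := z) (fun b _ => hz.1 b) (Finset.mem_univ a)

lemma Cx_mono {S' : Set A} (h : S ⊆ S') : Cx H S ⊆ Cx H S' := fun _ hz =>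
  ⟨hz.1, hz.2.1, fun a ha => hz.2.2.1 a (fun h' => ha (h h')), hz.2.2.2⟩

instance : CompactSpace (Cx H S) := by
  rw [← isCompact_iff_compactSpace]
  have hb : Cx H S ⊆ Set.pi Set.univ (fun _ : A => Set.Icc (0:ℝ) 1) :=
    fun z hz a _ => ⟨hz.1 a, Cx_le_one hz a⟩
  refine (isCompact_univ_pi (fun _ => isCompact_Icc)).of_isClosed_subset ?_ hb
  unfold Cx
  simp only [Set.ofPred_and, Set.ofPred_forall]
  refine IsClosed.inter ?_ (IsClosed.inter ?_ (IsClosed.inter ?_ ?_))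
  · exact isClosed_iInter fun a => isClosed_le continuous_const (continuous_apply a)
  · exact isClosed_eq (by fun_prop) continuous_const
  · exact isClosed_iInter fun a => isClosed_iInter fun _ => isClosed_eq (by fun_prop) continuous_const
  · exact isClosed_iInter fun a => isClosed_iInter fun b => isClosed_iInter fun _ =>
      isClosed_eq (by fun_prop) continuous_const

/-- straight segments between compatible points stay in the complex -/
lemma Cx_segment {x y : A → ℝ} (hx : x ∈ Cx H S) (hy : y ∈ Cx H S)
    (hxy : ∀ a b, H.Adj a b → x a * y b = 0) {t : ℝ} (h0 : 0 ≤ t) (h1 : t ≤ 1) :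
    (fun a => (1 - t) * x a + t * y a) ∈ Cx H S := by
  refine ⟨fun a => ?_, ?_, fun a ha => ?_, fun a b hab => ?_⟩
  · have := hx.1 a; have := hy.1 a
    have : 0 ≤ 1 - t := by linarith
    positivity
  · rw [Finset.sum_add_distrib, ← Finset.mul_sum, ← Finset.mul_sum, hx.2.1, hy.2.1]; ring
  · simp [hx.2.2.1 a ha, hy.2.2.1 a ha]
  · have e1 := hx.2.2.2 a b hab
    have e2 := hy.2.2.2 a b hab
    have e3 := hxy a b hab
    have e4 := hxy b a hab.symm
    linear_combination (1 - t) ^ 2 * e1 + t ^ 2 * e2 + t * (1 - t) * e3 + t * (1 - t) * e4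

lemma Cx_coord {X : Type*} [TopologicalSpace X] (F : C(X, Cx H S)) (a : A) :
    Continuous fun x => (F x).1 a :=
  (continuous_apply a).comp (continuous_subtype_val.comp F.continuous)

/-- contiguous maps are homotopic -/
lemma Cx_homotopic {X : Type*} [TopologicalSpace X] (F G : C(X, Cx H S))
    (h : ∀ x a b, H.Adj a b → (F x).1 a * (G x).1 b = 0) :
    F.HomotopicRel G {x | F x = G x} := by
  let W : C(X × I, Cx H S) := ⟨fun p => ⟨fun a => (1 - (p.2 : ℝ)) * (F p.1).1 a + p.2 * (G p.1).1 a,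
    Cx_segment (F p.1).2 (G p.1).2 (h p.1) p.2.2.1 p.2.2.2⟩, by
      refine Continuous.subtype_mk (continuous_pi fun a => ?_) _
      have h1 := (Cx_coord F a).comp (continuous_fst (X := X) (Y := I))
      have h2 := (Cx_coord G a).comp (continuous_fst (X := X) (Y := I))
      have h3 := continuous_subtype_val.comp (continuous_snd (X := X) (Y := I))
      exact ((continuous_const.sub h3).mul h1).add (h3.mul h2)⟩
  refine homRel_of _ _ _ W.curry ?_ ?_ ?_
  · intro x; ext a; simp [W]
  · intro x; ext a; simp [W]
  · intro x (hx : F x = G x) t; ext a; simp [W, hx]; ring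

open Classical in
/-- vertex -/
def vx (H : SimpleGraph A) {S : Set A} {e : A} (he : e ∈ S) : Cx H S :=
  ⟨Pi.single e 1, fun a => by
      by_cases h : a = e
      · subst h; simp
      · simp [h], by simp, fun a ha => by
      rw [Pi.single_eq_of_ne]; rintro rfl; exact ha he, fun a b hab => by
      by_cases h : a = e
      · subst h; simp [hab.ne']
      · simp [h]⟩

@[simp] lemma vx_self {e : A} (he : e ∈ S) : (vx H he).1 e = 1 := by simp [vx]
lemma vx_ne {e : A} (he : e ∈ S) {a : A} (h : a ≠ e) : (vx H he).1 a = 0 := by simp [vx, h]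

/-- A cone is pointed-contractible at every vertex. -/
lemma cone_contractible {c e : A} (hc : c ∈ S) (he : e ∈ S) (h : ∀ s ∈ S, ¬ H.Adj c s) :
    PEq (vx H he) () := by
  refine ⟨⟨fun _ => (), by fun_prop⟩, ⟨fun _ => vx H he, by fun_prop⟩, rfl, rfl, ?_,
    by exact HomotopicRel.refl _⟩
  refine HomotopicRel.symm ?_
  have hce : ¬ H.Adj c e := h e he
  by_cases hec : c = e
  · subst hec
    refine homRel_mono (Cx_homotopic _ _ ?_) ?_
    · intro x a b hab
      by_cases hb : b = c
      · subst hb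
        have : a ∉ S := fun ha => h a ha hab.symm
        simp [x.2.2.2.1 a this]
      · simp [vx_ne he hb]
    · rintro _ rfl; simp
  have hm : ∀ z : Cx H S, (fun a => (1 - z.1 e) * (vx H hc).1 a + z.1 e * (vx H he).1 a) ∈ Cx H S := by
    intro z
    refine Cx_segment (vx H hc).2 (vx H he).2 ?_ (z.2.1 e) (Cx_le_one z.2 e)
    intro a b hab
    by_cases ha : a = c
    · by_cases hb : b = e
      · subst ha hb; exact absurd hab hce
      · simp [vx_ne he hb]
    · simp [vx_ne hc ha]
  let M : C(Cx H S, Cx H S) := ⟨fun z => ⟨_, hm z⟩, by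
      refine Continuous.subtype_mk (continuous_pi fun a => ?_) _
      have h1 := Cx_coord (ContinuousMap.id (Cx H S)) e
      exact ((continuous_const.sub h1).mul continuous_const).add (h1.mul continuous_const)⟩
  have hMe : M (vx H he) = vx H he := by ext a; simp [M]
  refine HomotopicRel.trans (g := M) ?_ ?_
  · refine homRel_mono (Cx_homotopic _ _ ?_) ?_
    · intro x a b hab
      simp only [ContinuousMap.id_apply, M, coe_mk]
      by_cases hb : b = c
      · subst hb
        have : a ∉ S := fun ha => h a ha hab.symm
        simp [x.2.2.2.1 a this]
      · by_cases hb' : b = e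
        · subst hb'
          have := x.2.2.2.2 a b hab
          simp only [vx_ne hc hb, vx_self]
          linear_combination this
        · simp [vx_ne hc hb, vx_ne he hb']
    · rintro _ rfl; simp [hMe]
  · refine homRel_mono (Cx_homotopic _ _ ?_) ?_
    · intro x a b hab
      simp only [ContinuousMap.comp_apply, M, coe_mk]
      by_cases hb : b = e
      · subst hb
        by_cases ha : a = c
        · subst ha; exact absurd hab hce
        · simp [vx_ne hc ha, vx_ne he hab.ne]
      · simp [vx_ne he hb]
    · rintro _ rfl; simp [hMe]

/-- link of `b` -/
def lk (H : SimpleGraph A) (S : Set A) (b : A) : Set A := {s | s ∈ S ∧ s ≠ b ∧ ¬ H.Adj b s}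

lemma lk_sub (b : A) : lk H S b ⊆ S \ {b} := fun _ hs => ⟨hs.1, hs.2.1⟩

/-- inclusion of the link in the deletion -/
def lkIncl (H : SimpleGraph A) (S : Set A) (b : A) : C(Cx H (lk H S b), Cx H (S \ {b})) :=
  ⟨Set.inclusion (Cx_mono (lk_sub b)), continuous_inclusion _⟩

lemma lk_adj {b : A} (z : Cx H (lk H S b)) {s : A} (h : H.Adj b s) : z.1 s = 0 :=
  z.2.2.2.1 s (fun hs => hs.2.2 h)

lemma lk_b {b : A} (z : Cx H (lk H S b)) : z.1 b = 0 :=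
  z.2.2.2.1 b (fun hs => hs.2.1 rfl)

lemma coneMap_mem {b : A} (hb : b ∈ S) (z : Cx H (lk H S b)) (t : I) :
    (fun a => (1 - (t:ℝ)) * z.1 a + t * (vx H hb).1 a) ∈ Cx H S := by
  refine Cx_segment (Cx_mono (fun _ h => h.1) z.2) (vx H hb).2 ?_ t.2.1 t.2.2
  intro a c hac
  by_cases hc : c = b
  · subst hc; simp [lk_adj z hac.symm]
  · simp [vx_ne hb hc]

/-- comparison map from the mapping cone of the link inclusion -/
def coneMap {b : A} (hb : b ∈ S) : C(MCone (lkIncl H S b), Cx H S) :=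
  mlift _ ⟨Set.inclusion (Cx_mono Set.sdiff_subset), continuous_inclusion _⟩
    ⟨fun p => ⟨_, coneMap_mem hb p.1 p.2⟩, by
      refine Continuous.subtype_mk (continuous_pi fun a => ?_) _
      have h1 := (Cx_coord (ContinuousMap.id (Cx H (lk H S b))) a).comp
        (continuous_fst (X := Cx H (lk H S b)) (Y := I))
      have h3 := continuous_subtype_val.comp (continuous_snd (X := Cx H (lk H S b)) (Y := I))
      exact ((continuous_const.sub h3).mul h1).add (h3.mul continuous_const)⟩ (vx H hb)
    (by intro l; ext a; simp [lkIncl])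
    (by intro l; ext a; simp)

lemma coneMap_mi {b : A} (hb : b ∈ S) (x : Cx H (S \ {b})) (a : A) :
  (coneMap hb (mi _ x)).1 a = x.1 a := rfl
lemma coneMap_mc {b : A} (hb : b ∈ S) (l : Cx H (lk H S b)) (t : I) (a : A) :
  (coneMap hb (mc _ (l, t))).1 a = (1 - (t:ℝ)) * l.1 a + t * (vx H hb).1 a := rfl
lemma coneMap_mtip {b : A} (hb : b ∈ S) :
  (coneMap hb (mtip _)) = vx H hb := rfl

lemma del_b {b : A} (x : Cx H (S \ {b})) : x.1 b = 0 := x.2.2.2.1 b (by simp)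

lemma coneMap_mi_mc {b : A} (hb : b ∈ S) (x : Cx H (S \ {b})) (l : Cx H (lk H S b)) (t : I)
    (h : coneMap hb (mi _ x) = coneMap hb (mc _ (l, t))) : mi (lkIncl H S b) x = mc _ (l, t) := by
  have hb' := congrArg (fun z => z.1 b) h
  simp only [coneMap_mi, coneMap_mc, del_b, lk_b, vx_self] at hb'
  have ht : t = 0 := by apply Subtype.ext; change (t:ℝ) = 0; linarith
  subst ht
  rw [mc_zero]
  congr 1
  ext a
  have := congrArg (fun z => z.1 a) h
  simpa [coneMap_mi, coneMap_mc] using this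

lemma coneMap_mi_mtip {b : A} (hb : b ∈ S) (x : Cx H (S \ {b}))
    (h : coneMap hb (mi _ x) = coneMap hb (mtip _)) : False := by
  have hb' := congrArg (fun z => z.1 b) h
  simp [coneMap_mi, coneMap_mtip, del_b] at hb'

lemma coneMap_mc_mtip {b : A} (hb : b ∈ S) (l : Cx H (lk H S b)) (t : I)
    (h : coneMap hb (mc _ (l, t)) = coneMap hb (mtip _)) : mc (lkIncl H S b) (l, t) = mtip _ := by
  have hb' := congrArg (fun z => z.1 b) h
  simp [coneMap_mc, coneMap_mtip, lk_b] at hb'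
  subst hb'
  simp

lemma coneMap_mc_mc {b : A} (hb : b ∈ S) (l l' : Cx H (lk H S b)) (t t' : I)
    (h : coneMap hb (mc _ (l, t)) = coneMap hb (mc _ (l', t'))) :
    mc (lkIncl H S b) (l, t) = mc _ (l', t') := by
  have hb' := congrArg (fun z => z.1 b) h
  simp only [coneMap_mc, lk_b, vx_self] at hb'
  have ht : t = t' := by ext; linarith
  subst ht
  by_cases h1 : t = 1
  · subst h1; simp
  · have : l = l' := by
      ext a
      have ha := congrArg (fun z => z.1 a) h
      simp only [coneMap_mc, add_left_inj] at ha
      refine mul_left_cancel₀ ?_ ha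
      intro h0
      apply h1; apply Subtype.ext; change (t:ℝ) = 1; linarith
    rw [this]

lemma coneMap_inj {b : A} (hb : b ∈ S) : Function.Injective (coneMap (H := H) hb) := by
  refine mind ?_ ?_ ?_
  · intro x
    refine mind ?_ ?_ ?_
    · intro y h
      congr 1
      ext a
      exact congrArg (fun z => z.1 a) h
    · rintro ⟨l, t⟩ h; exact coneMap_mi_mc hb x l t h
    · intro h; exact (coneMap_mi_mtip hb x h).elim
  · rintro ⟨l, t⟩
    refine mind ?_ ?_ ?_
    · intro y h; exact (coneMap_mi_mc hb y l t h.symm).symm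
    · rintro ⟨l', t'⟩ h; exact coneMap_mc_mc hb l l' t t' h
    · intro h; exact coneMap_mc_mtip hb l t h
  · refine mind ?_ ?_ ?_
    · intro y h; exact (coneMap_mi_mtip hb y h.symm).elim
    · rintro ⟨l', t'⟩ h; exact (coneMap_mc_mtip hb l' t' h.symm).symm
    · intro h; rfl

lemma coneMap_surj {b : A} (hb : b ∈ S) : Function.Surjective (coneMap (H := H) hb) := by
  classical
  intro z
  have hz0 := z.2.1 b
  have hz1 := Cx_le_one z.2 b
  by_cases h0 : z.1 b = 0
  · refine ⟨mi _ ⟨z.1, z.2.1, z.2.2.1, fun a ha => ?_, z.2.2.2.2⟩, rfl⟩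
    by_cases hab : a = b
    · rw [hab, h0]
    · exact z.2.2.2.1 a (fun h => ha ⟨h, hab⟩)
  by_cases h1 : z.1 b = 1
  · refine ⟨mtip _, ?_⟩
    rw [coneMap_mtip]
    ext a
    by_cases hab : a = b
    · subst hab; simp [h1]
    · rw [vx_ne hb hab]
      have := z.2.2.1
      rw [Fintype.sum_eq_add_sum_compl b, h1] at this
      have h' : ∑ i ∈ {b}ᶜ, z.1 i = 0 := by linarith
      rw [Finset.sum_eq_zero_iff_of_nonneg (fun i _ => z.2.1 i)] at h'
      exact (h' a (by simp [hab])).symm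
  have hpos : 0 < 1 - z.1 b := lt_of_le_of_ne (by linarith) (fun h => h1 (by linarith))
  have hl : (fun a => if a = b then 0 else z.1 a / (1 - z.1 b)) ∈ Cx H (lk H S b) := by
    refine ⟨fun a => ?_, ?_, fun a ha => ?_, fun a c hac => ?_⟩
    · dsimp only
      split_ifs
      · exact le_rfl
      · exact div_nonneg (z.2.1 a) hpos.le
    · rw [Fintype.sum_eq_add_sum_compl b]
      have := z.2.2.1
      rw [Fintype.sum_eq_add_sum_compl b] at this
      have h' : ∑ i ∈ {b}ᶜ, (if i = b then 0 else z.1 i / (1 - z.1 b)) =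
          (∑ i ∈ {b}ᶜ, z.1 i) / (1 - z.1 b) := by
        rw [Finset.sum_div]
        refine Finset.sum_congr rfl fun i hi => ?_
        rw [if_neg (by simpa using hi)]
      rw [h', if_pos rfl, zero_add, div_eq_one_iff_eq hpos.ne']
      linarith
    · dsimp only
      split_ifs with hab
      · rfl
      · have : z.1 a = 0 := by
          by_cases haS : a ∈ S
          · have hadj : H.Adj b a := by
              by_contra hn
              exact ha ⟨haS, hab, hn⟩
            have := z.2.2.2.2 b a hadj
            exact (mul_eq_zero.mp this).resolve_left h0
          · exact z.2.2.2.1 a haS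
        rw [this, zero_div]
    · have := z.2.2.2.2 a c hac
      dsimp only
      split_ifs
      · simp
      · simp
      · simp
      · rw [div_mul_div_comm, this, zero_div]
  refine ⟨mc _ (⟨_, hl⟩, ⟨z.1 b, hz0, hz1⟩), ?_⟩
  ext a
  rw [coneMap_mc]
  dsimp only
  by_cases hab : a = b
  · subst hab; simp
  · rw [if_neg hab, vx_ne hb hab]
    field_simp
    ring

instance {L X : Type*} [TopologicalSpace L] [TopologicalSpace X] [CompactSpace L] [CompactSpace X]
    (f : C(L, X)) : CompactSpace (MCone f) := by
  unfold MCone; infer_instance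

lemma PEq.cx_mcone {b e : A} (hb : b ∈ S) (he : e ∈ S) (heb : e ∈ S \ {b}) :
    PEq (vx H he) (mi (lkIncl H S b) (vx H heb)) := by
  refine PEq.symm (PEq.of_homeo (Continuous.homeoOfEquivCompactToT2
    (f := Equiv.ofBijective (coneMap (H := H) hb) ⟨coneMap_inj hb, coneMap_surj hb⟩)
    (coneMap hb).continuous) ?_)
  rfl

/-- basepoint of the suspension -/
abbrev sbase (L : Type*) [TopologicalSpace L] : SL L := mi (ContinuousMap.const L ()) ()

lemma PEq.cx_wedge {a b e : A} (hb : b ∈ S) (he : e ∈ S) (heb : e ∈ S \ {b})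
    (hab : a ∈ S \ {b}) (hdom : ∀ s ∈ S, s ≠ b → H.Adj a s → H.Adj b s) (hae : ¬ H.Adj a e) :
    PEq (vx H he) (winl (vx H heb) (sbase (Cx H (lk H S b))) (vx H heb)) := by
  refine (PEq.cx_mcone hb he heb).trans (PEq.trans (PEq.mcone ?_ _) (PEq.mcone_const _))
  refine Homotopic.trans (g := ContinuousMap.const _ (vx H hab)) ?_ ?_
  · refine (Cx_homotopic _ _ ?_).homotopic
    intro x c d hcd
    by_cases hd : d = a
    · subst hd
      have : (lkIncl H S b x).1 c = x.1 c := rfl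
      rw [this]
      by_cases hcb : c = b
      · subst hcb; simp [lk_b]
      by_cases hcS : c ∈ S
      · simp [lk_adj x (hdom c hcS hcb hcd.symm)]
      · rw [x.2.2.2.1 c (fun h => hcS h.1), zero_mul]
    · simp [vx_ne hab hd]
  · refine (Cx_homotopic _ _ ?_).homotopic
    intro x c d hcd
    simp only [ContinuousMap.const_apply]
    by_cases hd : d = e
    · by_cases hc : c = a
      · subst hd hc; exact absurd hcd hae
      · simp [vx_ne hab hc]
    · simp [vx_ne heb hd]

end CxSec


section PWSec
/-- Pointed wedge of spheres (a point for the empty family). -/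
def PW {ι : Type} (n : ι → ℕ) : Type :=
  Quot (fun (a b : Unit ⊕ (Σ i, nSphere (n i))) =>
    a = Sum.inl () ∧ ∃ i, b = Sum.inr ⟨i, spherePt (n i)⟩)

instance {ι : Type} (n : ι → ℕ) : TopologicalSpace (PW n) := by
  unfold PW; infer_instance

/-- basepoint -/
def pwb {ι : Type} (n : ι → ℕ) : PW n := Quot.mk _ (Sum.inl ())

/-- inclusion of a sphere -/
def pwi {ι : Type} (n : ι → ℕ) (i : ι) : C(nSphere (n i), PW n) :=
  ⟨fun u => Quot.mk _ (Sum.inr ⟨i, u⟩),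
    continuous_quot_mk.comp (continuous_inr.comp continuous_sigmaMk)⟩

lemma pwglue {ι : Type} (n : ι → ℕ) (i : ι) : pwi n i (spherePt (n i)) = pwb n :=
  (Quot.sound ⟨rfl, i, rfl⟩).symm

/-- maps out of a pointed wedge -/
def pwlift {ι : Type} {n : ι → ℕ} {T : Type*} [TopologicalSpace T] (t : T)
    (f : ∀ i, C(nSphere (n i), T)) (h : ∀ i, f i (spherePt (n i)) = t) : C(PW n, T) :=
  ⟨Quot.lift (Sum.elim (fun _ => t) (fun p => f p.1 p.2))
    (by rintro _ _ ⟨rfl, i, rfl⟩; exact (h i).symm),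
    continuous_quot_lift _ (continuous_const.sumElim
      (continuous_sigma fun i => (f i).continuous))⟩

@[simp] lemma pwlift_b {ι : Type} {n : ι → ℕ} {T : Type*} [TopologicalSpace T] (t : T)
    (f : ∀ i, C(nSphere (n i), T)) (h : ∀ i, f i (spherePt (n i)) = t) :
    pwlift t f h (pwb n) = t := rfl
@[simp] lemma pwlift_i {ι : Type} {n : ι → ℕ} {T : Type*} [TopologicalSpace T] (t : T)
    (f : ∀ i, C(nSphere (n i), T)) (h : ∀ i, f i (spherePt (n i)) = t) (i : ι)
    (u : nSphere (n i)) :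
    pwlift t f h (pwi n i u) = f i u := rfl

lemma pwind {ι : Type} {n : ι → ℕ} {P : PW n → Prop} (h0 : P (pwb n))
    (h : ∀ i u, P (pwi n i u)) : ∀ w, P w := by
  rintro ⟨⟨⟩ | ⟨i, u⟩⟩
  · exact h0
  · exact h i u

lemma PEq.pw_sum {ι κ : Type} (n : ι → ℕ) (m : κ → ℕ) :
    PEq (winl (pwb n) (pwb m) (pwb n)) (pwb (Sum.elim n m)) := by
  refine PEq.of_inverse
    (wlift (pwlift (pwb (Sum.elim n m)) (fun i => pwi (Sum.elim n m) (Sum.inl i))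
        (fun i => pwglue (Sum.elim n m) (Sum.inl i)))
      (pwlift (pwb (Sum.elim n m)) (fun i => pwi (Sum.elim n m) (Sum.inr i))
        (fun i => pwglue (Sum.elim n m) (Sum.inr i))) rfl)
    (pwlift (winl (pwb n) (pwb m) (pwb n))
      (Sum.rec (fun i => (winl (pwb n) (pwb m)).comp (pwi n i))
        (fun i => (winr (pwb n) (pwb m)).comp (pwi m i))) ?_) rfl ?_ ?_
  · rintro (i | i)
    · exact congrArg (winl (pwb n) (pwb m)) (pwglue n i)
    · exact (congrArg (winr (pwb n) (pwb m)) (pwglue m i)).trans (wglue _ _).symm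
  · refine wind (pwind rfl fun _ _ => rfl) (pwind ?_ fun _ _ => rfl)
    exact wglue _ _
  · refine pwind rfl ?_
    rintro (i | i) u <;> rfl

lemma PEq.pw_unit (d : ℕ) : PEq (spherePt d) (pwb (fun _ : Unit => d)) :=
  PEq.of_inverse (pwi (fun _ : Unit => d) ())
    (pwlift (n := fun _ : Unit => d) (spherePt d) (fun _ => ContinuousMap.id _) (fun _ => rfl))
    (pwglue (fun _ : Unit => d) ()) (fun _ => rfl)
    (pwind (pwglue (fun _ : Unit => d) ()) (fun _ _ => rfl))

lemma PEq.pw_empty {ι : Type} [IsEmpty ι] (n : ι → ℕ) : PEq () (pwb n) :=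
  PEq.of_inverse ⟨fun _ => pwb n, continuous_const⟩
    ⟨fun _ => (), continuous_const⟩ rfl (fun _ => rfl) (pwind rfl (fun i => isEmptyElim i))

/-- inclusion into the frozen wedge -/
def wsi {ι : Type} (n : ι → ℕ) (i : ι) : C(nSphere (n i), WedgeOfSpheres n) :=
  ⟨fun u => Quot.mk _ ⟨i, u⟩, continuous_quot_mk.comp continuous_sigmaMk⟩

/-- maps out of the frozen wedge -/
def wslift {ι : Type} {n : ι → ℕ} {T : Type*} [TopologicalSpace T] (t : T)
    (f : ∀ i, C(nSphere (n i), T)) (h : ∀ i, f i (spherePt (n i)) = t) : C(WedgeOfSpheres n, T) :=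
  ⟨Quot.lift (fun p => f p.1 p.2)
    (by rintro _ _ ⟨i, j, rfl, rfl⟩; exact (h i).trans (h j).symm),
    continuous_quot_lift _ (continuous_sigma fun i => (f i).continuous)⟩

lemma PEq.pw_ws {ι κ : Type} (n : ι → ℕ) (e : κ ≃ ι) (k : κ) :
    PEq (pwb n) (wsi (n ∘ e) k (spherePt _)) := by
  have hg : ∀ j, wsi (n ∘ e) j (spherePt _) = wsi (n ∘ e) k (spherePt _) :=
    fun j => Quot.sound ⟨j, k, rfl, rfl⟩
  have key : ∃ f : ∀ i, C(nSphere (n i), WedgeOfSpheres (n ∘ e)), ∀ j, f (e j) = wsi (n ∘ e) j := by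
    refine ⟨fun i => e.apply_symm_apply i ▸ wsi (n ∘ e) (e.symm i), ?_⟩
    intro j
    have : ∀ i (h : e i = e j), (h ▸ wsi (n ∘ e) i : C(nSphere (n (e j)), WedgeOfSpheres (n ∘ e)))
        = wsi (n ∘ e) j := by
      intro i h
      obtain rfl := e.injective h
      rfl
    exact this _ _
  obtain ⟨f, hf⟩ := key
  have hf0 : ∀ i, f i (spherePt _) = wsi (n ∘ e) k (spherePt _) := by
    intro i
    obtain ⟨j, rfl⟩ := e.surjective i
    rw [hf]; exact hg j
  refine PEq.of_inverse (pwlift _ f hf0)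
    (wslift (pwb n) (fun j => pwi n (e j)) (fun j => pwglue n (e j))) rfl ?_ ?_
  · refine pwind ?_ ?_
    · exact pwglue n (e k)
    · intro i u
      obtain ⟨j, rfl⟩ := e.surjective i
      rw [pwlift_i, hf]; rfl
  · rintro ⟨j, u⟩
    exact DFunLike.congr_fun (hf j) u

/-- pointed homotopy equivalent to a finite pointed wedge of spheres -/
def Good {X : Type*} [TopologicalSpace X] (x : X) : Prop :=
  ∃ (ι : Type) (_ : Finite ι) (n : ι → ℕ), PEq x (pwb n)

lemma Good.of_unit {X : Type*} [TopologicalSpace X] {x : X} (h : PEq x ()) : Good x :=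
  ⟨Empty, inferInstance, fun _ => 0, h.trans (PEq.pw_empty _)⟩

lemma Good.of_sphere {X : Type*} [TopologicalSpace X] {x : X} {d : ℕ} (h : PEq x (spherePt d)) :
    Good x :=
  ⟨Unit, inferInstance, fun _ => d, h.trans (PEq.pw_unit _)⟩

lemma Good.congr {X Y : Type*} [TopologicalSpace X] [TopologicalSpace Y] {x : X} {y : Y}
    (h : PEq x y) (hy : Good y) : Good x := by
  obtain ⟨ι, hι, n, hn⟩ := hy
  exact ⟨ι, hι, n, h.trans hn⟩

lemma Good.wedge {X Y : Type*} [TopologicalSpace X] [TopologicalSpace Y] {x : X} {y : Y}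
    (hx : Good x) (hy : Good y) : Good (winl x y x) := by
  obtain ⟨ι, hι, n, hn⟩ := hx
  obtain ⟨κ, hκ, m, hm⟩ := hy
  exact ⟨ι ⊕ κ, inferInstance, Sum.elim n m, (hn.wedge hm).trans (PEq.pw_sum n m)⟩

lemma Good.final {X : Type*} [TopologicalSpace X] {x : X} (hx : Good x) :
    ContractibleSpace X ∨ IsWedgeOfSpheres X := by
  obtain ⟨ι, hι, n, hn⟩ := hx
  rcases isEmpty_or_nonempty ι with h | ⟨⟨i⟩⟩
  · left
    obtain ⟨f⟩ := (hn.trans (PEq.pw_empty n).symm).homotopyEquiv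
    exact ⟨⟨f⟩⟩
  · right
    obtain ⟨k, ⟨e⟩⟩ := Finite.exists_equiv_fin ι
    exact ⟨k, n ∘ e.symm, (hn.trans (PEq.pw_ws n e.symm (e i))).homotopyEquiv⟩
end PWSec

section StepSec
variable {A : Type*} [Fintype A] {H : SimpleGraph A} {S : Set A}

lemma Good.step {a b e : A} (hb : b ∈ S) (he : e ∈ S) (heb : e ∈ S \ {b})
    (hab : a ∈ S \ {b}) (hadj : H.Adj a b)
    (hdom : ∀ s ∈ S, s ≠ b → H.Adj a s → H.Adj b s) (hae : ¬ H.Adj a e)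
    (h1 : Good (vx H heb)) {S' : Set A} (hS' : ∀ s, s ∈ S' ↔ s = a ∨ s = b ∨ s ∈ lk H S b)
    (ha' : a ∈ S') (h2 : Good (vx H ha')) : Good (vx H he) := by
  refine Good.congr (PEq.cx_wedge hb he heb hab hdom hae) ?_
  refine h1.wedge ?_
  have hlk : lk H S' b = lk H S b := by
    ext s
    simp only [lk, Set.mem_ofPred_eq, hS']
    constructor
    · rintro ⟨rfl | rfl | h, h1, h2⟩
      · exact absurd hadj.symm h2
      · exact absurd rfl h1
      · exact h
    · rintro ⟨h1, h2, h3⟩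
      exact ⟨Or.inr (Or.inr ⟨h1, h2, h3⟩), h2, h3⟩
  have hne : a ≠ b := hadj.ne
  have hb' : b ∈ S' := (hS' b).2 (Or.inr (Or.inl rfl))
  have hab' : a ∈ S' \ {b} := ⟨ha', hne⟩
  have hd' : ∀ s ∈ S', s ≠ b → H.Adj a s → H.Adj b s := by
    intro s hs hsb has
    rcases (hS' s).1 hs with rfl | rfl | h
    · exact absurd has (H.loopless.irrefl _)
    · exact absurd rfl hsb
    · exact hdom s h.1 hsb has
  have h3 := PEq.cx_wedge hb' ha' hab' hab' hd' (H.loopless.irrefl a)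
  have h4 : PEq (vx H hab') () := by
    refine cone_contractible hab' hab' ?_
    rintro s ⟨hs, hsb⟩ has
    rcases (hS' s).1 hs with rfl | rfl | h
    · exact absurd has (H.loopless.irrefl _)
    · exact absurd rfl hsb
    · exact h.2.2 (hdom s h.1 hsb has)
  have h5 : PEq (vx H ha') (sbase (Cx H (lk H S' b))) :=
    (h3.trans (h4.wedge (PEq.refl _))).trans (PEq.unit_wedge _)
  rw [hlk] at h5
  exact Good.congr h5.symm h2
end StepSec


section Cross
variable {A : Type*} [Fintype A] {H : SimpleGraph A} {S : Set A}

lemma cross_inj {d : ℕ} {p : Fin (d+1) → Bool → A}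
    (hp : ∀ i β j γ, H.Adj (p i β) (p j γ) ↔ i = j ∧ β ≠ γ) :
    Function.Injective (Function.uncurry p) := by
  rintro ⟨i, β⟩ ⟨j, γ⟩ h
  simp only [Function.uncurry] at h
  have h1 : H.Adj (p i β) (p i (!β)) := (hp _ _ _ _).2 ⟨rfl, by simp⟩
  rw [h, hp] at h1
  obtain ⟨rfl, h2⟩ := h1
  simp only [Prod.mk.injEq, true_and]
  clear h
  cases β <;> cases γ <;> simp_all

/-- difference coordinates -/
def crossw {d : ℕ} (p : Fin (d+1) → Bool → A) (z : A → ℝ) : EuclideanSpace ℝ (Fin (d+1)) :=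
  WithLp.toLp 2 (fun i => z (p i true) - z (p i false))

lemma crossw_apply {d : ℕ} (p : Fin (d+1) → Bool → A) (z : A → ℝ) (i : Fin (d+1)) :
    crossw p z i = z (p i true) - z (p i false) := rfl

lemma cross_true {d : ℕ} {p : Fin (d+1) → Bool → A}
    (hp : ∀ i β j γ, H.Adj (p i β) (p j γ) ↔ i = j ∧ β ≠ γ) (z : Cx H S) (i : Fin (d+1)) :
    z.1 (p i true) = max (crossw p z.1 i) 0 ∧ z.1 (p i false) = max (-crossw p z.1 i) 0 := by
  rw [crossw_apply]
  have h0 := z.2.1 (p i true)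
  have h1 := z.2.1 (p i false)
  rcases mul_eq_zero.1 (z.2.2.2.2 (p i true) (p i false) ((hp _ _ _ _).2 ⟨rfl, by simp⟩)) with h | h
  · rw [h, max_eq_right (by linarith), max_eq_left (by linarith)]; simp
  · rw [h, max_eq_left (by linarith), max_eq_right (by linarith)]; simp

lemma cross_sum {d : ℕ} {p : Fin (d+1) → Bool → A}
    (hp : ∀ i β j γ, H.Adj (p i β) (p j γ) ↔ i = j ∧ β ≠ γ)
    {z : A → ℝ} (hz : ∀ a, (∀ i β, p i β ≠ a) → z a = 0) :
    ∑ a, z a = ∑ i, (z (p i true) + z (p i false)) := by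
  rw [← Fintype.sum_of_injective (Function.uncurry p) (cross_inj hp)
    (fun q => z (p q.1 q.2)) z ?_ (fun _ => rfl), Fintype.sum_prod_type]
  · simp
  · intro a ha
    exact hz a (fun i β h => ha ⟨(i, β), h⟩)

lemma cross_abs {d : ℕ} {p : Fin (d+1) → Bool → A}
    (hp : ∀ i β j γ, H.Adj (p i β) (p j γ) ↔ i = j ∧ β ≠ γ)
    (hS : ∀ s ∈ S, ∃ i β, p i β = s) (z : Cx H S) : ∑ i, |crossw p z.1 i| = 1 := by
  rw [← z.2.2.1, cross_sum hp]
  · refine Finset.sum_congr rfl fun i _ => ?_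
    rw [(cross_true hp z i).1, (cross_true hp z i).2]
    rcases le_total 0 (crossw p z.1 i) with h | h
    · rw [abs_of_nonneg h, max_eq_left h, max_eq_right (by linarith)]; simp
    · rw [abs_of_nonpos h, max_eq_right h, max_eq_left (by linarith)]; simp
  · intro a ha
    refine z.2.2.2.1 a (fun h => ?_)
    obtain ⟨i, β, h⟩ := hS a h
    exact ha i β h

lemma cross_ne {d : ℕ} {p : Fin (d+1) → Bool → A}
    (hp : ∀ i β j γ, H.Adj (p i β) (p j γ) ↔ i = j ∧ β ≠ γ)
    (hS : ∀ s ∈ S, ∃ i β, p i β = s) (z : Cx H S) : crossw p z.1 ≠ 0 := by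
  intro h
  have := cross_abs hp hS z
  simp [h] at this

lemma PEq.cross {d : ℕ} {p : Fin (d+1) → Bool → A}
    (hp : ∀ i β j γ, H.Adj (p i β) (p j γ) ↔ i = j ∧ β ≠ γ)
    (hS : ∀ s ∈ S, ∃ i β, p i β = s) (hS' : ∀ i β, p i β ∈ S) {e : A} (he : e ∈ S)
    (hep : e = p 0 true) : PEq (vx H he) (spherePt d) := by
  subst hep
  let φ : Cx H S → Metric.sphere (0 : EuclideanSpace ℝ (Fin (d + 1))) 1 := fun z =>
    ⟨‖crossw p z.1‖⁻¹ • crossw p z.1, by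
      have := norm_ne_zero_iff.2 (cross_ne hp hS z)
      simp [norm_smul, this]⟩
  have hφc : Continuous φ := by
    have h1 : Continuous fun z : Cx H S => crossw p z.1 := by
      refine (PiLp.continuous_toLp 2 _).comp (continuous_pi fun i => ?_)
      exact ((continuous_apply _).comp continuous_subtype_val).sub
        ((continuous_apply _).comp continuous_subtype_val)
    refine Continuous.subtype_mk ?_ _
    exact (h1.norm.inv₀ (fun z => norm_ne_zero_iff.2 (cross_ne hp hS z))).smul h1
  have hinj : Function.Injective φ := by
    intro z z' h
    have h1 : ∀ i, ‖crossw p z.1‖⁻¹ * crossw p z.1 i = ‖crossw p z'.1‖⁻¹ * crossw p z'.1 i :=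
      fun i => congrArg (fun u => u.1 i) h
    have hpos := norm_pos_iff.2 (cross_ne hp hS z)
    have hpos' := norm_pos_iff.2 (cross_ne hp hS z')
    have h2 : ‖crossw p z.1‖⁻¹ = ‖crossw p z'.1‖⁻¹ := by
      have e1 : ∑ i, |‖crossw p z.1‖⁻¹ * crossw p z.1 i| = ‖crossw p z.1‖⁻¹ := by
        simp only [abs_mul, ← Finset.mul_sum, cross_abs hp hS z]
        simp
      have e2 : ∑ i, |‖crossw p z'.1‖⁻¹ * crossw p z'.1 i| = ‖crossw p z'.1‖⁻¹ := by
        simp only [abs_mul, ← Finset.mul_sum, cross_abs hp hS z']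
        simp
      rw [← e1, ← e2]; simp only [h1]
    have h3 : ∀ i, crossw p z.1 i = crossw p z'.1 i := by
      intro i
      have := h1 i
      rw [h2] at this
      exact mul_left_cancel₀ (inv_pos.2 hpos').ne' this
    refine Subtype.ext (funext fun a => ?_)
    by_cases ha : a ∈ S
    · obtain ⟨i, β, rfl⟩ := hS a ha
      cases β
      · rw [(cross_true hp z i).2, (cross_true hp z' i).2, h3]
      · rw [(cross_true hp z i).1, (cross_true hp z' i).1, h3]
    · rw [z.2.2.2.1 a ha, z'.2.2.2.1 a ha]
  have hsurj : Function.Surjective φ := by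
    rintro ⟨u, hu⟩
    have hu1 : ‖u‖ = 1 := by simpa using hu
    have hc0 : 0 ≤ ∑ i, |u i| := Finset.sum_nonneg fun i _ => abs_nonneg _
    have hc : 0 < ∑ i, |u i| := by
      refine lt_of_le_of_ne hc0 (fun h => ?_)
      have h' := (Finset.sum_eq_zero_iff_of_nonneg (fun i _ => abs_nonneg (u i))).1 h.symm
      have : u = 0 := by
        ext i; simpa using h' i (Finset.mem_univ i)
      simp [this] at hu1
    set c := ∑ i, |u i| with hcdef
    let z : A → ℝ := Function.extend (Function.uncurry p)
      (fun q => max (if q.2 then u q.1 else - u q.1) 0 / c) 0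
    have zt : ∀ i β, z (p i β) = max (if β then u i else - u i) 0 / c := fun i β =>
      (cross_inj hp).extend_apply _ _ (i, β)
    have z0 : ∀ a, (∀ i β, p i β ≠ a) → z a = 0 := fun a ha =>
      Function.extend_apply' _ _ _ (fun ⟨q, hq⟩ => ha q.1 q.2 hq)
    have zw : ∀ i, z (p i true) - z (p i false) = u i / c := by
      intro i
      simp only [zt, if_true, Bool.false_eq_true, if_false]
      rw [← sub_div]; congr 1
      rcases le_total 0 (u i) with h | h
      · rw [max_eq_left h, max_eq_right (by linarith)]; simp
      · rw [max_eq_right h, max_eq_left (by linarith)]; simp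
    have hz : z ∈ Cx H S := by
      refine ⟨?_, ?_, ?_, ?_⟩
      · intro a
        by_cases ha : ∃ i β, p i β = a
        · obtain ⟨i, β, rfl⟩ := ha
          rw [zt]; positivity
        · push Not at ha
          rw [z0 a ha]
      · rw [cross_sum hp z0]
        have : ∀ i, z (p i true) + z (p i false) = |u i| / c := by
          intro i
          simp only [zt, if_true, Bool.false_eq_true, if_false]
          rw [← add_div]; congr 1
          rcases le_total 0 (u i) with h | h
          · rw [abs_of_nonneg h, max_eq_left h, max_eq_right (by linarith)]; simp
          · rw [abs_of_nonpos h, max_eq_right h, max_eq_left (by linarith)]; simp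
        simp only [this]
        rw [← Finset.sum_div, ← hcdef, div_self hc.ne']
      · intro a ha
        refine z0 a ?_
        rintro i β rfl
        exact ha (hS' i β)
      · intro a b hab
        by_cases ha : ∃ i β, p i β = a
        · by_cases hb : ∃ i β, p i β = b
          · obtain ⟨i, β, rfl⟩ := ha
            obtain ⟨j, γ, rfl⟩ := hb
            obtain ⟨rfl, h⟩ := (hp _ _ _ _).1 hab
            rw [zt, zt]
            rcases le_total 0 (u i) with h' | h' <;> cases β <;> cases γ <;> simp at h ⊢ <;> simp [h']
          · push Not at hb
            rw [z0 b hb, mul_zero]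
        · push Not at ha
          rw [z0 a ha, zero_mul]
    refine ⟨⟨z, hz⟩, Subtype.ext ?_⟩
    have e1 : crossw p z = c⁻¹ • u := by
      ext i
      rw [crossw_apply, zw]; simp [div_eq_inv_mul]
    change ‖crossw p z‖⁻¹ • crossw p z = u
    rw [e1, norm_smul, hu1, smul_smul]
    have : ‖c⁻¹‖ = c⁻¹ := by rw [Real.norm_eq_abs, abs_of_pos (inv_pos.2 hc)]
    rw [this, mul_one, inv_mul_cancel₀ (inv_pos.2 hc).ne', one_smul]
  have base : φ (vx H he) = spherePt d := by
    refine Subtype.ext ?_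
    have e1 : crossw p (vx H he).1 = EuclideanSpace.single 0 1 := by
      ext i
      rw [crossw_apply]
      have hf : (vx H he).1 (p i false) = 0 := by
        refine vx_ne he (fun h => ?_)
        have := @cross_inj _ _ H _ _ hp (i, false) (0, true) h
        simp at this
      rw [hf]
      by_cases hi : i = 0
      · subst hi; simp
      · rw [vx_ne he (fun h => hi (by
          have := @cross_inj _ _ H _ _ hp (i, true) (0, true) h
          simpa using this))]
        simp [hi]
    change ‖crossw p (vx H he).1‖⁻¹ • crossw p (vx H he).1 = EuclideanSpace.single 0 1
    rw [e1]; simp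
  exact PEq.of_homeo (Y := nSphere d) (Continuous.homeoOfEquivCompactToT2
    (Y := Metric.sphere (0 : EuclideanSpace ℝ (Fin (d + 1))) 1)
    (f := Equiv.ofBijective φ ⟨hinj, hsurj⟩) hφc) base
end Cross


section Claims
variable {A : Type*} [Fintype A] {H : SimpleGraph A}

/-- every nonempty set of vertices has a simplicial vertex -/
def Chordy (H : SimpleGraph A) : Prop :=
  ∀ T : Set A, T.Nonempty → ∃ a ∈ T, ∀ b ∈ T, ∀ c ∈ T, H.Adj a b → H.Adj a c → b ≠ c → H.Adj b c

lemma claim_two (hch : Chordy H) (N : ℕ) : ∀ (T : Set A), T.ncard ≤ N → ∀ (d : ℕ)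
    (p : Fin (d+1) → Bool → A),
    (∀ i β j γ, H.Adj (p i β) (p j γ) ↔ i = j ∧ β ≠ γ) →
    (∀ i β, ∀ t ∈ T, p i β ≠ t ∧ ¬ H.Adj (p i β) t) →
    ∀ (S : Set A), (∀ s, s ∈ S ↔ s ∈ T ∨ ∃ i β, p i β = s) →
    ∀ (e : A) (he : e ∈ S), e = p 0 true → Good (vx H he) := by
  induction N with
  | zero =>
    intro T hT d p hp hpT S hS e he hep
    have hT0 : T = ∅ := by
      rwa [Nat.le_zero, Set.ncard_eq_zero] at hT
    subst hT0
    refine Good.of_sphere (PEq.cross hp (fun s hs => ?_) (fun i β => ?_) he hep)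
    · simpa using (hS s).1 hs
    · exact (hS _).2 (Or.inr ⟨i, β, rfl⟩)
  | succ N ih =>
    intro T hT d p hp hpT S hS e he hep
    rcases T.eq_empty_or_nonempty with hT0 | hTn
    · exact ih T (by simp [hT0]) d p hp hpT S hS e he hep
    obtain ⟨a, haT, ha⟩ := hch T hTn
    by_cases hnb : ∃ b ∈ T, H.Adj a b
    · obtain ⟨b, hbT, hab⟩ := hnb
      have hpS : ∀ i β, p i β ∈ S := fun i β => (hS _).2 (Or.inr ⟨i, β, rfl⟩)
      have hTS : ∀ t ∈ T, t ∈ S := fun t ht => (hS _).2 (Or.inl ht)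
      have heb : e ∈ S \ {b} := ⟨he, by rw [hep]; exact (hpT 0 true b hbT).1⟩
      have hcard : ∀ T' : Set A, T' ⊆ T \ {b} → T'.ncard ≤ N := by
        intro T' h
        have h1 := Set.ncard_le_ncard h (Set.toFinite _)
        have h2 := Set.ncard_sdiff_singleton_add_one hbT (Set.toFinite _)
        omega
      have g1 : Good (vx H heb) := by
        refine ih (T \ {b}) (hcard _ subset_rfl) d p hp (fun i β t ht => hpT i β t ht.1) (S \ {b}) ?_
          e heb hep
        intro s
        simp only [Set.mem_sdiff, Set.mem_singleton_iff, hS]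
        constructor
        · rintro ⟨h | h, h'⟩
          · exact Or.inl ⟨h, h'⟩
          · exact Or.inr h
        · rintro (⟨h, h'⟩ | ⟨i, β, rfl⟩)
          · exact ⟨Or.inl h, h'⟩
          · exact ⟨Or.inr ⟨i, β, rfl⟩, (hpT i β b hbT).1⟩
      have ha' : a ∈ ({a, b} ∪ lk H S b : Set A) := by simp
      refine Good.step (hTS b hbT) he heb ⟨hTS a haT, hab.ne⟩ hab ?_ ?_ g1
        (S' := {a, b} ∪ lk H S b) (by intro s; simp [or_assoc]) ha' ?_
      · intro s hs hsb has
        rcases (hS s).1 hs with h | ⟨i, β, rfl⟩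
        · exact ha b hbT s h hab has hsb.symm
        · exact absurd has.symm (hpT i β a haT).2
      · rw [hep]; exact fun h => (hpT 0 true a haT).2 h.symm
      · refine ih {t | t ∈ T ∧ t ≠ b ∧ ¬ H.Adj b t} (hcard _ (fun t ht => ⟨ht.1, ht.2.1⟩)) (d+1)
          (Fin.cons (fun β => if β then a else b) p) ?_ ?_ _ ?_ a ha' (by simp)
        · intro i β j γ
          refine Fin.cases ?_ (fun i => ?_) i <;> refine Fin.cases ?_ (fun j => ?_) j
          · cases β <;> cases γ <;> simp [hab, hab.symm]
          · have h1 : ¬ H.Adj a (p j γ) := fun h => (hpT j γ a haT).2 (H.symm.symm _ _ h)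
            have h2 : ¬ H.Adj b (p j γ) := fun h => (hpT j γ b hbT).2 (H.symm.symm _ _ h)
            cases β <;> simp [h1, h2, (Fin.succ_ne_zero j).symm]
          · have h1 := (hpT i β a haT).2
            have h2 := (hpT i β b hbT).2
            cases γ <;> simp [h1, h2, Fin.succ_ne_zero]
          · simp [hp]
        · intro i β t ht
          refine Fin.cases ?_ (fun i => ?_) i
          · cases β
            · simpa using ⟨ht.2.1.symm, ht.2.2⟩
            · simp only [Fin.cons_zero, if_true]
              refine ⟨?_, fun h => ?_⟩
              · rintro rfl; exact ht.2.2 hab.symm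
              · exact ht.2.2 (ha b hbT t ht.1 hab h ht.2.1.symm)
          · simpa using hpT i β t ht.1
        · intro s
          simp only [Set.mem_union, Set.mem_insert_iff, Set.mem_singleton_iff, lk,
            Set.mem_ofPred_eq, hS]
          constructor
          · rintro ((rfl | rfl) | ⟨h | ⟨i, β, rfl⟩, h1, h2⟩)
            · exact Or.inr ⟨0, true, by simp⟩
            · exact Or.inr ⟨0, false, by simp⟩
            · exact Or.inl ⟨h, h1, h2⟩
            · exact Or.inr ⟨i.succ, β, by simp⟩
          · rintro (⟨h, h1, h2⟩ | ⟨i, β, rfl⟩)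
            · exact Or.inr ⟨Or.inl h, h1, h2⟩
            · refine Fin.cases ?_ (fun i => ?_) i
              · cases β <;> simp
              · right
                simp only [Fin.cons_succ]
                exact ⟨Or.inr ⟨i, β, rfl⟩, (hpT i β b hbT).1,
                  fun h => (hpT i β b hbT).2 (H.symm.symm _ _ h)⟩
    · push Not at hnb
      refine Good.of_unit (cone_contractible ((hS a).2 (Or.inl haT)) he ?_)
      intro s hs
      rcases (hS s).1 hs with h | ⟨i, β, rfl⟩
      · exact hnb s h
      · exact fun h => (hpT i β a haT).2 h.symm

lemma claim_one (hch : Chordy H) (N : ℕ) : ∀ (T : Set A), T.ncard ≤ N → ∀ (e : A) (he : e ∈ T),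
    (∀ b ∈ T, ∀ c ∈ T, H.Adj e b → H.Adj e c → b ≠ c → H.Adj b c) → Good (vx H he) := by
  induction N with
  | zero =>
    intro T hT e he
    rw [Nat.le_zero, Set.ncard_eq_zero] at hT
    simp [hT] at he
  | succ N ih =>
    intro T hT e he hs
    by_cases hnb : ∃ b ∈ T, H.Adj e b
    · obtain ⟨b, hbT, hab⟩ := hnb
      have heb : e ∈ T \ {b} := ⟨he, hab.ne⟩
      have h2 := Set.ncard_sdiff_singleton_add_one hbT (Set.toFinite _)
      have ha' : e ∈ ({e, b} ∪ lk H T b : Set A) := by simp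
      refine Good.step hbT he heb heb hab (fun s hsT hsb h => hs b hbT s hsT hab h hsb.symm)
        (H.loopless.irrefl e) (ih _ (by omega) e heb
          (fun c hc c' hc' => hs c hc.1 c' hc'.1)) (S' := {e, b} ∪ lk H T b)
        (by intro s; simp [or_assoc]) ha' ?_
      refine claim_two hch _ (lk H T b) le_rfl 0 (fun _ β => if β then e else b) ?_ ?_ _ ?_ e ha'
        (by simp)
      · intro i β j γ
        have : i = j := Subsingleton.elim (α := Fin 1) _ _
        cases β <;> cases γ <;> simp [hab, hab.symm, this]
      · rintro i β t ⟨h1, h2, h3⟩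
        cases β
        · simpa using ⟨h2.symm, h3⟩
        · simp only [if_true]
          refine ⟨?_, fun h => ?_⟩
          · rintro rfl; exact h3 hab.symm
          · exact h3 (hs b hbT t h1 hab h h2.symm)
      · intro s
        simp only [Set.mem_union, Set.mem_insert_iff, Set.mem_singleton_iff, exists_const,
          Bool.exists_bool, if_true, Bool.false_eq_true, if_false]
        constructor
        · rintro ((rfl | rfl) | h) <;> simp_all
        · rintro (h | rfl | rfl) <;> simp_all
    · push Not at hnb
      exact Good.of_unit (cone_contractible he he hnb)
end Claims


section Forest
lemma exists_leaf {V : Type*} [Finite V] (K : SimpleGraph V) (hK : K.IsAcyclic) {x y : V}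
    (hxy : K.Adj x y) : ∃ u v, K.Adj u v ∧ ∀ w, K.Adj u w → w = v := by
  have : Nonempty V := ⟨x⟩
  obtain ⟨u, v, p, hp, hmax⟩ := SimpleGraph.Walk.exists_isPath_forall_isPath_length_le_length K
  have h1 := hmax x y _ (SimpleGraph.Path.singleton hxy).2
  have hnil : ¬ p.Nil := by
    intro h
    have h2 := SimpleGraph.Walk.nil_iff_length_eq.1 h
    simp [h2] at h1
  refine ⟨u, p.snd, p.adj_snd hnil, fun w hadj => ?_⟩
  apply hK.eq_snd_of_adj_start hp hadj
  by_contra hw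
  have h3 := hmax _ _ (p.cons hadj.symm) (hp.cons hw)
  simp at h3

variable {V : Type*} [Fintype V]

/-- conflict graph on edges -/
def conflict (G : SimpleGraph V) : SimpleGraph (Sym2 V) where
  Adj e f := e ∈ G.edgeSet ∧ f ∈ G.edgeSet ∧ e ≠ f ∧ ∃ v, v ∈ e ∧ v ∈ f
  symm := ⟨fun _ _ ⟨h1, h2, h3, v, h4, h5⟩ => ⟨h2, h1, h3.symm, v, h5, h4⟩⟩
  loopless := ⟨fun _ h => h.2.2.1 rfl⟩

lemma conflict_chordy (G : SimpleGraph V) (hG : G.IsAcyclic) : Chordy (conflict G) := by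
  intro T hT
  by_cases hTe : ∃ a ∈ T, a ∉ G.edgeSet
  · obtain ⟨a, ha, hae⟩ := hTe
    exact ⟨a, ha, fun b _ c _ h => absurd h.1 hae⟩
  push Not at hTe
  obtain ⟨e, he⟩ := hT
  have hle : SimpleGraph.fromEdgeSet T ≤ G := by
    intro x y h
    rw [SimpleGraph.fromEdgeSet_adj] at h
    exact hTe _ h.1
  induction e using Sym2.ind with
  | _ x y =>
    have hxy : (SimpleGraph.fromEdgeSet T).Adj x y := by
      rw [SimpleGraph.fromEdgeSet_adj]
      exact ⟨he, (hTe _ he : G.Adj x y).ne⟩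
    obtain ⟨u, v, huv, hu⟩ := exists_leaf _ (hG.anti hle) hxy
    rw [SimpleGraph.fromEdgeSet_adj] at huv
    refine ⟨s(u, v), huv.1, ?_⟩
    have key : ∀ b ∈ T, (conflict G).Adj s(u, v) b → v ∈ b := by
      rintro b hb ⟨_, _, hne, w, hw, hwb⟩
      rw [Sym2.mem_iff] at hw
      rcases hw with rfl | rfl
      · obtain ⟨z, rfl⟩ := Sym2.mem_iff_exists.1 hwb
        have := hu z (by
          rw [SimpleGraph.fromEdgeSet_adj]
          exact ⟨hb, (hTe _ hb : G.Adj w z).ne⟩)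
        subst this
        exact absurd rfl hne
      · exact hwb
    intro b hb c hc h1 h2 hbc
    exact ⟨hTe b hb, hTe c hc, hbc, v, key b hb h1, key c hc h2⟩

lemma real_iff (G : SimpleGraph V) (f : Sym2 V → ℝ) :
    ((∀ a, 0 ≤ f a) ∧ ∃ s ∈ matchingComplex G, Function.support f ⊆ ↑s ∧ ∑ a ∈ s, f a = 1) ↔
    f ∈ Cx (conflict G) G.edgeSet := by
  classical
  constructor
  · rintro ⟨h0, s, ⟨hs1, hs2⟩, hsup, hsum⟩
    have hz : ∀ a, a ∉ s → f a = 0 := by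
      intro a ha
      by_contra h
      exact ha (hsup h)
    refine ⟨h0, ?_, fun a ha => hz a (fun h => ha (hs1 a h)), ?_⟩
    · rw [← hsum]
      exact (Finset.sum_subset (Finset.subset_univ s) (fun a _ ha => hz a ha)).symm
    · rintro a b ⟨_, _, hne, v, hva, hvb⟩
      by_cases ha : a ∈ s
      · by_cases hb : b ∈ s
        · exact absurd hvb (hs2 a ha b hb hne v hva)
        · rw [hz b hb, mul_zero]
      · rw [hz a ha, zero_mul]
  · rintro ⟨h0, hsum, hS, hadj⟩
    have hmem : ∀ a, f a ≠ 0 → a ∈ G.edgeSet := fun a h => by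
      by_contra h'; exact h (hS a h')
    refine ⟨h0, Finset.univ.filter (fun a => f a ≠ 0), ⟨?_, ?_⟩, ?_, ?_⟩
    · intro e he
      exact hmem e (by simpa using he)
    · intro e he g hg hne v hv hv'
      simp only [Finset.mem_filter, Finset.mem_univ, true_and] at he hg
      rcases mul_eq_zero.1 (hadj e g ⟨hmem e he, hmem g hg, hne, v, hv, hv'⟩) with h | h
      · exact he h
      · exact hg h
    · intro a ha
      simpa using ha
    · rw [← hsum, Finset.sum_filter_ne_zero]

lemma forest_main (G : SimpleGraph V) (hforest : G.IsAcyclic) :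
    ContractibleSpace (realization (matchingComplex G)) ∨
      IsWedgeOfSpheres (realization (matchingComplex G)) := by
  let φ : realization (matchingComplex G) ≃ₜ Cx (conflict G) G.edgeSet :=
    { toFun := fun z => ⟨z.1, (real_iff G z.1).1 z.2⟩
      invFun := fun z => ⟨z.1, (real_iff G z.1).2 z.2⟩
      left_inv := fun _ => rfl
      right_inv := fun _ => rfl
      continuous_toFun := Continuous.subtype_mk continuous_subtype_val _
      continuous_invFun := Continuous.subtype_mk continuous_subtype_val _ }
  rcases G.edgeSet.eq_empty_or_nonempty with h | h
  · right
    have : IsEmpty (realization (matchingComplex G)) := by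
      refine ⟨fun z => ?_⟩
      obtain ⟨-, h1, h2, -⟩ := (φ z).2
      simp [fun a => h2 a (by simp [h])] at h1
    have : IsEmpty (WedgeOfSpheres (fun _ : Fin 0 => 0)) := by
      refine ⟨?_⟩
      rintro ⟨⟨i, _⟩⟩
      exact i.elim0
    exact ⟨0, fun _ => 0, ⟨(Homeomorph.empty).toHomotopyEquiv⟩⟩
  · obtain ⟨e, he, hs⟩ := conflict_chordy G hforest _ h
    have hg := claim_one (conflict_chordy G hforest) _ _ le_rfl e he hs
    have : Good (φ.symm (vx (conflict G) he)) :=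
      Good.congr (PEq.of_homeo φ (by simp)) hg
    exact this.final
end Forest


end Development

/-- The matching complex of a forest is contractible or homotopy equivalent to a wedge of
spheres. -/
theorem matchingComplex_forest_contractible_or_wedge
    {V : Type*} [Fintype V] (G : SimpleGraph V) (hforest : G.IsAcyclic) :
    ContractibleSpace (realization (matchingComplex G)) ∨
      IsWedgeOfSpheres (realization (matchingComplex G)) := by
  exact forest_main G hforest
end
end
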